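/- Assume a ≥ 2 and b ≥ 2. The kernel of the Foulkes–Howe homomorphism α (i.e., the homogeneous ideal I(X) of the variety X of a-th powers of binary forms of degree b) is generated in degree b+1: ker(α) equals the ideal of S generated by the set of homogeneous polynomials P of degree b+1 with α(P) = 0. (Generation part of Theorem 1.1.) -/

import Mathlib

open MvPolynomial

/-- The generic binary form `G = ∑_{i=0}^{b} u_i x^i y^{b-i}` of degree `b`,
viewed as a polynomial in two variables `x = X 0`, `y = X 1` with coefficients in
`R = MvPolynomial (Fin (b+1)) ℂ`. -/
noncomputable def genForm (b : ℕ) : MvPolynomial (Fin 2) (MvPolynomial (Fin (b + 1)) ℂ) :=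
  ∑ i : Fin (b + 1),
    MvPolynomial.C (MvPolynomial.X i) *
      MvPolynomial.X (0 : Fin 2) ^ (i : ℕ) * MvPolynomial.X (1 : Fin 2) ^ (b - (i : ℕ))

/-- The coefficient `c_j ∈ R` of `x^j y^{ab-j}` in `G^a`. -/
noncomputable def coeffC (a b j : ℕ) : MvPolynomial (Fin (b + 1)) ℂ :=
  MvPolynomial.coeff
    (Finsupp.single (0 : Fin 2) j + Finsupp.single (1 : Fin 2) (a * b - j))
    (genForm b ^ a)

/-- The Foulkes–Howe homomorphism `α : S → R`, `z_j ↦ c_j`. -/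
noncomputable def FH (a b : ℕ) :
    MvPolynomial (Fin (a * b + 1)) ℂ →ₐ[ℂ] MvPolynomial (Fin (b + 1)) ℂ :=
  MvPolynomial.aeval fun j : Fin (a * b + 1) => coeffC a b (j : ℕ)

set_option linter.unusedSectionVars false

section Dunkl

variable {ι : Type*} [DecidableEq ι] {k : Type*} [CommRing k]

/-- The transposition of two variables. -/
noncomputable abbrev swapVar (k : Type*) [CommRing k] (i j : ι) :
    MvPolynomial ι k →ₐ[k] MvPolynomial ι k :=
  rename (Equiv.swap i j)

lemma X_sub_X_dvd_sub_swapVar (i j : ι) (f : MvPolynomial ι k) :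
    X i - X j ∣ f - swapVar k i j f := by
  have h : (Ideal.Quotient.mkₐ k (Ideal.span {(X i - X j : MvPolynomial ι k)})) =
      (Ideal.Quotient.mkₐ k (Ideal.span {(X i - X j : MvPolynomial ι k)})).comp
        (swapVar k i j) := by
    ext l
    simp only [Ideal.Quotient.mkₐ_eq_mk, AlgHom.comp_apply, rename_X]
    rw [Ideal.Quotient.eq, Ideal.mem_span_singleton]
    rcases eq_or_ne l i with rfl | hi
    · simp
    rcases eq_or_ne l j with rfl | hj
    · simp only [Equiv.swap_apply_right]
      exact ⟨-1, by ring⟩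
    · simp [Equiv.swap_apply_of_ne_of_ne hi hj]
  have := DFunLike.congr_fun h f
  simp only [Ideal.Quotient.mkₐ_eq_mk, AlgHom.comp_apply] at this
  rwa [Ideal.Quotient.eq, Ideal.mem_span_singleton] at this

/-- The divided difference of `f` along a transposition. -/
noncomputable def divDiff (i j : ι) (f : MvPolynomial ι k) : MvPolynomial ι k :=
  (X_sub_X_dvd_sub_swapVar i j f).choose

lemma X_sub_X_mul_divDiff (i j : ι) (f : MvPolynomial ι k) :
    (X i - X j) * divDiff i j f = f - swapVar k i j f :=
  (X_sub_X_dvd_sub_swapVar i j f).choose_spec.symm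

lemma X_sub_X_ne_zero [Nontrivial k] {i j : ι} (h : i ≠ j) :
    (X i - X j : MvPolynomial ι k) ≠ 0 := by
  rw [sub_ne_zero]
  exact fun e => h (X_injective e)

variable [IsDomain k]

lemma divDiff_eq_of_mul {i j : ι} (h : i ≠ j) {f g : MvPolynomial ι k}
    (hg : (X i - X j) * g = f - swapVar k i j f) : divDiff i j f = g :=
  mul_left_cancel₀ (X_sub_X_ne_zero h) ((X_sub_X_mul_divDiff i j f).trans hg.symm)

lemma divDiff_eq_zero {i j : ι} (h : i ≠ j) {f : MvPolynomial ι k}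
    (hf : swapVar k i j f = f) : divDiff i j f = 0 :=
  divDiff_eq_of_mul h (by rw [hf]; ring)

lemma divDiff_add {i j : ι} (h : i ≠ j) (f g : MvPolynomial ι k) :
    divDiff i j (f + g) = divDiff i j f + divDiff i j g :=
  divDiff_eq_of_mul h (by
    rw [mul_add, X_sub_X_mul_divDiff, X_sub_X_mul_divDiff, map_add]; ring)

lemma divDiff_smul {i j : ι} (h : i ≠ j) (c : k) (f : MvPolynomial ι k) :
    divDiff i j (c • f) = c • divDiff i j f :=
  divDiff_eq_of_mul h (by
    rw [mul_smul_comm, X_sub_X_mul_divDiff, map_smul, smul_sub])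

lemma divDiff_mul {i j : ι} (h : i ≠ j) (f g : MvPolynomial ι k) :
    divDiff i j (f * g) = f * divDiff i j g + divDiff i j f * swapVar k i j g :=
  divDiff_eq_of_mul h (by
    have h1 := X_sub_X_mul_divDiff i j f
    have h2 := X_sub_X_mul_divDiff i j g
    rw [map_mul]
    linear_combination f * h2 + (swapVar k i j g) * h1)

lemma divDiff_X_left {i j : ι} (h : i ≠ j) : divDiff i j (X i : MvPolynomial ι k) = 1 :=
  divDiff_eq_of_mul h (by simp)

lemma divDiff_X_right {i j : ι} (h : i ≠ j) : divDiff i j (X j : MvPolynomial ι k) = -1 :=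
  divDiff_eq_of_mul h (by simp)

lemma divDiff_X_of_ne {i j l : ι} (h : i ≠ j) (hi : l ≠ i) (hj : l ≠ j) :
    divDiff i j (X l : MvPolynomial ι k) = 0 :=
  divDiff_eq_zero h (by simp [Equiv.swap_apply_of_ne_of_ne hi hj])

lemma rename_divDiff {τ : Type*} [DecidableEq τ] {e : ι → τ} (he : Function.Injective e)
    {i j : ι} (h : i ≠ j) (f : MvPolynomial ι k) :
    rename e (divDiff i j f) = divDiff (e i) (e j) (rename e f) := by
  symm
  refine divDiff_eq_of_mul (he.ne h) ?_
  have := congrArg (rename e) (X_sub_X_mul_divDiff i j f)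
  simp only [map_mul, map_sub, rename_X, rename_rename] at this
  rw [this, rename_rename]
  congr 2
  congr 1
  funext l
  simp only [Function.comp_apply, he.swap_apply]

variable [Fintype ι] {β : Type*} [DecidableEq β]

/-- The other variables with the same colour. -/
def sameColor (χ : ι → β) (i : ι) : Finset ι := {j | j ≠ i ∧ χ j = χ i}

lemma mem_sameColor {χ : ι → β} {i j : ι} : j ∈ sameColor χ i ↔ j ≠ i ∧ χ j = χ i := by
  simp [sameColor]

/-- The Dunkl operator with parameter `κ` attached to the group of
colour-preserving permutations of the variables. -/
noncomputable def dunkl (χ : ι → β) (κ : k) (i : ι) :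
    MvPolynomial ι k →ₗ[k] MvPolynomial ι k where
  toFun f := pderiv i f + κ • ∑ j ∈ sameColor χ i, divDiff i j f
  map_add' f g := by
    rw [map_add, Finset.sum_congr rfl fun j hj =>
      divDiff_add (mem_sameColor.1 hj).1.symm f g, Finset.sum_add_distrib, smul_add]
    abel
  map_smul' c f := by
    rw [Finset.sum_congr rfl fun j hj =>
      divDiff_smul (mem_sameColor.1 hj).1.symm c f, ← Finset.smul_sum]
    simp [smul_comm c κ]

lemma dunkl_apply (χ : ι → β) (κ : k) (i : ι) (f : MvPolynomial ι k) :
    dunkl χ κ i f = pderiv i f + κ • ∑ j ∈ sameColor χ i, divDiff i j f := rfl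

lemma dunkl_of_symm (χ : ι → β) (κ : k) (i : ι) {f : MvPolynomial ι k}
    (hf : ∀ j ∈ sameColor χ i, swapVar k i j f = f) :
    dunkl χ κ i f = pderiv i f := by
  rw [dunkl_apply, Finset.sum_eq_zero fun j hj =>
    divDiff_eq_zero (mem_sameColor.1 hj).1.symm (hf j hj), smul_zero, add_zero]

lemma dunkl_C (χ : ι → β) (κ : k) (i : ι) (c : k) : dunkl χ κ i (C c) = 0 := by
  rw [dunkl_of_symm _ _ _ (by simp), pderiv_C]

/-- The commutator of a Dunkl operator with multiplication by a variable. -/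
noncomputable def dunklX (χ : ι → β) (κ : k) (i l : ι) :
    MvPolynomial ι k →ₗ[k] MvPolynomial ι k :=
  if l = i then
    LinearMap.id + κ • ∑ j ∈ sameColor χ i, (swapVar k i j).toLinearMap
  else if χ l = χ i then -(κ • (swapVar k i l).toLinearMap) else 0

lemma dunklX_self (χ : ι → β) (κ : k) (i : ι) (f : MvPolynomial ι k) :
    dunklX χ κ i i f = f + κ • ∑ j ∈ sameColor χ i, swapVar k i j f := by
  simp [dunklX]

lemma dunklX_of_eq {χ : ι → β} {κ : k} {i l : ι} (h : l ≠ i) (hc : χ l = χ i)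
    (f : MvPolynomial ι k) :
    dunklX χ κ i l f = -(κ • swapVar k i l f) := by
  simp [dunklX, h, hc]

lemma dunklX_of_ne {χ : ι → β} {κ : k} {i l : ι} (hc : χ l ≠ χ i)
    (f : MvPolynomial ι k) :
    dunklX χ κ i l f = 0 := by
  have h : l ≠ i := fun e => hc (e ▸ rfl)
  simp [dunklX, h, hc]

lemma dunkl_X_mul (χ : ι → β) (κ : k) (i l : ι) (f : MvPolynomial ι k) :
    dunkl χ κ i (X l * f) = X l * dunkl χ κ i f + dunklX χ κ i l f := by
  have hs : ∀ j ∈ sameColor χ i, divDiff i j (X l * f) =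
      X l * divDiff i j f + divDiff i j (X l : MvPolynomial ι k) * swapVar k i j f :=
    fun j hj => divDiff_mul (mem_sameColor.1 hj).1.symm _ _
  rw [dunkl_apply, dunkl_apply, Finset.sum_congr rfl hs, Finset.sum_add_distrib,
    ← Finset.mul_sum, Derivation.leibniz, pderiv_X]
  rcases eq_or_ne l i with rfl | hl
  · have e : ∑ j ∈ sameColor χ l, divDiff l j (X l : MvPolynomial ι k) * swapVar k l j f =
        ∑ j ∈ sameColor χ l, swapVar k l j f :=
      Finset.sum_congr rfl fun j hj => by
        rw [divDiff_X_left (mem_sameColor.1 hj).1.symm, one_mul]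
    rw [dunklX_self, e]
    simp only [Pi.single_eq_same, smul_eq_mul, smul_add, mul_add, mul_one, mul_smul_comm]
    ring
  · rw [Pi.single_eq_of_ne hl]
    by_cases hc : χ l = χ i
    · have e : ∑ j ∈ sameColor χ i, divDiff i j (X l : MvPolynomial ι k) * swapVar k i j f =
          -swapVar k i l f := by
        rw [Finset.sum_eq_single_of_mem l (mem_sameColor.2 ⟨hl, hc⟩),
          divDiff_X_right hl.symm, neg_one_mul]
        intro j hj hjl
        rw [divDiff_X_of_ne (mem_sameColor.1 hj).1.symm hl hjl.symm, zero_mul]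
      rw [dunklX_of_eq hl hc, e]
      simp only [smul_eq_mul, smul_add, mul_add, mul_zero, mul_smul_comm, smul_neg]
      ring
    · have e : ∑ j ∈ sameColor χ i, divDiff i j (X l : MvPolynomial ι k) * swapVar k i j f =
          0 := by
        refine Finset.sum_eq_zero fun j hj => ?_
        rw [divDiff_X_of_ne (mem_sameColor.1 hj).1.symm hl, zero_mul]
        rintro rfl
        exact hc (mem_sameColor.1 hj).2
      rw [dunklX_of_ne hc, e]
      simp only [smul_eq_mul, mul_add, mul_zero, mul_smul_comm, add_zero]

lemma sameColor_map {χ : ι → β} {σ : Equiv.Perm ι} (hσ : ∀ l, χ (σ l) = χ l) (i : ι) :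
    (sameColor χ i).map σ.toEmbedding = sameColor χ (σ i) := by
  ext j
  simp only [Finset.mem_map_equiv, mem_sameColor, hσ]
  have : χ (σ.symm j) = χ j := by rw [← hσ (σ.symm j), Equiv.apply_symm_apply]
  rw [this, Ne, Equiv.symm_apply_eq]

lemma rename_dunkl {χ : ι → β} (κ : k) {σ : Equiv.Perm ι} (hσ : ∀ l, χ (σ l) = χ l) (i : ι)
    (f : MvPolynomial ι k) :
    rename σ (dunkl χ κ i f) = dunkl χ κ (σ i) (rename σ f) := by
  rw [dunkl_apply, dunkl_apply, pderiv_rename σ.injective, map_add, map_smul, map_sum,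
    ← sameColor_map hσ, Finset.sum_map]
  congr 2
  refine Finset.sum_congr rfl fun j hj => ?_
  rw [rename_divDiff σ.injective (mem_sameColor.1 hj).1.symm]
  rfl

lemma color_swap {χ : ι → β} {i j : ι} (h : χ j = χ i) (l : ι) :
    χ (Equiv.swap i j l) = χ l := by
  rcases eq_or_ne l i with rfl | hi
  · simp [h]
  rcases eq_or_ne l j with rfl | hj
  · simp [h]
  · rw [Equiv.swap_apply_of_ne_of_ne hi hj]

lemma swapVar_dunkl {χ : ι → β} (κ : k) {i j : ι} (h : χ j = χ i) (l : ι)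
    (f : MvPolynomial ι k) :
    swapVar k i j (dunkl χ κ l f) = dunkl χ κ (Equiv.swap i j l) (swapVar k i j f) :=
  rename_dunkl κ (color_swap h) l f

lemma swapVar_comm (i j : ι) (f : MvPolynomial ι k) : swapVar k i j f = swapVar k j i f := by
  rw [swapVar, swapVar, Equiv.swap_comm]

lemma dunkl_dunklX_self_sub (χ : ι → β) (κ : k) {i j : ι} (hij : i ≠ j)
    (f : MvPolynomial ι k) :
    dunkl χ κ j (dunklX χ κ i i f) - dunklX χ κ i i (dunkl χ κ j f) =
      dunkl χ κ i (dunklX χ κ j i f) - dunklX χ κ j i (dunkl χ κ i f) := by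
  simp only [dunklX_self, map_add, map_smul, map_sum]
  by_cases hc : χ i = χ j
  · have hm : j ∈ sameColor χ i := mem_sameColor.2 ⟨hij.symm, hc.symm⟩
    rw [dunklX_of_eq hij hc, dunklX_of_eq hij hc, ← Finset.add_sum_erase _ _ hm,
      ← Finset.add_sum_erase _ _ hm]
    have : ∑ x ∈ (sameColor χ i).erase j, swapVar k i x (dunkl χ κ j f) =
        ∑ x ∈ (sameColor χ i).erase j, dunkl χ κ j (swapVar k i x f) := by
      refine Finset.sum_congr rfl fun x hx => ?_
      have hx' := Finset.mem_erase.1 hx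
      rw [swapVar_dunkl κ (mem_sameColor.1 hx'.2).2,
        Equiv.swap_apply_of_ne_of_ne hij.symm hx'.1.symm]
    rw [this, swapVar_dunkl κ hc.symm, Equiv.swap_apply_right, swapVar_comm j i,
      swapVar_comm j i, swapVar_dunkl κ hc.symm, Equiv.swap_apply_left]
    simp only [map_neg, map_smul, smul_add]
    abel
  · rw [dunklX_of_ne hc, dunklX_of_ne hc, map_zero]
    have : ∑ x ∈ sameColor χ i, swapVar k i x (dunkl χ κ j f) =
        ∑ x ∈ sameColor χ i, dunkl χ κ j (swapVar k i x f) := by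
      refine Finset.sum_congr rfl fun x hx => ?_
      rw [swapVar_dunkl κ (mem_sameColor.1 hx).2,
        Equiv.swap_apply_of_ne_of_ne hij.symm]
      rintro rfl
      exact hc (mem_sameColor.1 hx).2.symm
    rw [this]
    abel

lemma dunkl_dunklX_sub (χ : ι → β) (κ : k) {i j : ι} (hij : i ≠ j) (l : ι)
    (f : MvPolynomial ι k) :
    dunkl χ κ j (dunklX χ κ i l f) - dunklX χ κ i l (dunkl χ κ j f) =
      dunkl χ κ i (dunklX χ κ j l f) - dunklX χ κ j l (dunkl χ κ i f) := by
  rcases eq_or_ne l i with rfl | hi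
  · exact dunkl_dunklX_self_sub χ κ hij f
  rcases eq_or_ne l j with rfl | hj
  · exact (dunkl_dunklX_self_sub χ κ hij.symm f).symm
  have key : ∀ {i j : ι}, i ≠ j → l ≠ i → l ≠ j →
      dunkl χ κ j (dunklX χ κ i l f) - dunklX χ κ i l (dunkl χ κ j f) = 0 := by
    intro i j hij hi hj
    by_cases hc : χ l = χ i
    · rw [dunklX_of_eq hi hc, dunklX_of_eq hi hc, swapVar_dunkl κ hc,
        Equiv.swap_apply_of_ne_of_ne hij.symm hj.symm, map_neg, map_smul, sub_self]
    · rw [dunklX_of_ne hc, dunklX_of_ne hc, map_zero, sub_zero]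
  rw [key hij hi hj, key hij.symm hj hi]

theorem dunkl_comm (χ : ι → β) (κ : k) (i j : ι) (f : MvPolynomial ι k) :
    dunkl χ κ i (dunkl χ κ j f) = dunkl χ κ j (dunkl χ κ i f) := by
  rcases eq_or_ne i j with rfl | hij
  · rfl
  induction f using MvPolynomial.induction_on with
  | C c => simp [dunkl_C]
  | add p q hp hq => simp only [map_add, hp, hq]
  | mul_X p l ih =>
    rw [mul_comm, dunkl_X_mul, dunkl_X_mul, map_add, map_add, dunkl_X_mul, dunkl_X_mul, ih]
    linear_combination dunkl_dunklX_sub χ κ hij.symm l p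

end Dunkl

open scoped IsMulCommutative in
/-- Evaluation of a polynomial at a family of commuting elements of an algebra. -/
theorem exists_algHom_of_commute {ι k A : Type*} [CommRing k] [Ring A] [Algebra k A]
    (t : ι → A) (ht : ∀ i j, t i * t j = t j * t i) :
    ∃ D : MvPolynomial ι k →ₐ[k] A, ∀ i, D (X i) = t i := by
  have hc : IsMulCommutative (Algebra.adjoin k (Set.range t)) :=
    Algebra.isMulCommutative_adjoin k (by
      rintro _ ⟨i, rfl⟩ _ ⟨j, rfl⟩
      exact ht i j)
  let D : MvPolynomial ι k →ₐ[k] Algebra.adjoin k (Set.range t) :=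
    aeval fun i => ⟨t i, Algebra.subset_adjoin ⟨i, rfl⟩⟩
  exact ⟨(Algebra.adjoin k (Set.range t)).val.comp D, fun i => by simp [D]⟩

section Pairing

variable {ι : Type*} [DecidableEq ι] {k : Type*} [CommRing k] [IsDomain k]
  [Fintype ι] {β : Type*} [DecidableEq β]

/-- The action of polynomials by Dunkl operators. -/
noncomputable def dunklHom (χ : ι → β) (κ : k) :
    MvPolynomial ι k →ₐ[k] Module.End k (MvPolynomial ι k) :=
  (exists_algHom_of_commute (k := k) (dunkl χ κ) fun i j =>
    LinearMap.ext fun f => dunkl_comm χ κ i j f).choose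

lemma dunklHom_X (χ : ι → β) (κ : k) (i : ι) : dunklHom χ κ (X i) = dunkl χ κ i :=
  (exists_algHom_of_commute (k := k) (dunkl χ κ) fun i j =>
    LinearMap.ext fun f => dunkl_comm χ κ i j f).choose_spec i

lemma dunklHom_C (χ : ι → β) (κ : k) (c : k) (f : MvPolynomial ι k) :
    dunklHom χ κ (C c) f = c • f := by
  rw [← algebraMap_eq, AlgHom.commutes, Module.algebraMap_end_apply]

lemma dunklHom_mul (χ : ι → β) (κ : k) (p q f : MvPolynomial ι k) :
    dunklHom χ κ (p * q) f = dunklHom χ κ p (dunklHom χ κ q f) := by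
  rw [map_mul, Module.End.mul_apply]

lemma dunklHom_X_mul (χ : ι → β) (κ : k) (i : ι) (p f : MvPolynomial ι k) :
    dunklHom χ κ (X i * p) f = dunklHom χ κ p (dunkl χ κ i f) := by
  rw [mul_comm, dunklHom_mul, dunklHom_X]

/-- The Dunkl pairing. -/
noncomputable def dunklPairing (χ : ι → β) (κ : k) (p q : MvPolynomial ι k) : k :=
  constantCoeff (dunklHom χ κ p q)

lemma rename_dunklHom {χ : ι → β} (κ : k) {σ : Equiv.Perm ι} (hσ : ∀ l, χ (σ l) = χ l)
    (p f : MvPolynomial ι k) :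
    rename σ (dunklHom χ κ p f) = dunklHom χ κ (rename σ p) (rename σ f) := by
  induction p using MvPolynomial.induction_on generalizing f with
  | C c => simp
  | add p q hp hq => simp only [map_add, LinearMap.add_apply, hp, hq]
  | mul_X p l ih =>
    rw [mul_comm, dunklHom_X_mul, ih, map_mul, rename_X, dunklHom_X_mul, rename_dunkl κ hσ]

variable (χ : ι → β) (κ : k)

lemma dunklPairing_add_left (p q f : MvPolynomial ι k) :
    dunklPairing χ κ (p + q) f = dunklPairing χ κ p f + dunklPairing χ κ q f := by
  simp [dunklPairing]

lemma dunklPairing_add_right (p f g : MvPolynomial ι k) :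
    dunklPairing χ κ p (f + g) = dunklPairing χ κ p f + dunklPairing χ κ p g := by
  simp [dunklPairing]

lemma dunklPairing_C_left (c : k) (f : MvPolynomial ι k) :
    dunklPairing χ κ (C c) f = c * constantCoeff f := by
  simp [dunklPairing]

lemma dunklPairing_smul_left (c : k) (p f : MvPolynomial ι k) :
    dunklPairing χ κ (c • p) f = c * dunklPairing χ κ p f := by
  simp [dunklPairing]

lemma dunklPairing_smul_right (c : k) (p f : MvPolynomial ι k) :
    dunklPairing χ κ p (c • f) = c * dunklPairing χ κ p f := by
  simp [dunklPairing]

lemma dunklPairing_X_mul (i : ι) (p f : MvPolynomial ι k) :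
    dunklPairing χ κ (X i * p) f = dunklPairing χ κ p (dunkl χ κ i f) := by
  rw [dunklPairing, dunklHom_X_mul, dunklPairing]

lemma dunklPairing_zero_left (f : MvPolynomial ι k) : dunklPairing χ κ 0 f = 0 := by
  simp [dunklPairing]

lemma dunklPairing_zero_right (f : MvPolynomial ι k) : dunklPairing χ κ f 0 = 0 := by
  simp [dunklPairing]

lemma dunklPairing_C_right (p : MvPolynomial ι k) (c : k) :
    dunklPairing χ κ p (C c) = constantCoeff p * c := by
  induction p using MvPolynomial.induction_on with
  | C d => simp [dunklPairing_C_left]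
  | add p q hp hq => rw [dunklPairing_add_left, hp, hq, map_add, add_mul]
  | mul_X p l ih =>
    rw [mul_comm, dunklPairing_X_mul, dunkl_C, dunklPairing_zero_right]
    simp

variable {χ}

lemma dunklPairing_swapVar_left {i j : ι} (h : χ j = χ i) (p f : MvPolynomial ι k) :
    dunklPairing χ κ (swapVar k i j p) f = dunklPairing χ κ p (swapVar k i j f) := by
  have h1 := rename_dunklHom κ (color_swap h) p (swapVar k i j f)
  have h2 : swapVar k i j (swapVar k i j f) = f := by
    rw [rename_rename, ← Equiv.coe_trans, ← Equiv.Perm.mul_def, Equiv.swap_mul_self]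
    exact rename_id_apply f
  rw [h2] at h1
  rw [dunklPairing, ← h1, dunklPairing, constantCoeff_rename]

variable (χ)

lemma dunklPairing_dunklX (i j : ι) (p f : MvPolynomial ι k) :
    dunklPairing χ κ p (dunklX χ κ j i f) = dunklPairing χ κ (dunklX χ κ i j p) f := by
  rcases eq_or_ne i j with rfl | hij
  · rw [dunklX_self, dunklX_self, dunklPairing_add_left, dunklPairing_add_right,
      dunklPairing_smul_left, dunklPairing_smul_right]
    congr 2
    have h1 : dunklPairing χ κ p (∑ j ∈ sameColor χ i, swapVar k i j f) =
        ∑ j ∈ sameColor χ i, dunklPairing χ κ p (swapVar k i j f) := by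
      simp [dunklPairing]
    have h2 : dunklPairing χ κ (∑ j ∈ sameColor χ i, swapVar k i j p) f =
        ∑ j ∈ sameColor χ i, dunklPairing χ κ (swapVar k i j p) f := by
      simp [dunklPairing]
    rw [h1, h2]
    exact Finset.sum_congr rfl fun j hj =>
      (dunklPairing_swapVar_left κ (mem_sameColor.1 hj).2 p f).symm
  · by_cases hc : χ i = χ j
    · rw [dunklX_of_eq hij hc, dunklX_of_eq hij.symm hc.symm, ← neg_smul, ← neg_smul,
        dunklPairing_smul_left, dunklPairing_smul_right,
        dunklPairing_swapVar_left κ hc.symm, swapVar_comm]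
    · rw [dunklX_of_ne hc, dunklX_of_ne (Ne.symm hc), dunklPairing_zero_left,
        dunklPairing_zero_right]

lemma dunklPairing_mul_X (i : ι) (p f : MvPolynomial ι k) :
    dunklPairing χ κ p (X i * f) = dunklPairing χ κ (dunkl χ κ i p) f := by
  induction p using MvPolynomial.induction_on generalizing f with
  | C c => simp [dunkl_C, dunklPairing_zero_left, dunklPairing_C_left]
  | add p q hp hq => rw [dunklPairing_add_left, map_add, dunklPairing_add_left, hp, hq]
  | mul_X p j ih =>
    rw [mul_comm, dunklPairing_X_mul, dunkl_X_mul, dunklPairing_add_right, ih,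
      dunkl_X_mul, dunklPairing_add_left, dunklPairing_X_mul, dunklPairing_dunklX]

theorem dunklPairing_comm (p q : MvPolynomial ι k) :
    dunklPairing χ κ p q = dunklPairing χ κ q p := by
  induction q using MvPolynomial.induction_on generalizing p with
  | C c => rw [dunklPairing_C_left, dunklPairing_C_right, mul_comm]
  | add f g hf hg => rw [dunklPairing_add_left, dunklPairing_add_right, hf, hg]
  | mul_X f i ih => rw [mul_comm, dunklPairing_mul_X, dunklPairing_X_mul, ih]

variable {k' : Type*} [CommRing k'] [IsDomain k'] (φ : k →+* k')

lemma map_dunkl (i : ι) (f : MvPolynomial ι k) :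
    MvPolynomial.map φ (dunkl χ κ i f) = dunkl χ (φ κ) i (MvPolynomial.map φ f) := by
  rw [dunkl_apply, dunkl_apply, map_add, pderiv_map, smul_eq_C_mul, map_mul, map_sum, map_C,
    ← smul_eq_C_mul]
  congr 2
  refine Finset.sum_congr rfl fun j hj => ?_
  symm
  refine divDiff_eq_of_mul (mem_sameColor.1 hj).1.symm ?_
  have := congrArg (MvPolynomial.map φ) (X_sub_X_mul_divDiff i j f)
  simpa [map_rename] using this

lemma map_dunklHom (p f : MvPolynomial ι k) :
    MvPolynomial.map φ (dunklHom χ κ p f) =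
      dunklHom χ (φ κ) (MvPolynomial.map φ p) (MvPolynomial.map φ f) := by
  induction p using MvPolynomial.induction_on generalizing f with
  | C c => simp [smul_eq_C_mul]
  | add p q hp hq => simp only [map_add, LinearMap.add_apply, hp, hq]
  | mul_X p l ih =>
    rw [mul_comm, dunklHom_X_mul, ih, map_mul, map_X, dunklHom_X_mul, map_dunkl]

lemma map_dunklPairing (p f : MvPolynomial ι k) :
    φ (dunklPairing χ κ p f) =
      dunklPairing χ (φ κ) (MvPolynomial.map φ p) (MvPolynomial.map φ f) := by
  rw [dunklPairing, dunklPairing, ← map_dunklHom, constantCoeff_map]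

end Pairing

lemma Derivation.map_finsetProd {R A ι : Type*} [CommSemiring R] [CommSemiring A] [Algebra R A]
    [DecidableEq ι] (D : Derivation R A A) (s : Finset ι) (f : ι → A) :
    D (∏ i ∈ s, f i) = ∑ i ∈ s, (∏ j ∈ s.erase i, f j) * D (f i) := by
  induction s using Finset.induction_on with
  | empty => simp
  | insert i s hi ih =>
    rw [Finset.prod_insert hi, D.leibniz, ih, Finset.sum_insert hi, Finset.erase_insert hi,
      smul_eq_mul, smul_eq_mul, Finset.mul_sum, add_comm]
    congr 1
    refine Finset.sum_congr rfl fun j hj => ?_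
    have hij : i ≠ j := fun e => hi (e ▸ hj)
    rw [Finset.erase_insert_of_ne hij, Finset.prod_insert fun h => hi (Finset.mem_of_mem_erase h),
      mul_assoc]

lemma apply_neg_pow_apply {R V : Type*} [CommRing R] [AddCommGroup V] [Module R V]
    {T S : Module.End R V} (h : ∀ f, T (S f) = S (T f)) (n : ℕ) (f : V) :
    T (((-S) ^ n) f) = ((-S) ^ n) (T f) := by
  induction n with
  | zero => simp
  | succ n ih => simp only [pow_succ', Module.End.mul_apply, LinearMap.neg_apply, map_neg, h, ih]

section Kernel

variable {ι : Type*} [DecidableEq ι] [Fintype ι] {k : Type*} [CommRing k]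

/-- The colouring of a single block of variables. -/
abbrev oneColor (ι : Type*) : ι → Unit := fun _ => ()

/-- The colouring of two blocks of variables. -/
abbrev twoColor (ι : Type*) : ι ⊕ ι → Bool := Sum.isLeft

/-- The kernel `∏ (s_i - y_j)^a`. -/
noncomputable def cauchyKernel (ι k : Type*) [Fintype ι] [CommRing k] (a : ℕ) :
    MvPolynomial (ι ⊕ ι) k :=
  ∏ p : ι × ι, (X (Sum.inl p.1) - X (Sum.inr p.2)) ^ a

/-- The kernel divided by one linear factor. -/
noncomputable def cauchyQuot (k : Type*) [CommRing k] (a : ℕ) (i j : ι) :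
    MvPolynomial (ι ⊕ ι) k :=
  (∏ p ∈ Finset.univ.erase (i, j), (X (Sum.inl p.1) - X (Sum.inr p.2)) ^ a) *
    (X (Sum.inl i) - X (Sum.inr j)) ^ (a - 1)

lemma mul_cauchyQuot {a : ℕ} (ha : a ≠ 0) (i j : ι) :
    (X (Sum.inl i) - X (Sum.inr j)) * cauchyQuot k a i j = cauchyKernel ι k a := by
  rw [cauchyKernel, ← Finset.mul_prod_erase _ _ (Finset.mem_univ (i, j)), cauchyQuot,
    ← mul_pow_sub_one ha]
  ring

lemma pderiv_inl_cauchyKernel (a : ℕ) (i : ι) :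
    pderiv (Sum.inl i) (cauchyKernel ι k a) = a • ∑ j, cauchyQuot k a i j := by
  rw [cauchyKernel, Derivation.map_finsetProd, Fintype.sum_prod_type,
    Finset.sum_eq_single_of_mem i (Finset.mem_univ _), Finset.smul_sum]
  · refine Finset.sum_congr rfl fun j _ => ?_
    simp only [Derivation.leibniz_pow, map_sub, pderiv_X_self, cauchyQuot]
    rw [pderiv_X_of_ne (by simp)]
    simp only [nsmul_eq_mul, smul_eq_mul]
    ring
  · intro i' _ hi'
    refine Finset.sum_eq_zero fun j _ => ?_
    simp only [Derivation.leibniz_pow, map_sub]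
    rw [pderiv_X_of_ne (by simpa using hi'), pderiv_X_of_ne (by simp)]
    simp

lemma pderiv_inr_cauchyKernel (a : ℕ) (j : ι) :
    pderiv (Sum.inr j) (cauchyKernel ι k a) = -(a • ∑ i, cauchyQuot k a i j) := by
  rw [cauchyKernel, Derivation.map_finsetProd, Fintype.sum_prod_type_right,
    Finset.sum_eq_single_of_mem j (Finset.mem_univ _), Finset.smul_sum, ← Finset.sum_neg_distrib]
  · refine Finset.sum_congr rfl fun i _ => ?_
    simp only [Derivation.leibniz_pow, map_sub, pderiv_X_self, cauchyQuot]
    rw [pderiv_X_of_ne (by simp)]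
    simp only [nsmul_eq_mul, smul_eq_mul]
    ring
  · intro j' _ hj'
    refine Finset.sum_eq_zero fun i _ => ?_
    simp only [Derivation.leibniz_pow, map_sub]
    rw [pderiv_X_of_ne (by simp), pderiv_X_of_ne (by simpa using hj')]
    simp

lemma rename_cauchyKernel (a : ℕ) (σ τ : Equiv.Perm ι) :
    rename (Equiv.sumCongr σ τ) (cauchyKernel ι k a) = cauchyKernel ι k a := by
  simp only [cauchyKernel, map_prod, map_pow, map_sub, rename_X, Equiv.sumCongr_apply,
    Sum.map_inl, Sum.map_inr]
  exact Fintype.prod_equiv (Equiv.prodCongr σ τ) _ _ fun p => rfl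

lemma swap_inl (i j : ι) : Equiv.swap (Sum.inl i : ι ⊕ ι) (Sum.inl j) =
    Equiv.sumCongr (Equiv.swap i j) 1 := by
  rw [← Equiv.Perm.sumCongr_swap_one]

lemma swap_inr (i j : ι) : Equiv.swap (Sum.inr i : ι ⊕ ι) (Sum.inr j) =
    Equiv.sumCongr 1 (Equiv.swap i j) := by
  rw [← Equiv.Perm.sumCongr_one_swap]

lemma swapVar_cauchyKernel (a : ℕ) {i j : ι ⊕ ι} (h : twoColor ι j = twoColor ι i) :
    swapVar k i j (cauchyKernel ι k a) = cauchyKernel ι k a := by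
  rcases i with i | i <;> rcases j with j | j
  · rw [swapVar, swap_inl, rename_cauchyKernel]
  · simp at h
  · simp at h
  · rw [swapVar, swap_inr, rename_cauchyKernel]

variable [IsDomain k]

lemma rename_cauchyQuot {a : ℕ} (ha : a ≠ 0) (σ τ : Equiv.Perm ι) (i j : ι) :
    rename (Equiv.sumCongr σ τ) (cauchyQuot k a i j) = cauchyQuot k a (σ i) (τ j) := by
  have h : (X (Sum.inl (σ i)) - X (Sum.inr (τ j)) : MvPolynomial (ι ⊕ ι) k) ≠ 0 :=
    X_sub_X_ne_zero (by simp)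
  refine mul_left_cancel₀ h ?_
  rw [mul_cauchyQuot ha, ← rename_cauchyKernel a σ τ, ← mul_cauchyQuot ha i j]
  simp

lemma sameColor_inl (i : ι) :
    sameColor (twoColor ι) (Sum.inl i) =
      (Finset.univ.erase i).map ⟨Sum.inl, Sum.inl_injective⟩ := by
  ext x
  rcases x with x | x <;> simp [mem_sameColor]

lemma sameColor_inr (i : ι) :
    sameColor (twoColor ι) (Sum.inr i) =
      (Finset.univ.erase i).map ⟨Sum.inr, Sum.inr_injective⟩ := by
  ext x
  rcases x with x | x <;> simp [mem_sameColor]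

lemma dunkl_inl_cauchyKernel (a : ℕ) (κ : k) (i : ι) :
    dunkl (twoColor ι) κ (Sum.inl i) (cauchyKernel ι k a) = a • ∑ j, cauchyQuot k a i j := by
  rw [dunkl_of_symm _ _ _ fun j hj => swapVar_cauchyKernel a (mem_sameColor.1 hj).2,
    pderiv_inl_cauchyKernel]

lemma dunkl_inr_cauchyKernel (a : ℕ) (κ : k) (j : ι) :
    dunkl (twoColor ι) κ (Sum.inr j) (cauchyKernel ι k a) = -(a • ∑ i, cauchyQuot k a i j) := by
  rw [dunkl_of_symm _ _ _ fun j hj => swapVar_cauchyKernel a (mem_sameColor.1 hj).2,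
    pderiv_inr_cauchyKernel]

lemma dunkl_inl_cauchyQuot {a : ℕ} (ha : a ≠ 0) (i j : ι) :
    dunkl (twoColor ι) (-a : k) (Sum.inl i) (cauchyQuot k a i j) =
      -dunkl (twoColor ι) (-a : k) (Sum.inr j) (cauchyQuot k a i j) := by
  have h1 := dunkl_inl_cauchyKernel a (-a : k) i
  have h2 := dunkl_inr_cauchyKernel a (-a : k) j
  rw [← mul_cauchyQuot ha i j, sub_mul, map_sub, dunkl_X_mul, dunkl_X_mul, dunklX_self,
    dunklX_of_ne (by simp), sameColor_inl, Finset.sum_map] at h1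
  rw [← mul_cauchyQuot ha i j, sub_mul, map_sub, dunkl_X_mul, dunkl_X_mul, dunklX_self,
    dunklX_of_ne (by simp), sameColor_inr, Finset.sum_map] at h2
  simp only [Function.Embedding.coeFn_mk, swapVar, swap_inl, swap_inr, rename_cauchyQuot ha,
    Equiv.swap_apply_left, Equiv.Perm.coe_one, id] at h1 h2
  rw [← Finset.add_sum_erase _ _ (Finset.mem_univ j)] at h1
  rw [← Finset.add_sum_erase _ _ (Finset.mem_univ i)] at h2
  have h : (X (Sum.inl i) - X (Sum.inr j) : MvPolynomial (ι ⊕ ι) k) ≠ 0 :=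
    X_sub_X_ne_zero (by simp)
  refine mul_left_cancel₀ h ?_
  simp only [smul_eq_C_mul, map_neg, map_natCast, nsmul_eq_mul] at h1 h2
  linear_combination h1 + h2

lemma dunkl_inl_pow_cauchyQuot {a : ℕ} (ha : a ≠ 0) (i j : ι) (n : ℕ) :
    (dunkl (twoColor ι) (-a : k) (Sum.inl i) ^ n) (cauchyQuot k a i j) =
      ((-dunkl (twoColor ι) (-a : k) (Sum.inr j)) ^ n) (cauchyQuot k a i j) := by
  induction n with
  | zero => simp
  | succ n ih =>
    rw [pow_succ', Module.End.mul_apply, ih,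
      apply_neg_pow_apply (dunkl_comm _ _ _ _), dunkl_inl_cauchyQuot ha, pow_succ,
      Module.End.mul_apply, LinearMap.neg_apply]

theorem sum_dunkl_pow_cauchyKernel {a : ℕ} (ha : a ≠ 0) (n : ℕ) :
    ∑ i : ι, (dunkl (twoColor ι) (-a : k) (Sum.inl i) ^ (n + 1)) (cauchyKernel ι k a) =
      ∑ j : ι, ((-dunkl (twoColor ι) (-a : k) (Sum.inr j)) ^ (n + 1)) (cauchyKernel ι k a) := by
  simp only [pow_succ, Module.End.mul_apply, dunkl_inl_cauchyKernel, LinearMap.neg_apply,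
    dunkl_inr_cauchyKernel, neg_neg, map_nsmul, map_sum, dunkl_inl_pow_cauchyQuot ha]
  rw [← Finset.smul_sum, ← Finset.smul_sum, Finset.sum_comm]

end Kernel

section Slice

variable {ι : Type*} [DecidableEq ι] [Fintype ι] {k : Type*} [CommRing k]

/-- Linear maps that extract a linear functional in the first block of variables. -/
structure IsSlice (L : MvPolynomial (ι ⊕ ι) k →ₗ[k] MvPolynomial ι k) : Prop where
  map_inr_mul : ∀ q f, L (rename Sum.inr q * f) = q * L f
  map_inl : ∀ p, ∃ c, L (rename Sum.inl p) = C c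

lemma IsSlice.add {L L' : MvPolynomial (ι ⊕ ι) k →ₗ[k] MvPolynomial ι k}
    (h : IsSlice L) (h' : IsSlice L') : IsSlice (L + L') where
  map_inr_mul q f := by
    rw [LinearMap.add_apply, LinearMap.add_apply, h.map_inr_mul, h'.map_inr_mul, mul_add]
  map_inl p := by
    obtain ⟨c, hc⟩ := h.map_inl p
    obtain ⟨c', hc'⟩ := h'.map_inl p
    exact ⟨c + c', by rw [LinearMap.add_apply, hc, hc', map_add]⟩

lemma IsSlice.zero : IsSlice (0 : MvPolynomial (ι ⊕ ι) k →ₗ[k] MvPolynomial ι k) where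
  map_inr_mul q f := by simp
  map_inl p := ⟨0, by simp⟩

lemma IsSlice.smul {L : MvPolynomial (ι ⊕ ι) k →ₗ[k] MvPolynomial ι k}
    (h : IsSlice L) (c : k) : IsSlice (c • L) where
  map_inr_mul q f := by
    rw [LinearMap.smul_apply, LinearMap.smul_apply, h.map_inr_mul, mul_smul_comm]
  map_inl p := by
    obtain ⟨d, hd⟩ := h.map_inl p
    exact ⟨c * d, by rw [LinearMap.smul_apply, hd, smul_eq_C_mul, map_mul]⟩

lemma IsSlice.sum {τ : Type*} (s : Finset τ)
    {L : τ → MvPolynomial (ι ⊕ ι) k →ₗ[k] MvPolynomial ι k}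
    (h : ∀ i ∈ s, IsSlice (L i)) : IsSlice (∑ i ∈ s, L i) := by
  classical
  induction s using Finset.induction_on with
  | empty => simpa using IsSlice.zero
  | insert i s hi ih =>
    rw [Finset.sum_insert hi]
    exact (h i (by simp)).add (ih fun j hj => h j (by simp [hj]))

lemma induction_inl_mul_inr {P : MvPolynomial (ι ⊕ ι) k → Prop}
    (hadd : ∀ f g, P f → P g → P (f + g))
    (hmul : ∀ p q, P (rename Sum.inl p * rename Sum.inr q)) (f : MvPolynomial (ι ⊕ ι) k) :
    P f := by
  suffices h : ∀ p q, P (f * (rename Sum.inl p * rename Sum.inr q)) by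
    simpa using h 1 1
  induction f using MvPolynomial.induction_on with
  | C c =>
    intro p q
    have := hmul (C c * p) q
    rwa [map_mul, rename_C, mul_assoc] at this
  | add f g hf hg =>
    intro p q
    rw [add_mul]
    exact hadd _ _ (hf p q) (hg p q)
  | mul_X f i ih =>
    intro p q
    rcases i with i | i
    · have := ih (X i * p) q
      rwa [map_mul, rename_X, mul_assoc, ← mul_assoc] at this
    · have := ih p (X i * q)
      rw [map_mul, rename_X] at this
      convert this using 1
      ring

variable [IsDomain k]

lemma dunkl_mul_of_symm {σ β : Type*} [DecidableEq σ] [Fintype σ] [DecidableEq β] (χ : σ → β)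
    (κ : k) (i : σ) {f : MvPolynomial σ k} (hf : ∀ j ∈ sameColor χ i, swapVar k i j f = f)
    (hd : pderiv i f = 0) (g : MvPolynomial σ k) :
    dunkl χ κ i (f * g) = f * dunkl χ κ i g := by
  have e : ∑ j ∈ sameColor χ i, divDiff i j (f * g) = f * ∑ j ∈ sameColor χ i, divDiff i j g := by
    rw [Finset.mul_sum]
    refine Finset.sum_congr rfl fun j hj => ?_
    have hij := (mem_sameColor.1 hj).1.symm
    rw [divDiff_mul hij, divDiff_eq_zero hij (hf j hj), zero_mul, add_zero]
  rw [dunkl_apply, dunkl_apply, e, Derivation.leibniz, hd]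
  simp only [smul_eq_mul, mul_zero, add_zero, mul_add, mul_smul_comm]

lemma pderiv_inl_rename_inr (i : ι) (q : MvPolynomial ι k) :
    pderiv (Sum.inl i) (rename (Sum.inr : ι → ι ⊕ ι) q) = 0 := by
  induction q using MvPolynomial.induction_on with
  | C c => simp
  | add p q hp hq => simp [hp, hq]
  | mul_X p j ih => simp [ih]

lemma pderiv_inr_rename_inl (i : ι) (q : MvPolynomial ι k) :
    pderiv (Sum.inr i) (rename (Sum.inl : ι → ι ⊕ ι) q) = 0 := by
  induction q using MvPolynomial.induction_on with
  | C c => simp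
  | add p q hp hq => simp [hp, hq]
  | mul_X p j ih => simp [ih]

lemma dunkl_inl_inr_mul (κ : k) (i : ι) (q : MvPolynomial ι k) (f : MvPolynomial (ι ⊕ ι) k) :
    dunkl (twoColor ι) κ (Sum.inl i) (rename Sum.inr q * f) =
      rename Sum.inr q * dunkl (twoColor ι) κ (Sum.inl i) f := by
  refine dunkl_mul_of_symm _ _ _ (fun j hj => ?_) (pderiv_inl_rename_inr i q) f
  rw [sameColor_inl, Finset.mem_map] at hj
  obtain ⟨j, -, rfl⟩ := hj
  simp only [Function.Embedding.coeFn_mk, swapVar, swap_inl, rename_rename]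
  congr 1

lemma dunkl_inr_inl_mul (κ : k) (i : ι) (q : MvPolynomial ι k) (f : MvPolynomial (ι ⊕ ι) k) :
    dunkl (twoColor ι) κ (Sum.inr i) (rename Sum.inl q * f) =
      rename Sum.inl q * dunkl (twoColor ι) κ (Sum.inr i) f := by
  refine dunkl_mul_of_symm _ _ _ (fun j hj => ?_) (pderiv_inr_rename_inl i q) f
  rw [sameColor_inr, Finset.mem_map] at hj
  obtain ⟨j, -, rfl⟩ := hj
  simp only [Function.Embedding.coeFn_mk, swapVar, swap_inr, rename_rename]
  congr 1

lemma sameColor_oneColor (i : ι) : sameColor (oneColor ι) i = Finset.univ.erase i := by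
  ext x
  simp [mem_sameColor]

lemma dunkl_inl_rename (κ : k) (i : ι) (p : MvPolynomial ι k) :
    dunkl (twoColor ι) κ (Sum.inl i) (rename Sum.inl p) =
      rename Sum.inl (dunkl (oneColor ι) κ i p) := by
  rw [dunkl_apply, dunkl_apply, map_add, pderiv_rename Sum.inl_injective, map_smul, map_sum,
    sameColor_inl, sameColor_oneColor, Finset.sum_map]
  congr 2
  refine Finset.sum_congr rfl fun j hj => ?_
  rw [rename_divDiff Sum.inl_injective (Finset.ne_of_mem_erase hj).symm]
  rfl

lemma dunkl_inr_rename (κ : k) (i : ι) (p : MvPolynomial ι k) :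
    dunkl (twoColor ι) κ (Sum.inr i) (rename Sum.inr p) =
      rename Sum.inr (dunkl (oneColor ι) κ i p) := by
  rw [dunkl_apply, dunkl_apply, map_add, pderiv_rename Sum.inr_injective, map_smul, map_sum,
    sameColor_inr, sameColor_oneColor, Finset.sum_map]
  congr 2
  refine Finset.sum_congr rfl fun j hj => ?_
  rw [rename_divDiff Sum.inr_injective (Finset.ne_of_mem_erase hj).symm]
  rfl

lemma IsSlice.dunkl_inr {L : MvPolynomial (ι ⊕ ι) k →ₗ[k] MvPolynomial ι k}
    (h : IsSlice L) (κ : k) (i : ι) (f : MvPolynomial (ι ⊕ ι) k) :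
    L (dunkl (twoColor ι) κ (Sum.inr i) f) = dunkl (oneColor ι) κ i (L f) := by
  induction f using induction_inl_mul_inr with
  | hadd f g hf hg => simp only [map_add, hf, hg]
  | hmul p q =>
    obtain ⟨c, hc⟩ := h.map_inl p
    rw [dunkl_inr_inl_mul, dunkl_inr_rename, mul_comm, h.map_inr_mul, mul_comm (rename _ p),
      h.map_inr_mul, hc, mul_comm, mul_comm q, ← smul_eq_C_mul, ← smul_eq_C_mul, map_smul]

lemma IsSlice.comp_dunkl_inl {L : MvPolynomial (ι ⊕ ι) k →ₗ[k] MvPolynomial ι k}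
    (h : IsSlice L) (κ : k) (i : ι) :
    IsSlice (L.comp (dunkl (twoColor ι) κ (Sum.inl i))) where
  map_inr_mul q f := by
    rw [LinearMap.comp_apply, LinearMap.comp_apply, dunkl_inl_inr_mul, h.map_inr_mul]
  map_inl p := by
    rw [LinearMap.comp_apply, dunkl_inl_rename]
    exact h.map_inl _

lemma IsSlice.comp_dunkl_inl_pow {L : MvPolynomial (ι ⊕ ι) k →ₗ[k] MvPolynomial ι k}
    (h : IsSlice L) (κ : k) (i : ι) (n : ℕ) :
    IsSlice (L.comp (dunkl (twoColor ι) κ (Sum.inl i) ^ n)) := by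
  induction n with
  | zero => exact h
  | succ n ih =>
    rw [pow_succ]
    exact ih.comp_dunkl_inl κ i

lemma IsSlice.dunkl_inr_neg_pow {L : MvPolynomial (ι ⊕ ι) k →ₗ[k] MvPolynomial ι k}
    (h : IsSlice L) (κ : k) (i : ι) (n : ℕ) (f : MvPolynomial (ι ⊕ ι) k) :
    L (((-dunkl (twoColor ι) κ (Sum.inr i)) ^ n) f) =
      ((-1 : k) ^ n) • (dunkl (oneColor ι) κ i ^ n) (L f) := by
  induction n generalizing f with
  | zero => simp
  | succ n ih =>
    rw [pow_succ, Module.End.mul_apply, ih, LinearMap.neg_apply, map_neg, h.dunkl_inr, pow_succ,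
      pow_succ, Module.End.mul_apply, map_neg, mul_neg_one, neg_smul, smul_neg]

lemma dunklHom_psum {σ β : Type*} [DecidableEq σ] [Fintype σ] [DecidableEq β] (χ : σ → β)
    (κ : k) (n : ℕ) (f : MvPolynomial σ k) :
    dunklHom χ κ (psum σ k n) f = ∑ i, (dunkl χ κ i ^ n) f := by
  simp [psum, dunklHom_X]

theorem IsSlice.exists_dunklHom {a : ℕ} (ha : a ≠ 0) {p : MvPolynomial ι k}
    (hp : p ∈ Algebra.adjoin k (Set.range fun n => psum ι k (n + 1)))
    {L : MvPolynomial (ι ⊕ ι) k →ₗ[k] MvPolynomial ι k} (h : IsSlice L) :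
    ∃ L' : MvPolynomial (ι ⊕ ι) k →ₗ[k] MvPolynomial ι k, IsSlice L' ∧
      dunklHom (oneColor ι) (-a : k) p (L (cauchyKernel ι k a)) = L' (cauchyKernel ι k a) := by
  induction hp using Algebra.adjoin_induction generalizing L with
  | mem x hx =>
    obtain ⟨n, rfl⟩ := hx
    refine ⟨((-1 : k) ^ (n + 1)) •
      ∑ i, L.comp (dunkl (twoColor ι) (-a : k) (Sum.inl i) ^ (n + 1)),
      (IsSlice.sum _ fun i _ => h.comp_dunkl_inl_pow _ _ _).smul _, ?_⟩
    have e := congrArg L (sum_dunkl_pow_cauchyKernel (ι := ι) (k := k) ha n)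
    simp only [map_sum, h.dunkl_inr_neg_pow, ← Finset.smul_sum] at e
    rw [dunklHom_psum, LinearMap.smul_apply, LinearMap.sum_apply]
    simp only [LinearMap.comp_apply]
    rw [e, smul_smul, ← mul_pow]
    simp
  | algebraMap r =>
    refine ⟨r • L, h.smul r, ?_⟩
    rw [algebraMap_eq, dunklHom_C, LinearMap.smul_apply]
  | add x y _ _ hx hy =>
    obtain ⟨L₁, h₁, e₁⟩ := hx h
    obtain ⟨L₂, h₂, e₂⟩ := hy h
    exact ⟨L₁ + L₂, h₁.add h₂, by
      rw [map_add, LinearMap.add_apply, LinearMap.add_apply, e₁, e₂]⟩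
  | mul x y _ _ hx hy =>
    obtain ⟨L₂, h₂, e₂⟩ := hy h
    obtain ⟨L₁, h₁, e₁⟩ := hx h₂
    exact ⟨L₁, h₁, by rw [dunklHom_mul, e₂, e₁]⟩

/-- Setting the variables of the first block to zero. -/
lemma exists_isSlice_cauchyKernel (a : ℕ) :
    ∃ L : MvPolynomial (ι ⊕ ι) k →ₗ[k] MvPolynomial ι k, IsSlice L ∧
      L (cauchyKernel ι k a) = ∏ p : ι × ι, (-X p.2) ^ a := by
  refine ⟨(aeval (Sum.elim (fun _ => 0) X)).toLinearMap, ⟨fun q f => ?_, fun p => ?_⟩, ?_⟩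
  · rw [AlgHom.toLinearMap_apply, map_mul, aeval_rename, Sum.elim_comp_inr, aeval_X_left_apply,
      AlgHom.toLinearMap_apply]
  · refine ⟨constantCoeff p, ?_⟩
    rw [AlgHom.toLinearMap_apply, aeval_rename, Sum.elim_comp_inl]
    exact aeval_zero p
  · simp [cauchyKernel]

end Slice

section Gseq

variable {A B : Type*} [CommRing A] [Algebra ℂ A] [CommRing B] [Algebra ℂ B]

/-- The coefficients of `(∑ u_j z^j)^(-κ)`, defined by their recurrence. -/
noncomputable def gseq (u : ℕ → A) (κ : A) : ℕ → A
  | 0 => 1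
  | n + 1 => (-((n : ℂ) + 1)⁻¹) • ∑ j : Fin (n + 1),
      (((n - j : ℕ) : A) + κ * ((j : ℕ) + 1)) * u (j + 1) * gseq u κ (n - j)

@[simp] lemma gseq_zero (u : ℕ → A) (κ : A) : gseq u κ 0 = 1 := by
  rw [gseq]

lemma natCast_add_one_mul_smul_inv (n : ℕ) (x : A) :
    ((n : A) + 1) * ((((n : ℂ) + 1)⁻¹) • x) = x := by
  have h : ((n : ℂ) + 1) ≠ 0 := Nat.cast_add_one_ne_zero n
  have e : ((n : A) + 1) = algebraMap ℂ A ((n : ℂ) + 1) := by simp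
  rw [e, ← Algebra.smul_def, smul_smul, mul_inv_cancel₀ h, one_smul]

lemma natCast_add_one_mul_cancel (n : ℕ) {x y : A} (h : ((n : A) + 1) * x = ((n : A) + 1) * y) :
    x = y := by
  have := congrArg (fun t => (((n : ℂ) + 1)⁻¹) • t) h
  simpa only [← mul_smul_comm, natCast_add_one_mul_smul_inv] using this

lemma gseq_succ (u : ℕ → A) (κ : A) (n : ℕ) :
    ((n : A) + 1) * gseq u κ (n + 1) = -∑ j ∈ Finset.range (n + 1),
      (((n - j : ℕ) : A) + κ * ((j : A) + 1)) * u (j + 1) * gseq u κ (n - j) := by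
  rw [gseq, neg_smul, mul_neg, natCast_add_one_mul_smul_inv, Finset.sum_range]

lemma eq_gseq {u : ℕ → A} {κ : A} {g : ℕ → A} (h0 : g 0 = 1)
    (h : ∀ n : ℕ, ((n : A) + 1) * g (n + 1) = -∑ j ∈ Finset.range (n + 1),
      (((n - j : ℕ) : A) + κ * ((j : A) + 1)) * u (j + 1) * g (n - j)) (n : ℕ) :
    g n = gseq u κ n := by
  induction n using Nat.strong_induction_on with
  | _ n ih =>
    rcases n with _ | n
    · simp [h0]
    · refine natCast_add_one_mul_cancel n ?_
      rw [h, gseq_succ]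
      congr 1
      refine Finset.sum_congr rfl fun j hj => ?_
      rw [ih (n - j) (by omega)]

lemma map_gseq (φ : A →ₐ[ℂ] B) (u : ℕ → A) (κ : A) (n : ℕ) :
    φ (gseq u κ n) = gseq (fun j => φ (u j)) (φ κ) n := by
  refine eq_gseq (g := fun n => φ (gseq u κ n)) (by simp) (fun n => ?_) n
  have := congrArg φ (gseq_succ u κ n)
  simpa using this

lemma sum_derivative_mul (g u : ℕ → A) (hu : u 0 = 1) (n : ℕ) :
    (PowerSeries.coeff n) (PowerSeries.derivative A (PowerSeries.mk g) * PowerSeries.mk u) =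
      ((n : A) + 1) * g (n + 1) +
        ∑ j ∈ Finset.range (n + 1), ((n - j : ℕ) : A) * u (j + 1) * g (n - j) := by
  rw [PowerSeries.coeff_mul, Finset.Nat.sum_antidiagonal_eq_sum_range_succ_mk,
    ← Finset.sum_range_reflect, Finset.sum_range_succ', add_comm, Finset.sum_range_succ _ n]
  simp only [PowerSeries.coeff_derivative, PowerSeries.coeff_mk]
  congr 1
  · simp [hu, mul_comm]
  · simp only [Nat.sub_self, Nat.cast_zero, zero_mul, add_zero]
    refine Finset.sum_congr rfl fun j hj => ?_
    have hj := Finset.mem_range.1 hj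
    obtain ⟨m, rfl⟩ : ∃ m, n = j + 1 + m := ⟨n - (j + 1), by omega⟩
    have e1 : j + 1 + m + 1 - 1 - (j + 1) = m := by omega
    have e2 : j + 1 + m - m = j + 1 := by omega
    have e3 : j + 1 + m - j = m + 1 := by omega
    rw [e1, e2, e3]
    push_cast
    ring

lemma sum_mul_derivative (g u : ℕ → A) (n : ℕ) :
    (PowerSeries.coeff n) (PowerSeries.mk g * PowerSeries.derivative A (PowerSeries.mk u)) =
        ∑ j ∈ Finset.range (n + 1), ((j : A) + 1) * u (j + 1) * g (n - j) := by
  rw [PowerSeries.coeff_mul, Finset.Nat.sum_antidiagonal_eq_sum_range_succ_mk,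
    ← Finset.sum_range_reflect]
  simp only [PowerSeries.coeff_derivative, PowerSeries.coeff_mk]
  refine Finset.sum_congr rfl fun j hj => ?_
  have hj := Finset.mem_range.1 hj
  have e1 : n + 1 - 1 - j = n - j := by omega
  have e2 : n - (n - j) = j := by omega
  rw [e1, e2]
  ring

lemma derivative_gseq {u : ℕ → A} (hu : u 0 = 1) (κ : A) :
    PowerSeries.derivative A (PowerSeries.mk (gseq u κ)) * PowerSeries.mk u =
      -(PowerSeries.C κ * (PowerSeries.mk (gseq u κ) *
        PowerSeries.derivative A (PowerSeries.mk u))) := by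
  ext n
  rw [sum_derivative_mul _ _ hu, gseq_succ, map_neg, PowerSeries.coeff_C_mul, sum_mul_derivative,
    Finset.mul_sum, neg_add_eq_sub, ← Finset.sum_sub_distrib, ← Finset.sum_neg_distrib]
  refine Finset.sum_congr rfl fun j _ => ?_
  ring

lemma eq_gseq_of_derivative {u g : ℕ → A} (hu : u 0 = 1) (hg : g 0 = 1) {κ : A}
    (h : PowerSeries.derivative A (PowerSeries.mk g) * PowerSeries.mk u =
      -(PowerSeries.C κ * (PowerSeries.mk g * PowerSeries.derivative A (PowerSeries.mk u))))
    (n : ℕ) : g n = gseq u κ n := by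
  refine eq_gseq hg (fun n => ?_) n
  have := congrArg (PowerSeries.coeff n) h
  rw [sum_derivative_mul _ _ hu, map_neg, PowerSeries.coeff_C_mul, sum_mul_derivative,
    Finset.mul_sum, ← eq_sub_iff_add_eq] at this
  rw [this, neg_sub_left, ← Finset.sum_add_distrib]
  congr 1
  refine Finset.sum_congr rfl fun j _ => ?_
  ring

lemma coeff_pow_eq_gseq {u : ℕ → A} (hu : u 0 = 1) {a : ℕ} (n : ℕ) :
    PowerSeries.coeff n (PowerSeries.mk u ^ a) = gseq u (-a : A) n := by
  refine eq_gseq_of_derivative (g := fun n => PowerSeries.coeff n (PowerSeries.mk u ^ a)) hu ?_ ?_ n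
  · rw [PowerSeries.coeff_zero_eq_constantCoeff_apply, map_pow,
      ← PowerSeries.coeff_zero_eq_constantCoeff_apply, PowerSeries.coeff_mk, hu, one_pow]
  · have e : (PowerSeries.mk fun n => PowerSeries.coeff n (PowerSeries.mk u ^ a)) =
        PowerSeries.mk u ^ a := by
      ext n
      simp
    rw [e, Derivation.leibniz_pow]
    rcases a with _ | a
    · simp
    · simp only [map_neg, nsmul_eq_mul, smul_eq_mul, Nat.add_sub_cancel, map_natCast]
      ring

lemma gseq_neg_eq_zero {u : ℕ → A} (hu : u 0 = 1) {a b n : ℕ} (hb : ∀ j, b < j → u j = 0)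
    (hn : a * b < n) : gseq u (-a : A) n = 0 := by
  rw [← coeff_pow_eq_gseq hu]
  let p : Polynomial A := ∑ j ∈ Finset.range (b + 1), Polynomial.monomial j (u j)
  have hp : (p : PowerSeries A) = PowerSeries.mk u := by
    ext n
    simp only [p, Polynomial.coeff_coe, Polynomial.finsetSum_coeff, Polynomial.coeff_monomial,
      PowerSeries.coeff_mk]
    rw [Finset.sum_ite_eq' (Finset.range (b + 1)) n u]
    split_ifs with h
    · rfl
    · exact (hb n (by simpa using h)).symm
  have hd : p.natDegree ≤ b :=
    Polynomial.natDegree_sum_le_of_forall_le _ _ fun j hj =>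
      (Polynomial.natDegree_monomial_le _).trans (by simpa [Nat.lt_succ_iff] using hj)
  rw [← hp, ← Polynomial.coe_pow, Polynomial.coeff_coe]
  exact Polynomial.coeff_eq_zero_of_natDegree_lt
    ((Polynomial.natDegree_pow_le_of_le a hd).trans_lt hn)

end Gseq

section SymmetricSide

variable {ι : Type*} [DecidableEq ι] [Fintype ι] {k : Type*} [CommRing k] [IsDomain k]
  [Algebra ℂ k]

/-- The coefficients of `∏ (1 - z X_i)`. -/
noncomputable def signedEsymm (ι k : Type*) [Fintype ι] [CommRing k] (j : ℕ) : MvPolynomial ι k :=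
  (-1) ^ j * esymm ι k j

lemma signedEsymm_zero : signedEsymm ι k 0 = 1 := by simp [signedEsymm]

lemma derivative_signedEsymm :
    PowerSeries.derivative _ (PowerSeries.mk (signedEsymm ι k)) =
      -(PowerSeries.mk (fun n => psum ι k (n + 1)) * PowerSeries.mk (signedEsymm ι k)) := by
  ext1 n
  rw [PowerSeries.coeff_derivative, map_neg, PowerSeries.coeff_mul, PowerSeries.coeff_mk,
    signedEsymm]
  have h := mul_esymm_eq_sum ι k (n + 1)
  have e : ∑ a ∈ Finset.HasAntidiagonal.antidiagonal (n + 1) with a.1 < n + 1,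
      (-1) ^ a.1 * esymm ι k a.1 * psum ι k a.2 =
      ∑ p ∈ Finset.HasAntidiagonal.antidiagonal n,
        (PowerSeries.coeff p.1) (PowerSeries.mk fun n => psum ι k (n + 1)) *
        (PowerSeries.coeff p.2) (PowerSeries.mk (signedEsymm ι k)) := by
    rw [Finset.Nat.antidiagonal_succ', Finset.filter_cons_of_neg _ _ _ _ (by simp),
      Finset.filter_true_of_mem]
    · rw [Finset.sum_map, ← Finset.Nat.sum_antidiagonal_swap]
      refine Finset.sum_congr rfl fun p _ => ?_
      simp [signedEsymm, mul_comm]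
    · intro x hx
      obtain ⟨p, hp, rfl⟩ := Finset.mem_map.1 hx
      have := Finset.HasAntidiagonal.mem_antidiagonal.1 hp
      simp
      omega
  rw [← e]
  push_cast at h
  have h1 : ((-1 : MvPolynomial ι k) ^ (n + 1)) * (-1) ^ (n + 1) = 1 := by
    rw [← mul_pow]; simp
  rw [mul_right_comm, mul_assoc, h, ← mul_assoc,
    pow_succ _ (n + 1), ← mul_assoc, h1]
  ring

/-- The symmetric polynomials with generating function `∏ (1 - z X_i)^(-κ)`. -/
noncomputable def gsym (ι : Type*) [Fintype ι] {k : Type*} [CommRing k] [Algebra ℂ k]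
    (κ : k) (n : ℕ) : MvPolynomial ι k :=
  gseq (signedEsymm ι k) (C κ) n

lemma gsym_succ (κ : k) (n : ℕ) :
    ((n : MvPolynomial ι k) + 1) * gsym ι κ (n + 1) =
      C κ * ∑ j ∈ Finset.range (n + 1), psum ι k (j + 1) * gsym ι κ (n - j) := by
  have h := derivative_gseq (signedEsymm_zero (ι := ι) (k := k)) (C κ)
  rw [derivative_signedEsymm] at h
  have hE : PowerSeries.mk (signedEsymm ι k) ≠ 0 := by
    intro h0
    have := congrArg (PowerSeries.coeff 0) h0
    rw [PowerSeries.coeff_mk, signedEsymm_zero, map_zero] at this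
    exact one_ne_zero this
  have h2 : PowerSeries.derivative _ (PowerSeries.mk (gseq (signedEsymm ι k) (C κ))) =
      PowerSeries.C (C κ) * (PowerSeries.mk (fun n => psum ι k (n + 1)) *
        PowerSeries.mk (gseq (signedEsymm ι k) (C κ))) := by
    refine mul_right_cancel₀ hE ?_
    rw [h]
    ring
  have := congrArg (PowerSeries.coeff n) h2
  rw [PowerSeries.coeff_derivative, PowerSeries.coeff_C_mul, PowerSeries.coeff_mul,
    Finset.Nat.sum_antidiagonal_eq_sum_range_succ_mk, PowerSeries.coeff_mk, mul_comm] at this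
  simpa [gsym] using this

@[simp] lemma gsym_zero (κ : k) : gsym ι κ 0 = 1 := gseq_zero _ _

/-- The truncated products of `gsym` with a geometric series. -/
noncomputable def hsymAt (κ : k) (i : ι) : ℕ → MvPolynomial ι k
  | 0 => 0
  | n + 1 => X i * hsymAt κ i n + gsym ι κ n

@[simp] lemma hsymAt_zero (κ : k) (i : ι) : hsymAt κ i 0 = 0 := rfl

lemma hsymAt_succ (κ : k) (i : ι) (n : ℕ) :
    hsymAt κ i (n + 1) = X i * hsymAt κ i n + gsym ι κ n := rfl

lemma hsymAt_eq_sum (κ : k) (i : ι) (n : ℕ) :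
    hsymAt κ i (n + 1) = ∑ j ∈ Finset.range (n + 1), X i ^ j * gsym ι κ (n - j) := by
  induction n with
  | zero => simp [hsymAt_succ]
  | succ n ih =>
    rw [hsymAt_succ, ih, Finset.sum_range_succ' _ (n + 1), Finset.mul_sum]
    congr 1
    · refine Finset.sum_congr rfl fun j _ => ?_
      rw [Nat.add_sub_add_right]
      ring
    · simp

lemma sum_add_sum_eq_hsymAt (κ : k) (i : ι) (n : ℕ) :
    ∑ j ∈ Finset.range (n + 1), ((j : MvPolynomial ι k) + 1) * X i ^ j * gsym ι κ (n - j) +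
      C κ * ∑ j ∈ Finset.range (n + 1), psum ι k (j + 1) * hsymAt κ i (n - j) =
    ((n : MvPolynomial ι k) + 1) * hsymAt κ i (n + 1) := by
  induction n with
  | zero => simp [hsymAt_succ]
  | succ n ih =>
    have e1 : ∑ j ∈ Finset.range (n + 1 + 1),
        ((j : MvPolynomial ι k) + 1) * X i ^ j * gsym ι κ (n + 1 - j) =
        hsymAt κ i (n + 1 + 1) + X i * ∑ j ∈ Finset.range (n + 1),
          ((j : MvPolynomial ι k) + 1) * X i ^ j * gsym ι κ (n - j) := by
      simp only [add_mul, one_mul, Finset.sum_add_distrib]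
      rw [← hsymAt_eq_sum, add_comm, Finset.sum_range_succ']
      simp only [Nat.cast_zero, zero_mul, add_zero, Nat.add_sub_add_right]
      rw [← Finset.sum_add_distrib, Finset.mul_sum]
      congr 1
      refine Finset.sum_congr rfl fun j _ => ?_
      push_cast
      ring
    have e2 : C κ * ∑ j ∈ Finset.range (n + 1 + 1), psum ι k (j + 1) * hsymAt κ i (n + 1 - j) =
        X i * (C κ * ∑ j ∈ Finset.range (n + 1), psum ι k (j + 1) * hsymAt κ i (n - j)) +
          ((n : MvPolynomial ι k) + 1) * gsym ι κ (n + 1) := by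
      rw [gsym_succ, Finset.sum_range_succ, Nat.sub_self, hsymAt_zero, mul_zero, add_zero,
        mul_left_comm, ← mul_add]
      congr 1
      rw [Finset.mul_sum, ← Finset.sum_add_distrib]
      refine Finset.sum_congr rfl fun j hj => ?_
      have : n + 1 - j = n - j + 1 := by
        have := Finset.mem_range.1 hj
        omega
      rw [this, hsymAt_succ]
      ring
    rw [e1, e2, hsymAt_succ κ i (n + 1)]
    push_cast
    linear_combination X i * ih

lemma pderiv_psum (i : ι) (n : ℕ) :
    pderiv i (psum ι k (n + 1)) = ((n : MvPolynomial ι k) + 1) * X i ^ n := by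
  rw [psum, map_sum, Finset.sum_eq_single_of_mem i (Finset.mem_univ _)]
  · simp [Derivation.leibniz_pow]
  · intro j _ hj
    simp [Derivation.leibniz_pow, pderiv_X_of_ne hj]

lemma pderiv_gsym (κ : k) (i : ι) (n : ℕ) :
    pderiv i (gsym ι κ n) = C κ * hsymAt κ i n := by
  induction n using Nat.strong_induction_on with
  | _ n ih =>
    rcases n with _ | n
    · simp
    · refine natCast_add_one_mul_cancel n ?_
      have h := congrArg (pderiv i) (gsym_succ (ι := ι) κ n)
      have e0 : pderiv i ((n : MvPolynomial ι k) + 1) = 0 := by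
        rw [map_add, Derivation.map_natCast, Derivation.map_one_eq_zero, add_zero]
      rw [Derivation.leibniz, e0, smul_zero, add_zero, Derivation.leibniz, pderiv_C, smul_zero,
        add_zero, map_sum] at h
      rw [← smul_eq_mul, h, smul_eq_mul, mul_left_comm, ← sum_add_sum_eq_hsymAt]
      congr 1
      rw [Finset.mul_sum, ← Finset.sum_add_distrib]
      refine Finset.sum_congr rfl fun j hj => ?_
      rw [Derivation.leibniz, pderiv_psum, ih (n - j) (by omega)]
      simp only [smul_eq_mul]
      ring

lemma sum_X_mul_hsymAt (κ : k) (n : ℕ) :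
    C κ * ∑ i, X i * hsymAt κ i n = (n : MvPolynomial ι k) * gsym ι κ n := by
  rcases n with _ | n
  · simp
  · push_cast
    rw [gsym_succ]
    simp only [hsymAt_eq_sum, Finset.mul_sum]
    rw [Finset.sum_comm]
    refine Finset.sum_congr rfl fun j _ => ?_
    rw [psum, Finset.sum_mul, Finset.mul_sum]
    refine Finset.sum_congr rfl fun i _ => ?_
    ring

lemma sum_hsymAt (κ : k) (n : ℕ) :
    C κ * ∑ i, hsymAt κ i (n + 1) =
      ((n : MvPolynomial ι k) + C κ * (Fintype.card ι : MvPolynomial ι k)) * gsym ι κ n := by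
  simp only [hsymAt_succ, Finset.sum_add_distrib, mul_add, sum_X_mul_hsymAt]
  simp
  ring

lemma rename_gsym (κ : k) (σ : Equiv.Perm ι) (n : ℕ) :
    rename σ (gsym ι κ n) = gsym ι κ n := by
  have h := map_gseq ((rename (R := k) σ).restrictScalars ℂ) (signedEsymm ι k) (C κ) n
  simp only [AlgHom.restrictScalars_apply, rename_C] at h
  rw [gsym, h]
  congr 1
  funext j
  simp [signedEsymm, rename_esymm]

lemma rename_hsymAt (κ : k) (σ : Equiv.Perm ι) (i : ι) (n : ℕ) :
    rename σ (hsymAt κ i n) = hsymAt κ (σ i) n := by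
  induction n with
  | zero => simp
  | succ n ih => simp [hsymAt_succ, ih, rename_gsym]

lemma dunkl_gsym (κ : k) (i : ι) (n : ℕ) :
    dunkl (oneColor ι) κ i (gsym ι κ n) = C κ * hsymAt κ i n := by
  rw [dunkl_of_symm _ _ _ fun j _ => rename_gsym κ _ n, pderiv_gsym]

lemma dunkl_hsymAt (κ : k) (i : ι) (n : ℕ) :
    dunkl (oneColor ι) κ i (hsymAt κ i (n + 1)) =
      ((n : MvPolynomial ι k) + C κ * (Fintype.card ι : MvPolynomial ι k)) * hsymAt κ i n := by
  induction n with
  | zero =>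
    rw [hsymAt_succ, hsymAt_zero, mul_zero, mul_zero, zero_add, dunkl_gsym, hsymAt_zero, mul_zero]
  | succ n ih =>
    rw [hsymAt_succ, map_add, dunkl_X_mul, dunkl_gsym, dunklX_self, ih, sameColor_oneColor]
    simp only [swapVar, rename_hsymAt, Equiv.swap_apply_left]
    have h := sum_hsymAt (ι := ι) κ n
    rw [← Finset.add_sum_erase _ _ (Finset.mem_univ i)] at h
    rw [smul_eq_C_mul]
    have h2 := hsymAt_succ κ i n
    push_cast
    linear_combination h - ((n : MvPolynomial ι k) + C κ * (Fintype.card ι : MvPolynomial ι k)) * h2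

end SymmetricSide

section Lowering

variable {ι : Type*} [DecidableEq ι] [Fintype ι] {k : Type*} [CommRing k] [IsDomain k]
  [Algebra ℂ k]

/-- The linear map on `k[X]` with `X ^ n ↦ g n`. -/
noncomputable def monomialMap {k : Type*} [CommRing k] {M : Type*} [AddCommGroup M] [Module k M]
    (g : ℕ → M) : Polynomial k →ₗ[k] M :=
  (Polynomial.basisMonomials k).constr k g

lemma monomialMap_X_pow {k : Type*} [CommRing k] {M : Type*} [AddCommGroup M] [Module k M]
    (g : ℕ → M) (n : ℕ) : monomialMap g (Polynomial.X ^ n : Polynomial k) = g n := by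
  have := (Polynomial.basisMonomials k).constr_basis k g n
  rw [Polynomial.coe_basisMonomials] at this
  simpa only [Polynomial.monomial_one_right_eq_X_pow, monomialMap] using this

lemma linearMap_ext_X_pow {k : Type*} [CommRing k] {M : Type*} [AddCommGroup M] [Module k M]
    {f g : Polynomial k →ₗ[k] M} (h : ∀ n : ℕ, f (Polynomial.X ^ n) = g (Polynomial.X ^ n)) :
    f = g := by
  refine (Polynomial.basisMonomials k).ext fun n => ?_
  rw [Polynomial.coe_basisMonomials]
  simpa only [Polynomial.monomial_one_right_eq_X_pow] using h n

/-- The lowering operator `X ^ (n + 1) ↦ (n + c) X ^ n`. -/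
noncomputable def lowering {k : Type*} [CommRing k] (c : k) : Module.End k (Polynomial k) :=
  monomialMap fun n => match n with
    | 0 => 0
    | n + 1 => ((n : k) + c) • Polynomial.X ^ n

lemma lowering_one {k : Type*} [CommRing k] (c : k) : lowering c (Polynomial.X ^ 0) = 0 := by
  rw [lowering, monomialMap_X_pow]

lemma lowering_X_pow_succ {k : Type*} [CommRing k] (c : k) (n : ℕ) :
    lowering c (Polynomial.X ^ (n + 1)) = ((n : k) + c) • Polynomial.X ^ n := by
  rw [lowering, monomialMap_X_pow]

lemma lowering_pow_X_pow {k : Type*} [CommRing k] (c : k) (r n : ℕ) :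
    ∃ d : k, (lowering c ^ r) (Polynomial.X ^ (n + r)) = d • Polynomial.X ^ n := by
  induction r with
  | zero => exact ⟨1, by simp⟩
  | succ r ih =>
    obtain ⟨d, hd⟩ := ih
    refine ⟨((n + r : ℕ) + c) * d, ?_⟩
    rw [pow_succ, Module.End.mul_apply, ← add_assoc, lowering_X_pow_succ, map_smul, hd, smul_smul]

variable (κ : k)

lemma dunkl_monomialMap_gsym (i : ι) (f : Polynomial k) :
    dunkl (oneColor ι) κ i (monomialMap (gsym ι κ) f) = κ • monomialMap (hsymAt κ i) f := by
  have : (dunkl (oneColor ι) κ i).comp (monomialMap (gsym ι κ)) =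
      κ • monomialMap (k := k) (hsymAt κ i) := by
    refine linearMap_ext_X_pow fun n => ?_
    rw [LinearMap.comp_apply, LinearMap.smul_apply, monomialMap_X_pow, monomialMap_X_pow,
      dunkl_gsym, smul_eq_C_mul]
  exact congrArg (fun g => g f) this

lemma dunkl_monomialMap_hsymAt (i : ι) (f : Polynomial k) :
    dunkl (oneColor ι) κ i (monomialMap (hsymAt κ i) f) =
      monomialMap (hsymAt κ i) (lowering (κ * (Fintype.card ι : k)) f) := by
  have : (dunkl (oneColor ι) κ i).comp (monomialMap (hsymAt κ i)) =
      (monomialMap (k := k) (hsymAt κ i)).comp (lowering (κ * (Fintype.card ι : k))) := by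
    refine linearMap_ext_X_pow fun n => ?_
    rcases n with _ | n
    · rw [LinearMap.comp_apply, LinearMap.comp_apply, lowering_one, monomialMap_X_pow,
        hsymAt_zero, map_zero, map_zero]
    · rw [LinearMap.comp_apply, LinearMap.comp_apply, lowering_X_pow_succ, map_smul,
        monomialMap_X_pow, monomialMap_X_pow, dunkl_hsymAt, smul_eq_C_mul]
      simp
  exact congrArg (fun g => g f) this

lemma dunkl_pow_monomialMap_hsymAt (i : ι) (n : ℕ) (f : Polynomial k) :
    (dunkl (oneColor ι) κ i ^ n) (monomialMap (hsymAt κ i) f) =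
      monomialMap (hsymAt κ i) ((lowering (κ * (Fintype.card ι : k)) ^ n) f) := by
  induction n generalizing f with
  | zero => simp
  | succ n ih =>
    rw [pow_succ, Module.End.mul_apply, dunkl_monomialMap_hsymAt, ih, pow_succ,
      Module.End.mul_apply]

lemma sum_monomialMap_hsymAt (f : Polynomial k) :
    κ • ∑ i : ι, monomialMap (hsymAt κ i) f =
      monomialMap (gsym ι κ) (lowering (κ * (Fintype.card ι : k)) f) := by
  have : κ • ∑ i : ι, monomialMap (k := k) (hsymAt κ i) =
      (monomialMap (k := k) (gsym ι κ)).comp (lowering (κ * (Fintype.card ι : k))) := by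
    refine linearMap_ext_X_pow fun n => ?_
    simp only [LinearMap.smul_apply, LinearMap.sum_apply, LinearMap.comp_apply, monomialMap_X_pow]
    rcases n with _ | n
    · rw [lowering_one]
      simp
    · rw [lowering_X_pow_succ, map_smul, monomialMap_X_pow, smul_eq_C_mul, sum_hsymAt,
        smul_eq_C_mul]
      simp
  simpa using congrArg (fun g => g f) this

/-- Restriction of polynomials to the line spanned by a coordinate vector. -/
noncomputable def axisHom (i₀ : ι) : MvPolynomial ι k →ₐ[k] Polynomial k :=
  aeval fun i => if i = i₀ then Polynomial.X else 0

lemma axisHom_psum (i₀ : ι) (n : ℕ) :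
    axisHom i₀ (psum ι k (n + 1)) = Polynomial.X ^ (n + 1) := by
  simp only [axisHom, psum, map_sum, map_pow, aeval_X]
  rw [Finset.sum_eq_single_of_mem i₀ (Finset.mem_univ _)]
  · simp
  · intro i _ hi
    simp [hi]

theorem dunklHom_monomialMap_gsym (i₀ : ι) {v : MvPolynomial ι k}
    (hv : v ∈ Algebra.adjoin k (Set.range fun n => psum ι k (n + 1))) (f : Polynomial k) :
    dunklHom (oneColor ι) κ v (monomialMap (gsym ι κ) f) = monomialMap (gsym ι κ)
      (Polynomial.aeval (lowering (κ * (Fintype.card ι : k))) (axisHom i₀ v) f) := by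
  induction hv using Algebra.adjoin_induction generalizing f with
  | mem x hx =>
    obtain ⟨n, rfl⟩ := hx
    rw [axisHom_psum, dunklHom_psum, map_pow, Polynomial.aeval_X, pow_succ', Module.End.mul_apply,
      ← sum_monomialMap_hsymAt, Finset.smul_sum]
    refine Finset.sum_congr rfl fun i _ => ?_
    rw [pow_succ, Module.End.mul_apply, dunkl_monomialMap_gsym, map_smul,
      dunkl_pow_monomialMap_hsymAt]
  | algebraMap r =>
    rw [algebraMap_eq, dunklHom_C, ← algebraMap_eq, AlgHom.commutes, Polynomial.algebraMap_eq,
      Polynomial.aeval_C, Module.algebraMap_end_apply, map_smul]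
  | add x y _ _ hx hy =>
    rw [map_add, map_add, map_add, LinearMap.add_apply, LinearMap.add_apply, hx, hy, map_add]
  | mul x y _ _ hx hy =>
    rw [dunklHom_mul, hy, hx, map_mul, map_mul, Module.End.mul_apply]

lemma constantCoeff_psum (n : ℕ) : constantCoeff (psum ι k (n + 1)) = 0 := by
  simp [psum]

lemma constantCoeff_gsym (n : ℕ) : constantCoeff (gsym ι κ (n + 1)) = 0 := by
  have h := congrArg constantCoeff (gsym_succ (ι := ι) κ n)
  simp only [map_mul, map_sum, constantCoeff_psum, zero_mul, Finset.sum_const_zero, mul_zero] at h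
  refine natCast_add_one_mul_cancel n ?_
  rw [mul_zero, ← h]
  simp

theorem dunklPairing_gsym_eq_zero (i₀ : ι) {v : MvPolynomial ι k}
    (hv : v ∈ Algebra.adjoin k (Set.range fun n => psum ι k (n + 1))) {n : ℕ}
    (hn : (axisHom i₀ v).natDegree < n) :
    dunklPairing (oneColor ι) κ v (gsym ι κ n) = 0 := by
  have h := dunklHom_monomialMap_gsym κ i₀ hv (Polynomial.X ^ n)
  rw [monomialMap_X_pow] at h
  rw [dunklPairing, h, Polynomial.aeval_eq_sum_range, LinearMap.sum_apply, map_sum, map_sum]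
  refine Finset.sum_eq_zero fun r hr => ?_
  obtain ⟨m, rfl⟩ : ∃ m, n = m + 1 + r := by
    have := Finset.mem_range.1 hr
    exact ⟨n - 1 - r, by omega⟩
  obtain ⟨d, hd⟩ := lowering_pow_X_pow (κ * (Fintype.card ι : k)) r (m + 1)
  rw [LinearMap.smul_apply, hd, smul_smul, map_smul, monomialMap_X_pow, smul_eq_C_mul, map_mul,
    constantCoeff_gsym, mul_zero]

lemma esymm_mem_adjoin_psum (n : ℕ) :
    esymm ι k n ∈ Algebra.adjoin k (Set.range fun n => psum ι k (n + 1)) := by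
  induction n using Nat.strong_induction_on with
  | _ n ih =>
    rcases n with _ | n
    · rw [esymm_zero]
      exact one_mem _
    · have h := mul_esymm_eq_sum ι k (n + 1)
      have h1 : ((n : ℂ) + 1) ≠ 0 := Nat.cast_add_one_ne_zero n
      have e : esymm ι k (n + 1) = algebraMap k _ (algebraMap ℂ k ((n : ℂ) + 1)⁻¹) *
          (((n + 1 : ℕ) : MvPolynomial ι k) * esymm ι k (n + 1)) := by
        have : (((n + 1 : ℕ) : MvPolynomial ι k)) =
            algebraMap k _ (algebraMap ℂ k ((n : ℂ) + 1)) := by simp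
        rw [this, ← mul_assoc, ← map_mul, ← map_mul, inv_mul_cancel₀ h1]
        simp
      rw [e, h]
      refine mul_mem (Subalgebra.algebraMap_mem _ _) (mul_mem (pow_mem (neg_mem (one_mem _)) _)
        (sum_mem fun p hp => ?_))
      have hp' := (Finset.mem_filter.1 hp)
      have h2 := Finset.HasAntidiagonal.mem_antidiagonal.1 hp'.1
      refine mul_mem (mul_mem (pow_mem (neg_mem (one_mem _)) _) (ih _ hp'.2))
        (Algebra.subset_adjoin ⟨p.2 - 1, ?_⟩)
      have h3 := hp'.2
      simp only
      congr 1
      omega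

end Lowering

section Koszul

/-- First syzygies of a regular sequence are generated by the Koszul relations. -/
theorem exists_koszul_of_sum_eq_zero {A : Type*} [CommRing A] (f : ℕ → A) (n : ℕ)
    (hf : ∀ k < n, ∀ x, f k * x ∈ Ideal.span (f '' Set.Iio k) → x ∈ Ideal.span (f '' Set.Iio k))
    (p : ℕ → A) (hp : ∑ i ∈ Finset.range n, f i * p i = 0) :
    ∃ T : ℕ → ℕ → A, ∀ i < n, p i = ∑ j ∈ Finset.range n, f j * (T i j - T j i) := by
  induction n generalizing p with
  | zero => exact ⟨0, by simp⟩
  | succ n ih =>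
    rw [Finset.sum_range_succ] at hp
    have h1 : p n ∈ Ideal.span (f '' Set.Iio n) := by
      refine hf n n.lt_succ_self _ ?_
      rw [eq_neg_of_add_eq_zero_right hp]
      exact neg_mem (sum_mem fun i hi => Ideal.mul_mem_right _ _
        (Ideal.subset_span ⟨i, Finset.mem_range.1 hi, rfl⟩))
    have h2 : ∃ c : ℕ → A, p n = ∑ i ∈ Finset.range n, f i * c i := by
      rw [← Finset.coe_range n] at h1
      obtain ⟨c, hc⟩ := (Submodule.mem_span_image_finset_iff_exists_fun' A).1 h1
      exact ⟨c, by rw [← hc]; simp [mul_comm]⟩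
    obtain ⟨c, hc⟩ := h2
    obtain ⟨T, hT⟩ := ih (fun k hk => hf k (by omega)) (fun i => p i + f n * c i) (by
      rw [← hp, hc, Finset.mul_sum, ← Finset.sum_add_distrib]
      exact Finset.sum_congr rfl fun i _ => by ring)
    refine ⟨fun i j => if j = n then 0 else if i = n then c j else T i j, fun i hi => ?_⟩
    rw [Finset.sum_range_succ]
    by_cases hin : i = n
    · subst hin
      rw [hc]
      simp only [if_true, sub_self, mul_zero, add_zero]
      refine Finset.sum_congr rfl fun j hj => ?_
      rw [if_neg (Finset.mem_range.1 hj).ne, sub_zero]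
    · have e := hT i (by omega)
      have e2 : ∑ j ∈ Finset.range n, f j * ((if j = n then 0 else if i = n then c j else T i j) -
          if i = n then 0 else if j = n then c i else T j i) =
          ∑ j ∈ Finset.range n, f j * (T i j - T j i) :=
        Finset.sum_congr rfl fun j hj => by
          rw [if_neg (Finset.mem_range.1 hj).ne, if_neg hin, if_neg hin,
            if_neg (Finset.mem_range.1 hj).ne]
      rw [e2, ← e]
      simp [hin]

variable {k : Type*} [CommRing k]

lemma X_mul_mem_span_X_image_iff {σ : Type*} {s : Set σ} {i : σ} (hi : i ∉ s)
    (p : MvPolynomial σ k) :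
    X i * p ∈ Ideal.span (X '' s : Set (MvPolynomial σ k)) →
      p ∈ Ideal.span (X '' s : Set (MvPolynomial σ k)) := by
  classical
  rw [mem_ideal_span_X_image, mem_ideal_span_X_image]
  intro h m hm
  obtain ⟨j, hj, hmj⟩ := h (Finsupp.single i 1 + m) (by
    rw [mem_support_iff, coeff_X_mul]
    exact mem_support_iff.1 hm)
  refine ⟨j, hj, fun h0 => hmj ?_⟩
  rw [Finsupp.add_apply, h0, add_zero, Finsupp.single_apply, if_neg]
  rintro rfl
  exact hi hj

theorem exists_koszul_X {b : ℕ} (z : Fin b → MvPolynomial (Fin b) k)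
    (hz : ∑ i, X i * z i = 0) :
    ∃ T : Fin b → Fin b → MvPolynomial (Fin b) k, ∀ i, z i = ∑ j, X j * (T i j - T j i) := by
  have key := exists_koszul_of_sum_eq_zero
    (fun n => if h : n < b then (X (⟨n, h⟩ : Fin b) : MvPolynomial (Fin b) k) else 0) b ?_
    (fun n => if h : n < b then z ⟨n, h⟩ else 0) ?_
  · obtain ⟨T, hT⟩ := key
    refine ⟨fun i j => T i j, fun i => ?_⟩
    have := hT i i.2
    rw [Finset.sum_range] at this
    simpa using this
  · intro n hn x hx
    have e : (fun n => if h : n < b then (X (⟨n, h⟩ : Fin b) : MvPolynomial (Fin b) k) else 0) ''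
        Set.Iio n = X '' Set.Iio (⟨n, hn⟩ : Fin b) := by
      ext y
      constructor
      · rintro ⟨j, hj, rfl⟩
        have hj' : j < n := hj
        exact ⟨⟨j, hj'.trans hn⟩, hj', by simp [hj'.trans hn]⟩
      · rintro ⟨j, hj, rfl⟩
        exact ⟨j, hj, by simp⟩
    rw [e] at hx ⊢
    simp only [hn, dif_pos] at hx
    exact X_mul_mem_span_X_image_iff (by simp) x hx
  · rw [Finset.sum_range]
    simpa using hz

open Matrix in
lemma mul_adjugate_sub_mem {A ι : Type*} [CommRing A] [DecidableEq ι] [Fintype ι]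
    (M : Matrix ι ι A) (u : ι → A) (j p q : ι) :
    u q * M.adjugate p j - u p * M.adjugate q j ∈ Ideal.span (Set.range (M *ᵥ u)) := by
  have h := congrFun (congrArg (fun N : Matrix ι ι A => N *ᵥ u)
    (adjugate_mul (M.updateRow j (Pi.single p 1)))) q
  simp only [← mulVec_mulVec, smul_mulVec, one_mulVec, Pi.smul_apply, smul_eq_mul] at h
  rw [mulVec, dotProduct, ← Finset.add_sum_erase _ _ (Finset.mem_univ j),
    adjugate_apply (updateRow _ _ _) q j, updateRow_idem, ← adjugate_apply,
    ← adjugate_apply] at h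
  have e : (M.updateRow j (Pi.single p 1) *ᵥ u) j = u p := by
    simp [mulVec, dotProduct, Pi.single_apply]
  rw [e] at h
  have : u q * M.adjugate p j - u p * M.adjugate q j = ∑ x ∈ Finset.univ.erase j,
      (M.updateRow j (Pi.single p 1)).adjugate q x * (M.updateRow j (Pi.single p 1) *ᵥ u) x := by
    linear_combination -h
  rw [this]
  refine sum_mem fun x hx => Ideal.mul_mem_left _ _ (Ideal.subset_span ⟨x, ?_⟩)
  rw [mulVec, mulVec, updateRow_ne (Finset.ne_of_mem_erase hx)]

lemma sum_antisymm_mul {A ι : Type*} [CommRing A] [Fintype ι] (T : ι → ι → A) (u C : ι → A) :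
    ∑ p, (∑ q, u q * (T p q - T q p)) * C p = ∑ p, ∑ q, T p q * (u q * C p - u p * C q) := by
  simp only [Finset.sum_mul, mul_sub, sub_mul, Finset.sum_sub_distrib]
  rw [Finset.sum_comm (f := fun p q => u q * T q p * C p)]
  congr 1
  · exact Finset.sum_congr rfl fun p _ => Finset.sum_congr rfl fun q _ => by ring
  · exact Finset.sum_congr rfl fun p _ => Finset.sum_congr rfl fun q _ => by ring

open Matrix in
/-- Modulo the entries of `M *ᵥ X`, the determinant of `M` depends only on these entries. -/
theorem det_sub_det_mem {b : ℕ} (M M' : Matrix (Fin b) (Fin b) (MvPolynomial (Fin b) k))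
    (h : M *ᵥ X = M' *ᵥ X) : M'.det - M.det ∈ Ideal.span (Set.range (M *ᵥ X)) := by
  suffices H : ∀ s : Finset (Fin b),
      (of fun i j => if i ∈ s then M' i j else M i j).det - M.det ∈
        Ideal.span (Set.range (M *ᵥ X)) by
    have e : (of fun i j => if i ∈ Finset.univ then M' i j else M i j) = M' := by
      ext i j
      simp
    rw [← e]
    exact H _
  intro s
  induction s using Finset.induction_on with
  | empty =>
    have e : (of fun i j => if i ∈ (∅ : Finset (Fin b)) then M' i j else M i j) = M := by
      ext i j
      simp
    rw [e, sub_self]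
    exact zero_mem _
  | insert r s hr ih =>
    set E : Matrix (Fin b) (Fin b) (MvPolynomial (Fin b) k) :=
      of fun i j => if i ∈ s then M' i j else M i j with hE
    have hEX : E *ᵥ X = M *ᵥ X := by
      ext1 i
      have hi := congrFun h i
      rw [mulVec, dotProduct] at hi ⊢
      by_cases his : i ∈ s
      · simpa [hE, his, mulVec, dotProduct] using hi.symm
      · simp [hE, his, mulVec, dotProduct]
    have e : (of fun i j => if i ∈ insert r s then M' i j else M i j) = E.updateRow r (M' r) := by
      ext i j
      by_cases hir : i = r
      · subst hir
        simp
      · simp [hE, hir]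
    have hEr : E r = M r := by
      ext1 j
      simp [hE, hr]
    have hz : ∑ i, X i * (M' r i - M r i) = 0 := by
      have := congrFun h r
      simp only [mulVec, dotProduct] at this
      simp only [mul_sub, Finset.sum_sub_distrib]
      simp only [mul_comm (X _)]
      rw [this, sub_self]
    obtain ⟨T, hT⟩ := exists_koszul_X _ hz
    have hd : (E.updateRow r (M' r)).det - E.det = ∑ p, (M' r p - M r p) * E.adjugate p r := by
      have h1 := det_eq_sum_mul_adjugate_row E r
      have h2 := det_eq_sum_mul_adjugate_row (E.updateRow r (M' r)) r
      simp only [adjugate_apply, updateRow_idem, updateRow_self] at h1 h2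
      rw [h1, h2, ← Finset.sum_sub_distrib]
      refine Finset.sum_congr rfl fun p _ => ?_
      rw [hEr, adjugate_apply, sub_mul]
    have hd2 := sum_antisymm_mul T X (fun p => E.adjugate p r)
    simp only [← hT] at hd2
    rw [e, ← sub_add_sub_cancel _ E.det]
    refine add_mem ?_ ih
    rw [hd, hd2, ← hEX]
    exact sum_mem fun p _ => sum_mem fun q _ =>
      Ideal.mul_mem_left _ _ (mul_adjugate_sub_mem E X r p q)

end Koszul

section Doubling

variable {ι : Type*} [Fintype ι] [DecidableEq ι] {k : Type*} [Field k]

/-- Apply the functional `ℓ` in the first block of variables. -/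
noncomputable def sliceOf (ℓ : MvPolynomial ι k →ₗ[k] k) :
    MvPolynomial (ι ⊕ ι) k →ₗ[k] MvPolynomial ι k :=
  (basisMonomials (ι ⊕ ι) k).constr k fun s =>
    ℓ (monomial (Finsupp.sumFinsuppEquivProdFinsupp s).1 1) •
      monomial (Finsupp.sumFinsuppEquivProdFinsupp s).2 1

lemma monomial_eq_inl_mul_inr (s : ι ⊕ ι →₀ ℕ) : (monomial s 1 : MvPolynomial (ι ⊕ ι) k) =
    rename Sum.inl (monomial (Finsupp.sumFinsuppEquivProdFinsupp s).1 1) *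
      rename Sum.inr (monomial (Finsupp.sumFinsuppEquivProdFinsupp s).2 1) := by
  rw [rename_monomial, rename_monomial, monomial_mul, mul_one]
  refine congrArg (fun t => monomial t (1 : k)) (Finsupp.ext fun x => ?_)
  rcases x with x | x
  · rw [Finsupp.add_apply, Finsupp.mapDomain_apply Sum.inl_injective,
      Finsupp.mapDomain_of_notMem_range _ _ (by simp)]
    simp
  · rw [Finsupp.add_apply, Finsupp.mapDomain_apply Sum.inr_injective,
      Finsupp.mapDomain_of_notMem_range _ _ (by simp)]
    simp

lemma sliceOf_monomial (ℓ : MvPolynomial ι k →ₗ[k] k) (s : ι ⊕ ι →₀ ℕ) :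
    sliceOf ℓ (monomial s 1) = ℓ (monomial (Finsupp.sumFinsuppEquivProdFinsupp s).1 1) •
      monomial (Finsupp.sumFinsuppEquivProdFinsupp s).2 1 := by
  have := (basisMonomials (ι ⊕ ι) k).constr_basis k (fun s =>
    ℓ (monomial (Finsupp.sumFinsuppEquivProdFinsupp s).1 1) •
      (monomial (Finsupp.sumFinsuppEquivProdFinsupp s).2 1 : MvPolynomial ι k)) s
  rw [coe_basisMonomials] at this
  exact this

lemma linearMap_ext_monomial {σ M : Type*} [AddCommGroup M] [Module k M]
    {f g : MvPolynomial σ k →ₗ[k] M} (h : ∀ s, f (monomial s 1) = g (monomial s 1)) : f = g := by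
  refine (basisMonomials σ k).ext fun s => ?_
  rw [coe_basisMonomials]
  exact h s

lemma sliceOf_inl_mul_inr (ℓ : MvPolynomial ι k →ₗ[k] k) (p q : MvPolynomial ι k) :
    sliceOf ℓ (rename Sum.inl p * rename Sum.inr q) = ℓ p • q := by
  have h : ((LinearMap.mul k _).compl₁₂ (rename (R := k) (Sum.inl : ι → ι ⊕ ι)).toLinearMap
      (rename (R := k) (Sum.inr : ι → ι ⊕ ι)).toLinearMap).compr₂ (sliceOf ℓ) =
      (LinearMap.lsmul k (MvPolynomial ι k) : k →ₗ[k] _).comp ℓ := by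
    refine linearMap_ext_monomial fun s => linearMap_ext_monomial fun t => ?_
    have := sliceOf_monomial ℓ (Finsupp.sumFinsuppEquivProdFinsupp.symm (s, t))
    rw [monomial_eq_inl_mul_inr] at this
    simpa using this
  exact congrArg (fun g => g p q) h

/-- The weights on a doubled set of variables. -/
abbrev doubleWeight (w : ι → ℕ) : ι ⊕ ι → ℤ := Sum.elim (fun i => (w i : ℤ)) fun i => (w i : ℤ)

lemma weight_doubleWeight (w : ι → ℕ) (s : ι ⊕ ι →₀ ℕ) :
    Finsupp.weight (doubleWeight w) s =
      (Finsupp.weight w (Finsupp.sumFinsuppEquivProdFinsupp s).1 : ℕ) +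
      (Finsupp.weight w (Finsupp.sumFinsuppEquivProdFinsupp s).2 : ℕ) := by
  simp [Finsupp.weight_apply, Finsupp.sum_fintype]

lemma weight_eq_zero_imp {w : ι → ℕ} (hw : ∀ i, w i ≠ 0) {s : ι →₀ ℕ}
    (h : Finsupp.weight w s = 0) : s = 0 := by
  rw [Finsupp.weight_apply, Finsupp.sum_fintype _ _ (by simp)] at h
  ext i
  have := Finset.sum_eq_zero_iff.1 h i (Finset.mem_univ i)
  simpa [hw i] using this

variable {ℓ : MvPolynomial ι k →ₗ[k] k} {w : ι → ℕ} {D : ℕ}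

lemma aeval_elim_inl_mul_inr {A : Type*} [CommRing A] [Algebra k A] (x y : ι → A)
    (p q : MvPolynomial ι k) :
    aeval (Sum.elim x y) (rename Sum.inl p * rename Sum.inr q) = aeval x p * aeval y q := by
  rw [map_mul, aeval_rename, aeval_rename, Sum.elim_comp_inl, Sum.elim_comp_inr]

lemma aeval_zero_monomial {A : Type*} [CommRing A] [Algebra k A] (s : ι →₀ ℕ) :
    aeval (0 : ι → A) (monomial s (1 : k)) = if s = 0 then 1 else 0 := by
  rw [show (0 : ι → A) = fun _ => 0 from rfl, aeval_zero', constantCoeff_monomial]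
  split_ifs <;> simp

lemma sliceOf_eq_C (hw : ∀ i, w i ≠ 0)
    (hℓ : ∀ s, Finsupp.weight w s ≠ D → ℓ (monomial s 1) = 0) {F : MvPolynomial (ι ⊕ ι) k}
    (hF : IsWeightedHomogeneous (doubleWeight w) F (D : ℤ)) :
    sliceOf ℓ F = C (ℓ (aeval (Sum.elim X 0) F)) := by
  induction hF using IsWeightedHomogeneous.induction_on with
  | zero => simp
  | add p q _ _ hp hq => simp only [map_add, hp, hq]
  | monomial s c hs =>
    rw [weight_doubleWeight] at hs
    rw [← mul_one c, ← smul_eq_mul, ← smul_monomial, map_smul, map_smul, map_smul,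
      smul_eq_mul, C_mul, smul_eq_C_mul]
    congr 1
    rw [monomial_eq_inl_mul_inr, sliceOf_inl_mul_inr, aeval_elim_inl_mul_inr, aeval_X_left_apply,
      aeval_zero_monomial]
    split_ifs with h
    · rw [h, mul_one, monomial_zero', smul_eq_C_mul, C_1, mul_one]
    · rw [hℓ, mul_zero, map_zero, zero_smul, C_0]
      intro h'
      exact h (weight_eq_zero_imp hw (by omega))

lemma sliceOf_inl_monomial_mul (hw : ∀ i, w i ≠ 0)
    (hℓ : ∀ s, Finsupp.weight w s ≠ D → ℓ (monomial s 1) = 0) {F : MvPolynomial (ι ⊕ ι) k}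
    {t : ι →₀ ℕ} (ht : Finsupp.weight w t = D) :
    sliceOf ℓ (rename Sum.inl (monomial t 1) * F) =
      ℓ (monomial t 1) • aeval (Sum.elim 0 X) F := by
  induction F using MvPolynomial.induction_on' with
  | add p q hp hq => rw [mul_add, map_add, map_add, smul_add, hp, hq]
  | monomial s c =>
    rw [← mul_one c, ← smul_eq_mul c, ← smul_monomial, mul_smul_comm, map_smul, map_smul,
      smul_comm _ c]
    congr 1
    rw [monomial_eq_inl_mul_inr, ← mul_assoc, ← map_mul, sliceOf_inl_mul_inr,
      aeval_elim_inl_mul_inr, aeval_X_left_apply, aeval_zero_monomial, monomial_mul, mul_one]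
    split_ifs with h
    · rw [h, add_zero, one_mul]
    · rw [hℓ, zero_smul, zero_mul, smul_zero]
      intro h'
      rw [map_add] at h'
      exact h (weight_eq_zero_imp hw (by omega))

lemma isWeightedHomogeneous_rename_inl {p : MvPolynomial ι k} {n : ℕ}
    (hp : IsWeightedHomogeneous w p n) :
    IsWeightedHomogeneous (doubleWeight w) (rename Sum.inl p) (n : ℤ) := by
  induction hp using IsWeightedHomogeneous.induction_on with
  | zero => simpa using isWeightedHomogeneous_zero _ _ _
  | add p q _ _ hp hq => simpa using hp.add hq
  | monomial s c hs =>
    rw [rename_monomial]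
    refine isWeightedHomogeneous_monomial _ _ _ ?_
    rw [← hs, Finsupp.weight_apply, Finsupp.weight_apply,
      Finsupp.sum_mapDomain_index (by simp) (by simp [add_mul]), Finsupp.sum_fintype _ _ (by simp),
      Finsupp.sum_fintype _ _ (by simp)]
    simp

lemma isWeightedHomogeneous_rename_inr {p : MvPolynomial ι k} {n : ℕ}
    (hp : IsWeightedHomogeneous w p n) :
    IsWeightedHomogeneous (doubleWeight w) (rename Sum.inr p) (n : ℤ) := by
  induction hp using IsWeightedHomogeneous.induction_on with
  | zero => simpa using isWeightedHomogeneous_zero _ _ _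
  | add p q _ _ hp hq => simpa using hp.add hq
  | monomial s c hs =>
    rw [rename_monomial]
    refine isWeightedHomogeneous_monomial _ _ _ ?_
    rw [← hs, Finsupp.weight_apply, Finsupp.weight_apply,
      Finsupp.sum_mapDomain_index (by simp) (by simp [add_mul]), Finsupp.sum_fintype _ _ (by simp),
      Finsupp.sum_fintype _ _ (by simp)]
    simp

lemma exists_inl_sub_inr_monomial (s : ι →₀ ℕ) :
    ∃ B : ι → MvPolynomial (ι ⊕ ι) k,
      (∀ j, IsWeightedHomogeneous (doubleWeight w) (B j) ((Finsupp.weight w s : ℕ) - w j : ℤ)) ∧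
      rename Sum.inl (monomial s (1 : k)) - rename Sum.inr (monomial s (1 : k)) =
        ∑ j, B j * (X (Sum.inl j) - X (Sum.inr j)) := by
  have hmul : ∀ s t : ι →₀ ℕ, (∃ B : ι → MvPolynomial (ι ⊕ ι) k,
      (∀ j, IsWeightedHomogeneous (doubleWeight w) (B j) ((Finsupp.weight w s : ℕ) - w j : ℤ)) ∧
      rename Sum.inl (monomial s (1 : k)) - rename Sum.inr (monomial s (1 : k)) =
        ∑ j, B j * (X (Sum.inl j) - X (Sum.inr j))) →
      (∃ B : ι → MvPolynomial (ι ⊕ ι) k,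
      (∀ j, IsWeightedHomogeneous (doubleWeight w) (B j) ((Finsupp.weight w t : ℕ) - w j : ℤ)) ∧
      rename Sum.inl (monomial t (1 : k)) - rename Sum.inr (monomial t (1 : k)) =
        ∑ j, B j * (X (Sum.inl j) - X (Sum.inr j))) →
      ∃ B : ι → MvPolynomial (ι ⊕ ι) k,
      (∀ j, IsWeightedHomogeneous (doubleWeight w) (B j)
        ((Finsupp.weight w (s + t) : ℕ) - w j : ℤ)) ∧
      rename Sum.inl (monomial (s + t) (1 : k)) - rename Sum.inr (monomial (s + t) (1 : k)) =
        ∑ j, B j * (X (Sum.inl j) - X (Sum.inr j)) := by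
    rintro s t ⟨B, hB, e⟩ ⟨B', hB', e'⟩
    have ht := isWeightedHomogeneous_rename_inl (k := k)
      (isWeightedHomogeneous_monomial w t 1 rfl)
    have hs := isWeightedHomogeneous_rename_inr (k := k)
      (isWeightedHomogeneous_monomial w s 1 rfl)
    refine ⟨fun j => rename Sum.inl (monomial t 1) * B j + rename Sum.inr (monomial s 1) * B' j,
      fun j => ?_, ?_⟩
    · refine IsWeightedHomogeneous.add ?_ ?_
      · convert ht.mul (hB j) using 1
        rw [map_add]
        push_cast
        ring
      · convert hs.mul (hB' j) using 1
        rw [map_add]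
        push_cast
        ring
    · have hst : (monomial (s + t) (1 : k)) = monomial s 1 * monomial t 1 := by
        rw [monomial_mul, mul_one]
      simp only [add_mul, Finset.sum_add_distrib, mul_assoc, ← Finset.mul_sum, ← e, ← e', hst,
        map_mul]
      ring
  have h0 : ∃ B : ι → MvPolynomial (ι ⊕ ι) k,
      (∀ j, IsWeightedHomogeneous (doubleWeight w) (B j)
        ((Finsupp.weight w (0 : ι →₀ ℕ) : ℕ) - w j : ℤ)) ∧
      rename Sum.inl (monomial (0 : ι →₀ ℕ) (1 : k)) - rename Sum.inr (monomial 0 (1 : k)) =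
        ∑ j, B j * (X (Sum.inl j) - X (Sum.inr j)) :=
    ⟨0, fun j => isWeightedHomogeneous_zero _ _ _, by simp⟩
  induction s using Finsupp.induction_linear with
  | zero => exact h0
  | add s t hs ht => exact hmul s t hs ht
  | single i n =>
    induction n with
    | zero =>
      rw [Finsupp.single_zero]
      exact h0
    | succ n ih =>
      rw [Finsupp.single_add]
      refine hmul _ _ ih ⟨Pi.single i 1, fun j => ?_, ?_⟩
      · by_cases hji : j = i
        · subst hji
          rw [Pi.single_eq_same]
          convert isWeightedHomogeneous_one k _ using 1
          simp [Finsupp.weight_apply]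
        · rw [Pi.single_eq_of_ne hji]
          exact isWeightedHomogeneous_zero _ _ _
      · rw [Finset.sum_eq_single_of_mem i (Finset.mem_univ i)]
        · rw [Pi.single_eq_same, one_mul, ← rename_X, ← rename_X]
          rfl
        · intro j _ hj
          rw [Pi.single_eq_of_ne hj, zero_mul]

/-- Divided differences of a weighted homogeneous polynomial. -/
lemma exists_inl_sub_inr {p : MvPolynomial ι k} {n : ℕ} (hp : IsWeightedHomogeneous w p n) :
    ∃ B : ι → MvPolynomial (ι ⊕ ι) k,
      (∀ j, IsWeightedHomogeneous (doubleWeight w) (B j) ((n : ℤ) - w j)) ∧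
      rename Sum.inl p - rename Sum.inr p = ∑ j, B j * (X (Sum.inl j) - X (Sum.inr j)) := by
  induction hp using IsWeightedHomogeneous.induction_on with
  | zero => exact ⟨0, fun j => isWeightedHomogeneous_zero _ _ _, by simp⟩
  | add p q _ _ hp hq =>
    obtain ⟨B, hB, e⟩ := hp
    obtain ⟨B', hB', e'⟩ := hq
    refine ⟨B + B', fun j => (hB j).add (hB' j), ?_⟩
    simp only [map_add, Pi.add_apply, add_mul, Finset.sum_add_distrib, ← e, ← e']
    ring
  | monomial s c hs =>
    obtain ⟨B, hB, e⟩ := exists_inl_sub_inr_monomial (k := k) (w := w) s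
    refine ⟨fun j => C c * B j, fun j => hs ▸ (hB j).C_mul c, ?_⟩
    have hc : monomial s c = C c * monomial s 1 := by rw [C_mul_monomial, mul_one]
    simp only [hc, map_mul, rename_C, ← mul_sub, e, Finset.mul_sum, mul_assoc]

/-- Divided differences specialize to partial derivatives on the diagonal. -/
lemma aeval_diag_of_inl_sub_inr {p : MvPolynomial ι k}
    {B : ι → MvPolynomial (ι ⊕ ι) k}
    (h : rename Sum.inl p - rename Sum.inr p = ∑ j, B j * (X (Sum.inl j) - X (Sum.inr j)))
    (i : ι) : aeval (Sum.elim X X) (B i) = pderiv i p := by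
  have h1 := congrArg (fun q => aeval (Sum.elim X X : ι ⊕ ι → MvPolynomial ι k)
    (pderiv (Sum.inl i) q)) h
  simp only [map_sub, map_sum, Derivation.leibniz, pderiv_inl_rename_inr,
    pderiv_rename Sum.inl_injective, sub_zero, smul_eq_mul, map_add, map_mul, aeval_X,
    Sum.elim_inl, Sum.elim_inr, sub_self, zero_mul, add_zero, aeval_rename, Sum.elim_comp_inl,
    aeval_X_left_apply] at h1
  rw [h1, Finset.sum_eq_single_of_mem i (Finset.mem_univ i)]
  · simp
  · intro j _ hj
    simp [hj]

end Doubling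

section Residue

variable {b : ℕ} {k : Type*} [Field k]

lemma prod_X_pow_notMem (N : ℕ) :
    ∏ j : Fin b, (X j : MvPolynomial (Fin b) k) ^ N ∉
      Ideal.span (Set.range fun j : Fin b => (X j : MvPolynomial (Fin b) k) ^ (N + 1)) := by
  have e : (Set.range fun j : Fin b => (X j : MvPolynomial (Fin b) k) ^ (N + 1)) =
      (fun s => monomial s (1 : k)) '' Set.range fun j => Finsupp.single j (N + 1) := by
    rw [← Set.range_comp]
    congr 1
    ext1 j
    simp [X_pow_eq_monomial]
  have e2 : ∏ j : Fin b, (X j : MvPolynomial (Fin b) k) ^ N =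
      monomial (∑ j, Finsupp.single j N) 1 := by
    rw [monomial_sum_one]
    simp [X_pow_eq_monomial]
  rw [e, e2, mem_ideal_span_monomial_image]
  intro h
  obtain ⟨t, ⟨j, rfl⟩, hj⟩ := h (∑ j, Finsupp.single j N) (by simp [mem_support_iff])
  have := hj j
  rw [Finsupp.finsetSum_apply, Finset.sum_eq_single_of_mem j (Finset.mem_univ j)] at this
  · simp at this
  · intro i _ hi
    simp [hi]

open Matrix in
/-- If `M *ᵥ X` generates an ideal containing powers of all variables, then `det M` does not
lie in this ideal. -/
theorem det_notMem_span {N : ℕ} (M : Matrix (Fin b) (Fin b) (MvPolynomial (Fin b) k))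
    (hN : ∀ j, X j ^ (N + 1) ∈ Ideal.span (Set.range (M *ᵥ X))) :
    M.det ∉ Ideal.span (Set.range (M *ᵥ X)) := by
  intro hM
  have hc : ∀ j, ∃ c : Fin b → MvPolynomial (Fin b) k, ∑ i, c i * (M *ᵥ X) i = X j ^ (N + 1) :=
    fun j => Ideal.mem_span_range_iff_exists_fun.1 (hN j)
  choose C hC using hc
  have hCM : (of C * M) *ᵥ X = fun j => X j ^ (N + 1) := by
    ext1 j
    rw [← mulVec_mulVec, mulVec, dotProduct, ← hC j]
    rfl
  have hdiag : (diagonal fun j : Fin b => (X j : MvPolynomial (Fin b) k) ^ N) *ᵥ X =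
      fun j => X j ^ (N + 1) := by
    ext1 j
    rw [mulVec_diagonal, pow_succ]
  have h1 := det_sub_det_mem (of C * M) _ (hCM.trans hdiag.symm)
  rw [hCM, det_diagonal, det_mul] at h1
  have h2 : (of C).det * M.det ∈
      Ideal.span (Set.range fun j : Fin b => (X j : MvPolynomial (Fin b) k) ^ (N + 1)) := by
    obtain ⟨c, hc⟩ := Ideal.mem_span_range_iff_exists_fun.1 hM
    rw [← hc, Finset.mul_sum]
    refine sum_mem fun i _ => ?_
    have h3 : (of C).det * (M *ᵥ X) i = ∑ j, (of C).adjugate i j * X j ^ (N + 1) := by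
      have h4 := congrFun (congrArg (fun E => (of C).adjugate *ᵥ E) hCM) i
      simp only [mulVec_mulVec] at h4
      rw [← Matrix.mul_assoc, adjugate_mul, smul_mul, one_mul, smul_mulVec, Pi.smul_apply,
        smul_eq_mul] at h4
      rw [h4]
      rfl
    rw [mul_left_comm, h3]
    exact Ideal.mul_mem_left _ _ (sum_mem fun j _ => Ideal.mul_mem_left _ _
      (Ideal.subset_span ⟨j, rfl⟩))
  have h5 := add_mem h1 h2
  rw [sub_add_cancel] at h5
  exact prod_X_pow_notMem N h5

lemma isWeightedHomogeneous_det {σ : Type*} {W : σ → ℤ}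
    {M : Matrix (Fin b) (Fin b) (MvPolynomial σ k)}
    {d w : Fin b → ℤ} (h : ∀ i j, IsWeightedHomogeneous W (M i j) (d i - w j)) :
    IsWeightedHomogeneous W M.det (∑ i, d i - ∑ i, w i) := by
  rw [Matrix.det_apply']
  refine IsWeightedHomogeneous.sum _ _ _ fun s _ => ?_
  have h1 := IsWeightedHomogeneous.prod Finset.univ (fun i => M (s i) i)
    (fun i => d (s i) - w i) fun i _ => h _ _
  rw [Finset.sum_sub_distrib, Equiv.sum_comp s d] at h1
  have := h1.C_mul ((Equiv.Perm.sign s : ℤ) : k)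
  simpa using this

variable [CharZero k] {w d : Fin b → ℕ} {f : Fin b → MvPolynomial (Fin b) k}

open Matrix in
lemma exists_euler_matrix (hd : ∀ i, d i ≠ 0) (hf : ∀ i, IsWeightedHomogeneous w (f i) (d i)) :
    ∃ A : Matrix (Fin b) (Fin b) (MvPolynomial (Fin b) k), A *ᵥ X = f ∧
      A.det * C (∏ i, (d i : k)) = C (∏ i, (w i : k)) * (of fun i j => pderiv j (f i)).det := by
  refine ⟨diagonal (fun i => C ((d i : k)⁻¹)) * (of fun i j => pderiv j (f i)) *
    diagonal fun j => C (w j : k), ?_, ?_⟩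
  · ext1 i
    have h1 := (hf i).sum_weight_X_mul_pderiv
    have hdi : (d i : k) ≠ 0 := Nat.cast_ne_zero.2 (hd i)
    rw [mulVec, dotProduct]
    simp only [mul_diagonal, diagonal_mul, of_apply]
    have e : ∑ j, C (d i : k)⁻¹ * (pderiv j) (f i) * C (w j : k) * X j =
        C (d i : k)⁻¹ * ∑ j, w j • (X j * pderiv j (f i)) := by
      rw [Finset.mul_sum]
      refine Finset.sum_congr rfl fun j _ => ?_
      rw [nsmul_eq_mul, map_natCast]
      ring
    rw [e, h1, nsmul_eq_mul, ← map_natCast (C : k →+* MvPolynomial (Fin b) k), ← mul_assoc,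
      ← C_mul, inv_mul_cancel₀ hdi, C_1, one_mul]
  · have h : (∏ i, C ((d i : k)⁻¹)) * C (∏ i, (d i : k)) = (1 : MvPolynomial (Fin b) k) := by
      rw [← map_prod, ← C_mul, ← Finset.prod_mul_distrib]
      simp [hd]
    rw [det_mul, det_mul, det_diagonal, det_diagonal, map_prod C fun i => (w i : k)]
    linear_combination (∏ i, C (w i : k)) * (of fun i j => pderiv j (f i)).det * h

end Residue

section Residue

variable {b : ℕ} {k : Type*} [Field k] [CharZero k]

open Matrix in
lemma mul_det_mem_span {A ι : Type*} [CommRing A] [DecidableEq ι] [Fintype ι]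
    (M : Matrix ι ι A) (u : ι → A) (j : ι) {J : Ideal A} (h : ∀ i, (M *ᵥ u) i ∈ J) :
    u j * M.det ∈ J := by
  have h1 := congrFun (congrArg (fun E => E *ᵥ u) (adjugate_mul M)) j
  simp only [← mulVec_mulVec, smul_mulVec, one_mulVec, Pi.smul_apply, smul_eq_mul] at h1
  rw [mul_comm, ← h1]
  exact sum_mem fun i _ => Ideal.mul_mem_left _ _ (h i)

lemma sliceOf_mem {ι : Type*} [Fintype ι] [DecidableEq ι] {ℓ : MvPolynomial ι k →ₗ[k] k}
    {I : Ideal (MvPolynomial ι k)} (hℓ : ∀ p ∈ I, ℓ p = 0) {F : MvPolynomial (ι ⊕ ι) k}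
    (hF : F ∈ I.map (rename (R := k) (Sum.inl : ι → ι ⊕ ι)) ⊔
      I.map (rename (R := k) (Sum.inr : ι → ι ⊕ ι))) : sliceOf ℓ F ∈ I := by
  have h1 : ∀ p ∈ I, ∀ r, sliceOf ℓ (r * rename Sum.inl p) ∈ I := by
    intro p hp r
    induction r using induction_inl_mul_inr with
    | hadd x y hx hy =>
      rw [add_mul, map_add]
      exact add_mem hx hy
    | hmul x y =>
      rw [mul_right_comm, ← map_mul, sliceOf_inl_mul_inr, hℓ _ (I.mul_mem_left _ hp), zero_smul]
      exact zero_mem _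
  have h2 : ∀ p ∈ I, ∀ r, sliceOf ℓ (r * rename Sum.inr p) ∈ I := by
    intro p hp r
    induction r using induction_inl_mul_inr with
    | hadd x y hx hy =>
      rw [add_mul, map_add]
      exact add_mem hx hy
    | hmul x y =>
      rw [mul_assoc, ← map_mul, sliceOf_inl_mul_inr, smul_eq_C_mul]
      exact I.mul_mem_left _ (I.mul_mem_left _ hp)
  obtain ⟨x, hx, y, hy, rfl⟩ := Submodule.mem_sup.1 hF
  rw [map_add]
  refine add_mem ?_ ?_
  · clear hF
    refine Submodule.span_induction (p := fun x _ => ∀ r, sliceOf ℓ (r * x) ∈ I) ?_ ?_ ?_ ?_ hx 1 |>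
      (by simpa using ·)
    · rintro _ ⟨p, hp, rfl⟩ r
      exact h1 p hp r
    · simp
    · intro x y _ _ hx hy r
      rw [mul_add, map_add]
      exact add_mem (hx r) (hy r)
    · intro a x _ hx r
      rw [smul_eq_mul, ← mul_assoc]
      exact hx _
  · clear hF
    refine Submodule.span_induction (p := fun x _ => ∀ r, sliceOf ℓ (r * x) ∈ I) ?_ ?_ ?_ ?_ hy 1 |>
      (by simpa using ·)
    · rintro _ ⟨p, hp, rfl⟩ r
      exact h2 p hp r
    · simp
    · intro x y _ _ hx hy r
      rw [mul_add, map_add]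
      exact add_mem (hx r) (hy r)
    · intro a x _ hx r
      rw [smul_eq_mul, ← mul_assoc]
      exact hx _

lemma exists_eq_sum_inl_mul_inr {ι : Type*} [Fintype ι] [DecidableEq ι]
    (F : MvPolynomial (ι ⊕ ι) k) : ∃ (n : ℕ) (p q : Fin n → MvPolynomial ι k),
      F = ∑ i, rename Sum.inl (p i) * rename Sum.inr (q i) := by
  induction F using induction_inl_mul_inr with
  | hadd f g hf hg =>
    obtain ⟨n, p, q, rfl⟩ := hf
    obtain ⟨m, p', q', rfl⟩ := hg
    refine ⟨n + m, Fin.append p p', Fin.append q q', ?_⟩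
    simp [Fin.sum_univ_add]
  | hmul p q => exact ⟨1, fun _ => p, fun _ => q, by simp⟩

/-- An element of the doubled ring which induces a dualizing pairing computes the dimension of
a quotient as a trace. -/
lemma finrank_of_sliceOf {ι Q : Type*} [Fintype ι] [DecidableEq ι] [CommRing Q] [Algebra k Q]
    {ℓ : MvPolynomial ι k →ₗ[k] k} (π : MvPolynomial ι k →ₐ[k] Q)
    (hsurj : Function.Surjective π) (hℓ : ∀ p, π p = 0 → ℓ p = 0)
    {F : MvPolynomial (ι ⊕ ι) k} {φ : k} (hφ : φ ≠ 0)
    (hF : ∀ p, π (sliceOf ℓ (rename Sum.inl p * F)) = φ • π p) :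
    Module.Finite k Q ∧ φ * (Module.finrank k Q : k) = ℓ (aeval (Sum.elim X X) F) := by
  obtain ⟨n, p, q, rfl⟩ := exists_eq_sum_inl_mul_inr F
  obtain ⟨s, hs⟩ := LinearMap.exists_rightInverse_of_surjective π.toLinearMap
    (LinearMap.range_eq_top.2 hsurj)
  have hπs : ∀ x, π (s x) = x := fun x => congrArg (fun g => g x) hs
  have hℓs : ∀ x, ℓ (s (π x)) = ℓ x := by
    intro x
    rw [← sub_eq_zero, ← map_sub]
    refine hℓ _ ?_
    rw [map_sub, hπs, sub_self]
  let g : Fin n → Q →ₗ[k] k := fun i => ℓ ∘ₗ s ∘ₗ LinearMap.mulLeft k (π (p i))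
  have hgi : ∀ i x, g i (π x) = ℓ (p i * x) := by
    intro i x
    change ℓ (s (π (p i) * π x)) = _
    rw [← map_mul π, hℓs]
  have hT : ∀ x, ∑ i, g i x • π (q i) = φ • x := by
    intro x
    obtain ⟨x, rfl⟩ := hsurj x
    have h := hF x
    rw [Finset.mul_sum, map_sum, map_sum] at h
    rw [← h]
    refine Finset.sum_congr rfl fun i _ => ?_
    rw [hgi, ← mul_assoc, ← map_mul, sliceOf_inl_mul_inr, map_smul, mul_comm x]
  have hfin : Module.Finite k Q := by
    classical
    refine ⟨⟨Finset.univ.image fun i => π (q i), ?_⟩⟩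
    rw [eq_top_iff]
    intro x _
    have hx : x = φ⁻¹ • ∑ i, g i x • π (q i) := by
      rw [hT, smul_smul, inv_mul_cancel₀ hφ, one_smul]
    rw [hx]
    exact Submodule.smul_mem _ _ (Submodule.sum_mem _ fun i _ => Submodule.smul_mem _ _
      (Submodule.subset_span (by simp)))
  refine ⟨hfin, ?_⟩
  have hT' : ∑ i, (g i).smulRight (π (q i)) = φ • LinearMap.id := by
    ext1 x
    simpa using hT x
  have h := congrArg (LinearMap.trace k Q) hT'
  rw [map_smul, LinearMap.trace_id, smul_eq_mul, map_sum] at h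
  rw [← h, map_sum, map_sum]
  refine Finset.sum_congr rfl fun i _ => ?_
  rw [LinearMap.trace_smulRight, hgi, aeval_elim_inl_mul_inr, aeval_X_left_apply,
    aeval_X_left_apply]


open Matrix

variable {w d : Fin b → ℕ} {D : ℕ} {f : Fin b → MvPolynomial (Fin b) k} {N : ℕ}
  {ℓ : MvPolynomial (Fin b) k →ₗ[k] k}

lemma sub_mul_det_mem {I : Ideal (MvPolynomial (Fin b) k)}
    {B : Matrix (Fin b) (Fin b) (MvPolynomial (Fin b ⊕ Fin b) k)}
    (hf : ∀ i, f i ∈ I)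
    (hB : ∀ i, rename Sum.inl (f i) - rename Sum.inr (f i) =
      ∑ j, B i j * (X (Sum.inl j) - X (Sum.inr j))) (p : MvPolynomial (Fin b) k) :
    (rename Sum.inl p - rename Sum.inr p) * B.det ∈
      I.map (rename (R := k) (Sum.inl : Fin b → Fin b ⊕ Fin b)) ⊔
      I.map (rename (R := k) (Sum.inr : Fin b → Fin b ⊕ Fin b)) := by
  have hj : ∀ j, (X (Sum.inl j) - X (Sum.inr j)) * B.det ∈
      I.map (rename (R := k) (Sum.inl : Fin b → Fin b ⊕ Fin b)) ⊔
      I.map (rename (R := k) (Sum.inr : Fin b → Fin b ⊕ Fin b)) := by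
    intro j
    refine mul_det_mem_span B (fun j => X (Sum.inl j) - X (Sum.inr j)) j fun i => ?_
    rw [mulVec, dotProduct, ← hB i]
    exact sub_mem (Ideal.mem_sup_left (Ideal.mem_map_of_mem _ (hf i)))
      (Ideal.mem_sup_right (Ideal.mem_map_of_mem _ (hf i)))
  induction p using MvPolynomial.induction_on' with
  | add p q hp hq =>
    rw [map_add, map_add, add_sub_add_comm, add_mul]
    exact add_mem hp hq
  | monomial s c =>
    obtain ⟨B', -, e⟩ := exists_inl_sub_inr_monomial (k := k) (w := (1 : Fin b → ℕ)) s
    have hc : monomial s c = C c * monomial s 1 := by rw [C_mul_monomial, mul_one]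
    rw [hc, map_mul, map_mul, rename_C, rename_C, ← mul_sub, e, mul_assoc, Finset.sum_mul]
    refine Ideal.mul_mem_left _ _ (sum_mem fun j _ => ?_)
    rw [mul_assoc]
    exact Ideal.mul_mem_left _ _ (hj j)

/-- A nonzero functional of socle degree which vanishes on a weighted homogeneous complete
intersection ideal is dualizing, and the quotient has the expected dimension. -/
theorem dualizing_of_completeIntersection (hw : ∀ i, w i ≠ 0) (hd : ∀ i, d i ≠ 0)
    (hD : ∑ i, d i = D + ∑ i, w i) (hf : ∀ i, IsWeightedHomogeneous w (f i) (d i))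
    (hN : ∀ j, X j ^ (N + 1) ∈ Ideal.span (Set.range f))
    (hℓ : ∀ p ∈ Ideal.span (Set.range f), ℓ p = 0)
    (hℓD : ∀ s, Finsupp.weight w s ≠ D → ℓ (monomial s 1) = 0) (hℓ0 : ℓ ≠ 0) :
    (∀ p, (∀ q, ℓ (q * p) = 0) → p ∈ Ideal.span (Set.range f)) ∧
    Module.Finite k (MvPolynomial (Fin b) k ⧸ Ideal.span (Set.range f)) ∧
    (Module.finrank k (MvPolynomial (Fin b) k ⧸ Ideal.span (Set.range f)) : k) *
      ∏ i, (w i : k) = ∏ i, (d i : k) := by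
  set I := Ideal.span (Set.range f) with hI
  have hfI : ∀ i, f i ∈ I := fun i => Ideal.subset_span ⟨i, rfl⟩
  choose B hBw hB using fun i => exists_inl_sub_inr (hf i)
  set F := (of B).det with hF
  have hFD : IsWeightedHomogeneous (doubleWeight w) F (D : ℤ) := by
    have := isWeightedHomogeneous_det (M := of B) (d := fun i => (d i : ℤ))
      (w := fun i => (w i : ℤ)) hBw
    convert this using 1
    rw [eq_sub_iff_add_eq]
    exact_mod_cast hD.symm
  have hf0 : ∀ i, aeval (0 : Fin b → MvPolynomial (Fin b) k) (f i) = 0 := by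
    intro i
    have h0 : aeval (0 : Fin b → MvPolynomial (Fin b) k) (f i) = C (constantCoeff (f i)) := by
      rw [show (0 : Fin b → MvPolynomial (Fin b) k) = fun _ => 0 from rfl, aeval_zero']
      rfl
    rw [h0, constantCoeff_eq, (hf i).coeff_eq_zero, C_0]
    simpa using (hd i).symm
  have hinl : (((of B).map (aeval (Sum.elim X 0 :
      Fin b ⊕ Fin b → MvPolynomial (Fin b) k))) *ᵥ X) = f := by
    ext1 i
    have := congrArg (aeval (Sum.elim X 0 : Fin b ⊕ Fin b → MvPolynomial (Fin b) k)) (hB i)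
    simp only [map_sub, map_sum, map_mul, aeval_X, Sum.elim_inl, Sum.elim_inr, aeval_rename,
      Sum.elim_comp_inl, Sum.elim_comp_inr, hf0, aeval_X_left_apply, Pi.zero_apply,
      sub_zero] at this
    rw [this]
    rfl
  have hinr : (((of B).map (aeval (Sum.elim 0 X :
      Fin b ⊕ Fin b → MvPolynomial (Fin b) k))) *ᵥ X) = f := by
    ext1 i
    have := congrArg (aeval (Sum.elim 0 X : Fin b ⊕ Fin b → MvPolynomial (Fin b) k)) (hB i)
    simp only [map_sub, map_sum, map_mul, aeval_X, Sum.elim_inl, Sum.elim_inr, aeval_rename,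
      Sum.elim_comp_inl, Sum.elim_comp_inr, hf0, aeval_X_left_apply, Pi.zero_apply,
      zero_sub, mul_neg, Finset.sum_neg_distrib, neg_inj] at this
    rw [this]
    rfl
  set φ := ℓ (aeval (Sum.elim X 0) F) with hφ
  have hsl : sliceOf ℓ F = C φ := sliceOf_eq_C hw hℓD hFD
  have hkey : ∀ p, sliceOf ℓ (rename Sum.inl p * F) - C φ * p ∈ I := by
    intro p
    have h1 := sliceOf_mem hℓ (sub_mul_det_mem (B := of B) hfI hB p)
    have : ∀ G : MvPolynomial (Fin b ⊕ Fin b) k,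
        sliceOf ℓ (rename Sum.inr p * G) = sliceOf ℓ G * p := by
      intro G
      induction G using induction_inl_mul_inr with
      | hadd x y hx hy => rw [mul_add, map_add, map_add, add_mul, hx, hy]
      | hmul x y =>
        rw [mul_left_comm, ← map_mul, sliceOf_inl_mul_inr, sliceOf_inl_mul_inr, smul_mul_assoc,
          mul_comm p]
    rwa [sub_mul, map_sub, ← hF, this, hsl] at h1
  have hφ0 : φ ≠ 0 := by
    intro h0
    obtain ⟨t, ht⟩ : ∃ t, ℓ (monomial t 1) ≠ 0 := by
      by_contra! h
      exact hℓ0 (linearMap_ext_monomial fun s => by simp [h])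
    have htD : Finsupp.weight w t = D := by
      by_contra h
      exact ht (hℓD t h)
    have h1 := hkey (monomial t 1)
    rw [sliceOf_inl_monomial_mul hw hℓD htD, h0, C_0, zero_mul, sub_zero, hF,
      AlgHom.map_det, smul_eq_C_mul] at h1
    have h2 := I.mul_mem_left (C (ℓ (monomial t 1))⁻¹) h1
    rw [← mul_assoc, ← C_mul, inv_mul_cancel₀ ht, C_1, one_mul] at h2
    rw [hI, ← hinr] at h2 hN
    exact det_notMem_span _ hN h2
  have hJ : ℓ (aeval (Sum.elim X X) F) * ∏ i, (w i : k) = φ * ∏ i, (d i : k) := by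
    obtain ⟨A, hA, hA'⟩ := exists_euler_matrix hd hf
    have h1 := det_sub_det_mem _ _ (hinl.trans hA.symm)
    rw [hinl] at h1
    have h2 := hℓ _ h1
    rw [map_sub, sub_eq_zero] at h2
    have h3 : aeval (Sum.elim X X) F = (of fun i j => pderiv j (f i)).det := by
      rw [hF, AlgHom.map_det]
      congr 1
      ext1 i j
      exact aeval_diag_of_inl_sub_inr (hB i) j
    have h4 := congrArg ℓ hA'
    rw [mul_comm, ← smul_eq_C_mul, ← smul_eq_C_mul, map_smul, map_smul, h2, ← h3,
      smul_eq_mul, smul_eq_mul] at h4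
    rw [mul_comm, ← h4, mul_comm, hφ, hF, AlgHom.map_det]
    rfl
  refine ⟨fun p hp => ?_, ?_⟩
  · have h1 : ∀ G : MvPolynomial (Fin b ⊕ Fin b) k, sliceOf ℓ (rename Sum.inl p * G) = 0 := by
      intro G
      induction G using induction_inl_mul_inr with
      | hadd x y hx hy => rw [mul_add, map_add, hx, hy, add_zero]
      | hmul x y => rw [← mul_assoc, ← map_mul, sliceOf_inl_mul_inr, mul_comm p, hp, zero_smul]
    have h2 := hkey p
    rw [h1, zero_sub, neg_mem_iff] at h2
    have h3 := I.mul_mem_left (C φ⁻¹) h2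
    rwa [← mul_assoc, ← C_mul, inv_mul_cancel₀ hφ0, C_1, one_mul] at h3
  · obtain ⟨h1, h2⟩ := finrank_of_sliceOf (Ideal.Quotient.mkₐ k I)
      (Ideal.Quotient.mkₐ_surjective k I)
      (fun p hp => hℓ p (Ideal.Quotient.eq_zero_iff_mem.1 hp)) (F := F) hφ0 (by
        intro p
        rw [← map_smul, smul_eq_C_mul]
        exact (Ideal.Quotient.mk_eq_mk_iff_sub_mem _ _).2 (hkey p))
    refine ⟨h1, mul_left_cancel₀ hφ0 ?_⟩
    rw [← mul_assoc, h2, hJ]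

end Residue

section ZeroLocus

lemma sum_range_eq_single_of_top {A : Type*} [CommRing A] {u g : ℕ → A} {m d : ℕ} (w : ℕ → A)
    (hu : ∀ j, d < j → u (j + 1) = 0) (hg : ∀ n, m < n → g n = 0) :
    ∑ j ∈ Finset.range (m + d + 1), w j * u (j + 1) * g (m + d - j) =
      w d * u (d + 1) * g m := by
  rw [Finset.sum_eq_single_of_mem d (by simp)]
  · rw [Nat.add_sub_cancel]
  · intro j _ hj
    rcases lt_or_gt_of_ne hj with h | h
    · rw [hg _ (by omega), mul_zero]
    · rw [hu j h, mul_zero, zero_mul]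

lemma exists_top_index {g : ℕ → ℂ} {N : ℕ} (hN : ∀ n, N < n → g n = 0) {m : ℕ} (hm : g m ≠ 0) :
    ∃ e, m ≤ e ∧ g e ≠ 0 ∧ ∀ n, e < n → g n = 0 := by
  have hmN : m ≤ N := by
    by_contra h
    exact hm (hN m (by omega))
  refine ⟨Nat.findGreatest (fun n => g n ≠ 0) N, Nat.le_findGreatest hmN hm,
    Nat.findGreatest_spec (P := fun n => g n ≠ 0) hmN hm, fun n hn => ?_⟩
  by_cases h : n ≤ N
  · simpa using Nat.findGreatest_is_greatest hn h
  · exact hN n (by omega)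

lemma eq_zero_of_recurrence {a b : ℕ} {u c h : ℕ → ℂ} (hu : ∀ j, b < j → u j = 0) (hc0 : c 0 = 1)
    (hc : ∀ n : ℕ, ((n : ℂ) + 1) * c (n + 1) = -∑ j ∈ Finset.range (n + 1),
      (((n - j : ℕ) : ℂ) + -a * ((j : ℂ) + 1)) * u (j + 1) * c (n - j))
    (hh : ∀ n : ℕ, ((n : ℂ) + 1) * h (n + 1) = -(∑ j ∈ Finset.range (n + 1),
      (((n - j : ℕ) : ℂ) + -a * ((j : ℂ) + 1)) * u (j + 1) * h (n - j) +
      ∑ j ∈ Finset.range (n + 1), ((j : ℂ) + 1) * u (j + 1) * c (n - j)))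
    (hcz : ∀ n, a * b < n → c n = 0) (hhz : ∀ i < b, h (a * b + 1 + i) = 0) (j : ℕ) :
    u (j + 1) = 0 := by
  have hhz' : ∀ n, a * b < n → h n = 0 := by
    intro n
    induction n using Nat.strong_induction_on with
    | _ n ih =>
      intro hn
      by_cases hnb : n ≤ a * b + b
      · have := hhz (n - (a * b + 1)) (by omega)
        rwa [Nat.add_sub_cancel' (by omega)] at this
      · obtain ⟨n, rfl⟩ := Nat.exists_eq_add_of_le' (show 1 ≤ n by omega)
        have h1 : ∀ j, u (j + 1) * h (n - j) = 0 ∧ u (j + 1) * c (n - j) = 0 := by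
          intro j
          by_cases hj : j + 1 ≤ b
          · rw [ih (n - j) (by omega) (by omega), hcz (n - j) (by omega)]
            simp
          · rw [hu _ (by omega)]
            simp
        have h2 := hh n
        simp only [mul_assoc, (h1 _).1, (h1 _).2, mul_zero, Finset.sum_const_zero, add_zero,
          neg_zero] at h2
        exact (mul_eq_zero.1 h2).resolve_left (Nat.cast_add_one_ne_zero n)
  by_contra hj
  obtain ⟨d, hjd, hd, hdmax⟩ := exists_top_index hu hj
  obtain ⟨d, rfl⟩ := Nat.exists_eq_add_of_le' (show 1 ≤ d by omega)
  have hdmax' : ∀ j, d < j → u (j + 1) = 0 := fun j hj => hdmax _ (by omega)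
  obtain ⟨e, -, he, hemax⟩ := exists_top_index hcz (m := 0) (by rw [hc0]; exact one_ne_zero)
  have key : ∀ m, ∀ g : ℕ → ℂ, (∀ n, m < n → g n = 0) → ∀ w : ℕ → ℂ,
      ∑ j ∈ Finset.range (m + d + 1), w j * u (j + 1) * g (m + d - j) =
      w d * u (d + 1) * g m := fun m g hg w => sum_range_eq_single_of_top w hdmax' hg
  have hed : (e : ℂ) + -a * ((d : ℂ) + 1) = 0 := by
    have h1 := hc (e + d)
    rw [key e c hemax (fun j => ((e + d - j : ℕ) : ℂ) + -a * ((j : ℂ) + 1)), hemax _ (by omega),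
      mul_zero, Nat.add_sub_cancel, eq_comm, neg_eq_zero] at h1
    simpa [he, hd] using h1
  have hhe : ∀ n, e < n → h n = 0 := by
    by_contra! hcon
    obtain ⟨m, hm, hm'⟩ := hcon
    obtain ⟨e', hme, he', hemax'⟩ := exists_top_index hhz' hm'
    have h1 := hh (e' + d)
    have hce : ∀ n, e' < n → c n = 0 := fun n hn => hemax n (by omega)
    rw [key e' h hemax' (fun j => ((e' + d - j : ℕ) : ℂ) + -a * ((j : ℂ) + 1)),
      key e' c hce (fun j => (j : ℂ) + 1), hemax' _ (by omega), hemax e' (by omega),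
      mul_zero, Nat.add_sub_cancel, mul_zero, add_zero, eq_comm, neg_eq_zero] at h1
    have h2 : (e' : ℂ) + -a * ((d : ℂ) + 1) = 0 := by simpa [he', hd] using h1
    have h3 : (e : ℂ) = e' := by linear_combination hed - h2
    have h4 : e = e' := by exact_mod_cast h3
    omega
  have h1 := hh (e + d)
  rw [key e h hhe (fun j => ((e + d - j : ℕ) : ℂ) + -a * ((j : ℂ) + 1)),
      key e c hemax (fun j => (j : ℂ) + 1), hhe _ (by omega),
      mul_zero, Nat.add_sub_cancel, hed, zero_mul, zero_mul, zero_add, eq_comm, neg_eq_zero] at h1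
  have h2 : (d : ℂ) + 1 ≠ 0 := Nat.cast_add_one_ne_zero d
  simp [he, hd, h2] at h1

/-- The sequence `1, x_0, …, x_{b-1}, 0, 0, …`. -/
def monicSeq {A : Type*} [Zero A] [One A] {b : ℕ} (x : Fin b → A) : ℕ → A
  | 0 => 1
  | j + 1 => if h : j < b then x ⟨j, h⟩ else 0

@[simp] lemma monicSeq_zero {A : Type*} [Zero A] [One A] {b : ℕ} (x : Fin b → A) :
    monicSeq x 0 = 1 := rfl

lemma monicSeq_succ {A : Type*} [Zero A] [One A] {b : ℕ} (x : Fin b → A) (i : Fin b) :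
    monicSeq x (i + 1) = x i := by
  simp [monicSeq]

lemma monicSeq_eq_zero {A : Type*} [Zero A] [One A] {b : ℕ} (x : Fin b → A) (j : ℕ) (h : b < j) :
    monicSeq x j = 0 := by
  rcases j with _ | j
  · omega
  · simp only [monicSeq]
    rw [dif_neg (by omega)]

lemma map_monicSeq {A B F : Type*} [Semiring A] [Semiring B] [FunLike F A B] [RingHomClass F A B]
    {b : ℕ} (φ : F) (x : Fin b → A) (j : ℕ) :
    φ (monicSeq x j) = monicSeq (fun i => φ (x i)) j := by
  rcases j with _ | j
  · simp
  · simp only [monicSeq]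
    split_ifs <;> simp

/-- `gseq` of the generic sequence, with a generic exponent. -/
noncomputable def genericGseq (b n : ℕ) : MvPolynomial (Fin b) (Polynomial ℂ) :=
  gseq (monicSeq X) (C Polynomial.X) n

lemma exists_genericGseq_eq_mul {a b n : ℕ} (hn : a * b < n) :
    ∃ G : MvPolynomial (Fin b) (Polynomial ℂ),
      genericGseq b n = C (Polynomial.X - Polynomial.C (-a : ℂ)) * G := by
  change C (Polynomial.X - Polynomial.C (-a : ℂ)) ∣ genericGseq b n
  rw [C_dvd_iff_dvd_coeff]
  intro s
  rw [Polynomial.dvd_iff_isRoot]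
  have h1 : mapAlgHom (σ := Fin b) (Polynomial.aeval (R := ℂ) (-a : ℂ)) (genericGseq b n) = 0 := by
    rw [genericGseq, map_gseq]
    simp only [map_monicSeq]
    have e : mapAlgHom (σ := Fin b) (Polynomial.aeval (R := ℂ) (-a : ℂ)) (C Polynomial.X) =
        (-a : MvPolynomial (Fin b) ℂ) := by
      rw [mapAlgHom_apply]
      simp
    rw [e]
    exact gseq_neg_eq_zero rfl (monicSeq_eq_zero _) hn
  have h2 := congrArg (coeff s) h1
  rw [coeff_zero, mapAlgHom_apply, coeff_map] at h2
  exact h2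

lemma isWeightedHomogeneous_genericGseq (b n : ℕ) :
    IsWeightedHomogeneous (fun i : Fin b => (i : ℕ) + 1) (genericGseq b n) n := by
  induction n using Nat.strong_induction_on with
  | _ n ih =>
    rcases n with _ | n
    · rw [genericGseq, gseq_zero]
      exact isWeightedHomogeneous_one _ _
    · have h := gseq_succ (monicSeq (X : Fin b → MvPolynomial (Fin b) (Polynomial ℂ)))
        (C Polynomial.X) n
      have e : genericGseq b (n + 1) = C (Polynomial.C ((n : ℂ) + 1)⁻¹) *
          (((n : MvPolynomial (Fin b) (Polynomial ℂ)) + 1) * genericGseq b (n + 1)) := by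
        have : (C (Polynomial.C ((n : ℂ) + 1)⁻¹) : MvPolynomial (Fin b) (Polynomial ℂ)) * (n + 1) =
            1 := by
          rw [show ((n : MvPolynomial (Fin b) (Polynomial ℂ)) + 1) =
              C (Polynomial.C ((n : ℂ) + 1)) by
            simp, ← C_mul, ← Polynomial.C_mul, inv_mul_cancel₀ (Nat.cast_add_one_ne_zero n)]
          simp
        rw [← mul_assoc, this, one_mul]
      rw [e]
      refine IsWeightedHomogeneous.C_mul ?_ _
      rw [genericGseq, h]
      refine (weightedHomogeneousSubmodule (Polynomial ℂ) (fun i : Fin b => (i : ℕ) + 1)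
        (n + 1)).neg_mem (IsWeightedHomogeneous.sum _ _ _ fun j hj => ?_)
      have hj' := Finset.mem_range.1 hj
      have e2 : (((n - j : ℕ) : MvPolynomial (Fin b) (Polynomial ℂ)) +
          C Polynomial.X * ((j : MvPolynomial (Fin b) (Polynomial ℂ)) + 1)) =
          C (((n - j : ℕ) : Polynomial ℂ) + Polynomial.X * ((j : Polynomial ℂ) + 1)) := by
        simp
      rw [e2, mul_assoc]
      refine IsWeightedHomogeneous.C_mul ?_ _
      have e3 : n + 1 = (j + 1) + (n - j) := by omega
      rw [e3]
      refine IsWeightedHomogeneous.mul ?_ (ih _ (by omega))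
      by_cases hjb : j < b
      · rw [monicSeq, dif_pos hjb]
        exact isWeightedHomogeneous_X _ _ _
      · rw [monicSeq_eq_zero _ _ (by omega)]
        exact isWeightedHomogeneous_zero _ _ _

open Polynomial in
lemma eq_zero_of_genericGseq {a b : ℕ} {G : ℕ → MvPolynomial (Fin b) ℂ[X]}
    (hG : ∀ i < b, genericGseq b (a * b + 1 + i) =
      MvPolynomial.C (Polynomial.X - Polynomial.C (-a : ℂ)) * G i) (x : Fin b → ℂ)
    (hx : ∀ i < b, MvPolynomial.eval x (MvPolynomial.map (evalRingHom (-a : ℂ)) (G i)) = 0) :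
    x = 0 := by
  set γ : ℕ → ℂ[X] := gseq (monicSeq fun i => Polynomial.C (x i)) Polynomial.X with hγ
  have hγG : ∀ n, γ n = MvPolynomial.aeval (fun i => Polynomial.C (x i)) (genericGseq b n) := by
    intro n
    have := map_gseq ((MvPolynomial.aeval (R := ℂ[X]) (fun i => Polynomial.C (x i))).restrictScalars
      ℂ) (monicSeq (MvPolynomial.X : Fin b → MvPolynomial (Fin b) ℂ[X]))
      (MvPolynomial.C Polynomial.X) n
    simp only [map_monicSeq, AlgHom.restrictScalars_apply, MvPolynomial.aeval_X,
      MvPolynomial.aeval_C, Algebra.algebraMap_self, RingHom.id_apply] at this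
    rw [hγ, ← this]
    rfl
  have hrec := fun n => gseq_succ (monicSeq fun i => Polynomial.C (x i)) (Polynomial.X : ℂ[X]) n
  have hu : ∀ j, (monicSeq fun i => Polynomial.C (x i)) j = Polynomial.C (monicSeq x j) :=
    fun j => (map_monicSeq Polynomial.C x j).symm
  have hE : ∀ G, MvPolynomial.eval x (MvPolynomial.map (evalRingHom (-a : ℂ)) G) =
      (MvPolynomial.aeval (fun i => Polynomial.C (x i)) G).eval (-a : ℂ) := by
    intro G
    induction G using MvPolynomial.induction_on with
    | C p => simp
    | add p q hp hq => simp [hp, hq]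
    | mul_X p i hp => simp [hp]
  have h := eq_zero_of_recurrence (a := a) (b := b) (u := monicSeq x)
    (c := fun n => (γ n).eval (-a : ℂ)) (h := fun n => (derivative (γ n)).eval (-a : ℂ))
    (monicSeq_eq_zero x) (by simp [hγ]) ?_ ?_ ?_ ?_
  · ext i
    rw [← monicSeq_succ x i, h]
    rfl
  · intro n
    have := congrArg (Polynomial.eval (-a : ℂ)) (hrec n)
    rw [← hγ] at this
    simpa only [Polynomial.eval_mul, Polynomial.eval_add, Polynomial.eval_natCast,
      Polynomial.eval_one, Polynomial.eval_neg, eval_finsetSum, hu,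
      Polynomial.eval_C, Polynomial.eval_X] using this
  · intro n
    have := congrArg (fun p => Polynomial.eval (-a : ℂ) (derivative p)) (hrec n)
    rw [← hγ] at this
    simp only [hu, derivative_mul, derivative_add, derivative_natCast, derivative_one,
      derivative_neg, derivative_sum, derivative_X, derivative_C,
      Polynomial.eval_mul, Polynomial.eval_add, Polynomial.eval_natCast,
      Polynomial.eval_one, Polynomial.eval_neg, eval_finsetSum, Polynomial.eval_zero,
      Polynomial.eval_C, Polynomial.eval_X] at this
    rw [← Finset.sum_add_distrib]
    simp only [add_zero, zero_add, zero_mul, mul_zero, one_mul] at this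
    rw [this]
    congr 1
    refine Finset.sum_congr rfl fun j _ => ?_
    ring
  · intro n hn
    obtain ⟨G', hG'⟩ := exists_genericGseq_eq_mul hn
    simp only [hγG, hG']
    simp
  · intro i hi
    simp only [hγG, hG i hi]
    have := hx i hi
    rw [hE] at this
    simp only [map_mul, MvPolynomial.aeval_C, Algebra.algebraMap_self, RingHom.id_apply,
      derivative_mul, derivative_X_sub_C, one_mul, Polynomial.eval_add, Polynomial.eval_mul, this,
      Polynomial.eval_sub, Polynomial.eval_X, Polynomial.eval_C, sub_self, zero_mul, add_zero]

lemma exists_X_pow_mem {a b : ℕ} {G : ℕ → MvPolynomial (Fin b) (Polynomial ℂ)}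
    (hG : ∀ i < b, genericGseq b (a * b + 1 + i) =
      C (Polynomial.X - Polynomial.C (-a : ℂ)) * G i) :
    ∃ N, ∀ j, X j ^ (N + 1) ∈ Ideal.span (Set.range fun i : Fin b =>
      map (Polynomial.evalRingHom (-a : ℂ)) (G i)) := by
  set I := Ideal.span (Set.range fun i : Fin b =>
      map (Polynomial.evalRingHom (-a : ℂ)) (G i)) with hI
  have h : ∀ j, ∃ n, (X j : MvPolynomial (Fin b) ℂ) ^ n ∈ I := by
    intro j
    rw [← Ideal.mem_radical_iff, ← vanishingIdeal_zeroLocus_eq_radical (K := ℂ),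
      mem_vanishingIdeal_iff]
    intro x hx
    have : x = 0 := eq_zero_of_genericGseq hG x fun i hi =>
      by simpa using hx _ (Ideal.subset_span ⟨⟨i, hi⟩, rfl⟩)
    simp [this]
  choose n hn using h
  refine ⟨∑ j, n j, fun j => I.pow_mem_of_pow_mem (hn j) ?_⟩
  exact (Finset.single_le_sum (fun _ _ => Nat.zero_le _) (Finset.mem_univ j)).trans
    (Nat.le_succ _)

lemma isWeightedHomogeneous_map_of_mul {b n : ℕ} {c : ℂ} {G : MvPolynomial (Fin b) (Polynomial ℂ)}
    (hG : genericGseq b n = C (Polynomial.X - Polynomial.C c) * G) :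
    IsWeightedHomogeneous (fun i : Fin b => (i : ℕ) + 1)
      (map (Polynomial.evalRingHom c) G) n := by
  intro s hs
  refine isWeightedHomogeneous_genericGseq b n ?_
  rw [hG, coeff_C_mul]
  refine mul_ne_zero (Polynomial.X_sub_C_ne_zero c) fun h => hs ?_
  rw [coeff_map, h, map_zero]

end ZeroLocus

section Degree

variable {ι : Type*} [DecidableEq ι] [Fintype ι] {k : Type*} [CommRing k] [IsDomain k]
  {β : Type*} [DecidableEq β] (χ : ι → β) (κ : k)

lemma isHomogeneous_dunklX (i l : ι) {f : MvPolynomial ι k} {n : ℕ} (hf : f.IsHomogeneous n) :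
    (dunklX χ κ i l f).IsHomogeneous n := by
  have hs : ∀ j, (swapVar k i j f).IsHomogeneous n := fun j => hf.rename_isHomogeneous
  rcases eq_or_ne l i with rfl | h
  · rw [dunklX_self]
    exact hf.add ((homogeneousSubmodule ι k n).smul_mem κ
      (Submodule.sum_mem _ fun j _ => hs j))
  by_cases hc : χ l = χ i
  · rw [dunklX_of_eq h hc]
    exact ((homogeneousSubmodule ι k n).neg_mem
      ((homogeneousSubmodule ι k n).smul_mem κ (hs l)))
  · rw [dunklX_of_ne hc]
    exact isHomogeneous_zero _ _ _

lemma isHomogeneous_dunkl (i : ι) {f : MvPolynomial ι k} {n : ℕ} (hf : f.IsHomogeneous (n + 1)) :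
    (dunkl χ κ i f).IsHomogeneous n := by
  have h : ∀ s : ι →₀ ℕ, ∀ c : k, ∃ m, (monomial s c).IsHomogeneous m ∧
      (dunkl χ κ i (monomial s c)).IsHomogeneous (m - 1) ∧
      (m = 0 → dunkl χ κ i (monomial s c) = 0) := by
    refine induction_on_monomial
      (fun c => ⟨0, isHomogeneous_C _ _, by rw [dunkl_C]; exact isHomogeneous_zero _ _ _,
        fun _ => dunkl_C _ _ _ _⟩) ?_
    rintro p l ⟨m, hp, hd, h0⟩
    refine ⟨m + 1, hp.mul (isHomogeneous_X _ _), ?_, by simp⟩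
    rw [mul_comm, dunkl_X_mul, Nat.add_sub_cancel]
    refine IsHomogeneous.add ?_ (isHomogeneous_dunklX χ κ i l hp)
    rcases m with _ | m
    · rw [h0 rfl, mul_zero]
      exact isHomogeneous_zero _ _ _
    · rw [add_comm m]
      exact (isHomogeneous_X _ _).mul hd
  rw [f.as_sum, map_sum]
  refine Submodule.sum_mem (homogeneousSubmodule ι k n) fun s hs => ?_
  obtain ⟨m, h1, h2, -⟩ := h s (coeff s f)
  have h3 : (monomial s (coeff s f)).IsHomogeneous (n + 1) :=
    isHomogeneous_monomial _ (hf.degree_eq_sum_deg_support hs).symm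
  rw [h1.inj_right h3 (by simpa using hs), Nat.add_sub_cancel] at h2
  exact h2

lemma dunkl_eq_zero_of_isHomogeneous_zero (i : ι) {f : MvPolynomial ι k}
    (hf : f.IsHomogeneous 0) : dunkl χ κ i f = 0 := by
  rw [totalDegree_eq_zero_iff_eq_C.1 (Nat.le_zero.1 hf.totalDegree_le), dunkl_C]

lemma dunklPairing_eq_zero_of_isHomogeneous {p f : MvPolynomial ι k} {m n : ℕ}
    (hp : p.IsHomogeneous m) (hf : f.IsHomogeneous n) (hmn : m ≠ n) :
    dunklPairing χ κ p f = 0 := by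
  have h : ∀ s : ι →₀ ℕ, ∀ c : k, ∃ m, (monomial s c).IsHomogeneous m ∧
      ∀ f n, f.IsHomogeneous n → m ≠ n → dunklPairing χ κ (monomial s c) f = 0 := by
    refine induction_on_monomial (fun c => ⟨0, isHomogeneous_C _ _, fun f n hf hn => ?_⟩) ?_
    · rw [dunklPairing_C_left, constantCoeff_eq, hf.coeff_eq_zero (by simpa using hn), mul_zero]
    rintro p l ⟨m, hp, h⟩
    refine ⟨m + 1, hp.mul (isHomogeneous_X _ _), fun f n hf hn => ?_⟩
    rw [mul_comm, dunklPairing_X_mul]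
    rcases n with _ | n
    · rw [dunkl_eq_zero_of_isHomogeneous_zero χ κ l hf, dunklPairing_zero_right]
    · exact h _ n (isHomogeneous_dunkl χ κ l hf) (by omega)
  have hsum : dunklPairing χ κ (∑ s ∈ p.support, monomial s (coeff s p)) f =
      ∑ s ∈ p.support, dunklPairing χ κ (monomial s (coeff s p)) f := by
    simp only [dunklPairing, map_sum, LinearMap.sum_apply]
  rw [p.as_sum, hsum]
  refine Finset.sum_eq_zero fun s hs => ?_
  obtain ⟨m', h1, h2⟩ := h s (coeff s p)
  have h3 : (monomial s (coeff s p)).IsHomogeneous m :=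
    isHomogeneous_monomial _ (hp.degree_eq_sum_deg_support hs).symm
  exact h2 f n hf (by rwa [h1.inj_right h3 (by simpa using hs)])

/-- Restriction of a polynomial to the diagonal line. -/
noncomputable def diagHom (ι k : Type*) [CommRing k] : MvPolynomial ι k →ₐ[k] Polynomial k :=
  aeval fun _ => Polynomial.X

lemma derivative_diagHom (f : MvPolynomial ι k) :
    Polynomial.derivative (diagHom ι k f) = diagHom ι k (∑ i, pderiv i f) := by
  induction f using MvPolynomial.induction_on with
  | C c => simp [diagHom]
  | add p q hp hq => simp only [map_add, Finset.sum_add_distrib, hp, hq]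
  | mul_X p l hp =>
    have h : ∑ i, pderiv i (p * X l) = p + (∑ i, pderiv i p) * X l := by
      rw [Finset.sum_mul, Finset.sum_congr rfl fun i _ => (pderiv i).leibniz p (X l),
        Finset.sum_add_distrib]
      congr 1
      · simp [pderiv_X, Pi.single_apply]
      · exact Finset.sum_congr rfl fun i _ => by rw [smul_eq_mul, mul_comm]
    have hX : diagHom ι k (X l) = Polynomial.X := by simp [diagHom]
    rw [h, map_mul (diagHom ι k), map_add, map_mul (diagHom ι k), Polynomial.derivative_mul, hp, hX,
      Polynomial.derivative_X, mul_one, add_comm]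

lemma eval_zero_diagHom (f : MvPolynomial ι k) :
    (diagHom ι k f).eval 0 = constantCoeff f := by
  induction f using MvPolynomial.induction_on with
  | C c => simp [diagHom]
  | add p q hp hq => simp only [map_add, Polynomial.eval_add, hp, hq]
  | mul_X p l hp => simp [diagHom]

lemma dunklPairing_sum_X_pow (n : ℕ) {f : MvPolynomial ι k}
    (hf : ∀ i j, swapVar k i j f = f) :
    dunklPairing (oneColor ι) κ ((∑ i, X i) ^ n) f =
      ((Polynomial.derivative^[n]) (diagHom ι k f)).eval 0 := by
  induction n generalizing f with
  | zero =>
    rw [pow_zero, ← C_1, dunklPairing_C_left, one_mul]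
    exact (eval_zero_diagHom f).symm
  | succ n ih =>
    have h1 : dunklPairing (oneColor ι) κ ((∑ i, X i) ^ (n + 1)) f =
        dunklPairing (oneColor ι) κ ((∑ i, X i) ^ n) (∑ i, dunkl (oneColor ι) κ i f) := by
      rw [dunklPairing, dunklPairing, pow_succ, dunklHom_mul, map_sum, LinearMap.sum_apply]
      simp only [dunklHom_X]
    have h2 : ∑ i, dunkl (oneColor ι) κ i f = ∑ i, pderiv i f :=
      Finset.sum_congr rfl fun i _ => dunkl_of_symm _ _ _ fun j _ => hf i j
    rw [h1, ih, Function.iterate_succ_apply, derivative_diagHom, h2]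
    intro i j
    have h3 : ∀ l, swapVar k i j (dunkl (oneColor ι) κ l f) =
        dunkl (oneColor ι) κ (Equiv.swap i j l) f := fun l => by
      have h4 := swapVar_dunkl (χ := oneColor ι) (i := i) (j := j) κ rfl l f
      rwa [hf i j] at h4
    rw [map_sum, Finset.sum_congr rfl fun l _ => h3 l]
    exact Equiv.sum_comp (Equiv.swap i j) fun l => dunkl (oneColor ι) κ l f

end Degree

section SignedHom

variable {b : ℕ} {k : Type*} [CommRing k] [IsDomain k]

/-- The homomorphism sending the variables to the signed elementary symmetric polynomials. -/
noncomputable def signedHom (b : ℕ) (k : Type*) [CommRing k] :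
    MvPolynomial (Fin b) k →ₐ[k] MvPolynomial (Fin b) k :=
  aeval fun j : Fin b => signedEsymm (Fin b) k (j + 1)

lemma signedHom_X (j : Fin b) : signedHom b k (X j) = signedEsymm (Fin b) k (j + 1) := by
  simp [signedHom]

lemma signedHom_mem_adjoin_psum [Algebra ℂ k] (p : MvPolynomial (Fin b) k) :
    signedHom b k p ∈ Algebra.adjoin k (Set.range fun n => psum (Fin b) k (n + 1)) := by
  induction p using MvPolynomial.induction_on with
  | C c => rw [← algebraMap_eq, AlgHom.commutes]; exact Subalgebra.algebraMap_mem _ _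
  | add p q hp hq => rw [map_add]; exact add_mem hp hq
  | mul_X p j hp =>
    rw [map_mul, signedHom_X, signedEsymm]
    exact mul_mem hp (mul_mem (pow_mem (neg_mem (one_mem _)) _) (esymm_mem_adjoin_psum _))

lemma map_signedHom {k' : Type*} [CommRing k'] [IsDomain k'] (φ : k →+* k')
    (p : MvPolynomial (Fin b) k) :
    map φ (signedHom b k p) = signedHom b k' (map φ p) := by
  induction p using MvPolynomial.induction_on with
  | C c => simp [signedHom]
  | add p q hp hq => simp only [map_add, hp, hq]
  | mul_X p j hp =>
    rw [map_mul, map_mul, map_mul, map_mul, hp, map_X, signedHom_X, signedHom_X, signedEsymm,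
      signedEsymm, map_mul, map_esymm, map_pow, map_neg, map_one]

lemma isHomogeneous_esymm {ι : Type*} [Fintype ι] (n : ℕ) : (esymm ι k n).IsHomogeneous n := by
  refine IsHomogeneous.sum _ _ _ fun s hs => ?_
  have h := IsHomogeneous.prod s (fun i => (X i : MvPolynomial ι k)) (fun _ => 1)
    fun i _ => isHomogeneous_X _ _
  rwa [Finset.sum_const, (Finset.mem_powersetCard.1 hs).2, smul_eq_mul, mul_one] at h

lemma isHomogeneous_signedEsymm {ι : Type*} [Fintype ι] (n : ℕ) :
    (signedEsymm ι k n).IsHomogeneous n := by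
  have h : (signedEsymm ι k n) = C ((-1) ^ n) * esymm ι k n := by simp [signedEsymm]
  rw [h]
  exact (isHomogeneous_esymm n).C_mul _

lemma isHomogeneous_signedHom_monomial (s : Fin b →₀ ℕ) :
    (signedHom b k (monomial s 1)).IsHomogeneous
      (Finsupp.weight (fun i : Fin b => (i : ℕ) + 1) s) := by
  rw [signedHom, aeval_monomial, map_one, one_mul, Finsupp.weight_apply, Finsupp.prod, Finsupp.sum]
  refine IsHomogeneous.prod _ _ _ fun i _ => ?_
  rw [smul_eq_mul, mul_comm]
  exact (isHomogeneous_signedEsymm _).pow _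

lemma esymm_eq_zero_of_card_lt {ι : Type*} [Fintype ι] {n : ℕ} (h : Fintype.card ι < n) :
    esymm ι k n = 0 := by
  rw [esymm, Finset.powersetCard_eq_empty.2 (by simpa using h), Finset.sum_empty]

lemma signedHom_monicSeq [Algebra ℂ k] (j : ℕ) :
    signedHom b k (monicSeq X j) = signedEsymm (Fin b) k j := by
  rcases j with _ | j
  · rw [monicSeq_zero, map_one, signedEsymm_zero]
  rcases lt_or_ge j b with h | h
  · have h1 := monicSeq_succ (X : Fin b → MvPolynomial (Fin b) k) ⟨j, h⟩
    simp only at h1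
    rw [h1, signedHom_X]
  · rw [monicSeq_eq_zero _ _ (by omega), map_zero, signedEsymm,
      esymm_eq_zero_of_card_lt (by simpa using by omega), mul_zero]

lemma signedHom_genericGseq (b n : ℕ) :
    signedHom b (Polynomial ℂ) (genericGseq b n) =
      gsym (Fin b) (Polynomial.X : Polynomial ℂ) n := by
  have h := map_gseq ((signedHom b (Polynomial ℂ)).restrictScalars ℂ) (monicSeq X)
    (C Polynomial.X) n
  rw [genericGseq, gsym]
  refine h.trans ?_
  congr 1
  · funext j
    exact signedHom_monicSeq j
  · exact (signedHom b (Polynomial ℂ)).commutes _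

end SignedHom

section Extension

variable {ι : Type*} [DecidableEq ι] [Fintype ι] {k k' : Type*} [CommRing k] [CommRing k']
  (φ : k →+* k')

lemma map_mem_adjoin_psum {v : MvPolynomial ι k}
    (hv : v ∈ Algebra.adjoin k (Set.range fun n => psum ι k (n + 1))) :
    map φ v ∈ Algebra.adjoin k' (Set.range fun n => psum ι k' (n + 1)) := by
  induction hv using Algebra.adjoin_induction with
  | mem x hx =>
    obtain ⟨n, rfl⟩ := hx
    refine Algebra.subset_adjoin ⟨n, ?_⟩
    simp [psum]
  | algebraMap c =>
    rw [algebraMap_eq, map_C]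
    exact Subalgebra.algebraMap_mem _ _
  | add x y _ _ hx hy => rw [map_add]; exact add_mem hx hy
  | mul x y _ _ hx hy => rw [map_mul]; exact mul_mem hx hy

lemma axisHom_map (i₀ : ι) (v : MvPolynomial ι k) :
    axisHom i₀ (map φ v) = (axisHom i₀ v).map φ := by
  induction v using MvPolynomial.induction_on with
  | C c => simp [axisHom]
  | add p q hp hq => simp only [map_add, Polynomial.map_add, hp, hq]
  | mul_X p j hp =>
    rw [map_mul, map_mul, map_mul, hp, Polynomial.map_mul]
    by_cases h : j = i₀ <;> simp [axisHom, h]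

end Extension

section LowerBound

variable {a b : ℕ}

/-- The lowest slice of the kernel. -/
noncomputable def bottomSlice (a b : ℕ) : MvPolynomial (Fin b) ℂ :=
  ∏ p : Fin b × Fin b, (-X p.2) ^ a

lemma isHomogeneous_bottomSlice : (bottomSlice a b).IsHomogeneous (a * b * b) := by
  have h := IsHomogeneous.prod Finset.univ
    (fun p : Fin b × Fin b => (-X p.2 : MvPolynomial (Fin b) ℂ) ^ a) (fun _ => 1 * a)
    fun p _ => (isHomogeneous_X ℂ p.2).neg.pow a
  rw [Finset.sum_const, Finset.card_univ, Fintype.card_prod, Fintype.card_fin, smul_eq_mul] at h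
  rw [bottomSlice, show a * b * b = b * b * (1 * a) by ring]
  exact h

lemma swapVar_bottomSlice (i j : Fin b) :
    swapVar ℂ i j (bottomSlice a b) = bottomSlice a b := by
  simp only [bottomSlice, map_prod, map_pow, map_neg, rename_X]
  exact Fintype.prod_equiv (Equiv.prodCongr 1 (Equiv.swap i j)) _ _ fun p => rfl

lemma diagHom_bottomSlice :
    diagHom (Fin b) ℂ (bottomSlice a b) = Polynomial.C ((-1) ^ (a * b * b)) *
      Polynomial.X ^ (a * b * b) := by
  simp only [bottomSlice, diagHom, map_prod, map_pow, map_neg, aeval_X, Finset.prod_const,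
    Finset.card_univ, Fintype.card_prod, Fintype.card_fin, ← pow_mul, map_one]
  rw [neg_pow]
  congr 2 <;> ring

/-- The functional given by the Dunkl pairing with the lowest slice. -/
noncomputable def bottomFunctional (a b : ℕ) : MvPolynomial (Fin b) ℂ →ₗ[ℂ] ℂ where
  toFun p := dunklPairing (oneColor (Fin b)) (-a : ℂ) (signedHom b ℂ p) (bottomSlice a b)
  map_add' p q := by rw [map_add, dunklPairing_add_left]
  map_smul' c p := by
    rw [map_smul, dunklPairing_smul_left, RingHom.id_apply, smul_eq_mul]

lemma bottomFunctional_apply (p : MvPolynomial (Fin b) ℂ) : bottomFunctional a b p =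
    dunklPairing (oneColor (Fin b)) (-a : ℂ) (signedHom b ℂ p) (bottomSlice a b) := rfl

lemma bottomFunctional_mul (p q : MvPolynomial (Fin b) ℂ) : bottomFunctional a b (p * q) =
    dunklPairing (oneColor (Fin b)) (-a : ℂ) (signedHom b ℂ p)
      (dunklHom (oneColor (Fin b)) (-a : ℂ) (signedHom b ℂ q) (bottomSlice a b)) := by
  rw [bottomFunctional_apply, dunklPairing, dunklPairing, map_mul, dunklHom_mul]

lemma bottomFunctional_monomial {s : Fin b →₀ ℕ}
    (hs : Finsupp.weight (fun i : Fin b => (i : ℕ) + 1) s ≠ a * b * b) :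
    bottomFunctional a b (monomial s 1) = 0 :=
  dunklPairing_eq_zero_of_isHomogeneous _ _ (isHomogeneous_signedHom_monomial s)
    isHomogeneous_bottomSlice hs

lemma bottomFunctional_ne_zero (i₀ : Fin b) : bottomFunctional a b ≠ 0 := by
  have hb : 0 < b := i₀.pos
  have h1 : signedHom b ℂ (-X ⟨0, hb⟩) = ∑ i, X i := by
    rw [map_neg, signedHom_X, signedEsymm]
    simp [esymm_one]
  have h2 : bottomFunctional a b ((-X ⟨0, hb⟩) ^ (a * b * b)) ≠ 0 := by
    rw [bottomFunctional_apply, map_pow, h1, dunklPairing_sum_X_pow _ _ swapVar_bottomSlice,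
      diagHom_bottomSlice, Polynomial.iterate_derivative_C_mul,
      Polynomial.iterate_derivative_X_pow_eq_C_mul]
    simp [Nat.descFactorial_self, Nat.factorial_ne_zero]
  exact fun h => h2 (by rw [h, LinearMap.zero_apply])

lemma dunklPairing_signedHom_eq_zero {n : ℕ} {G : MvPolynomial (Fin b) (Polynomial ℂ)} {c : ℂ}
    (hG : genericGseq b n = C (Polynomial.X - Polynomial.C c) * G) (i₀ : Fin b)
    {v : MvPolynomial (Fin b) ℂ}
    (hv : v ∈ Algebra.adjoin ℂ (Set.range fun n => psum (Fin b) ℂ (n + 1)))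
    (hn : (axisHom i₀ v).natDegree < n) :
    dunklPairing (oneColor (Fin b)) c (signedHom b ℂ (map (Polynomial.evalRingHom c) G)) v = 0 := by
  have h1 := dunklPairing_gsym_eq_zero (Polynomial.X : Polynomial ℂ) i₀
    (map_mem_adjoin_psum (Polynomial.C : ℂ →+* Polynomial ℂ) hv) (n := n) (by
      rw [axisHom_map]
      exact (Polynomial.natDegree_map_le).trans_lt hn)
  rw [← signedHom_genericGseq, hG, dunklPairing_comm, map_mul, ← algebraMap_eq, AlgHom.commutes,
    algebraMap_eq, ← smul_eq_C_mul, dunklPairing_smul_left] at h1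
  have h2 := (mul_eq_zero.1 h1).resolve_left (Polynomial.X_sub_C_ne_zero c)
  have h3 := map_dunklPairing (oneColor (Fin b)) (Polynomial.X : Polynomial ℂ)
    (Polynomial.evalRingHom c) (signedHom b (Polynomial ℂ) G) (map Polynomial.C v)
  rw [h2, map_zero, map_signedHom, map_map] at h3
  have h4 : (Polynomial.evalRingHom c).comp Polynomial.C = RingHom.id ℂ := by ext; simp
  rw [h4, map_id] at h3
  simpa using h3.symm

theorem choose_le_finrank_of_slices (ha : a ≠ 0) (i₀ : Fin b)
    (V : Submodule ℂ (MvPolynomial (Fin b) ℂ)) [FiniteDimensional ℂ V]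
    (hL : ∀ L : MvPolynomial (Fin b ⊕ Fin b) ℂ →ₗ[ℂ] MvPolynomial (Fin b) ℂ, IsSlice L →
      L (cauchyKernel (Fin b) ℂ a) ∈ V)
    (hV : ∀ v ∈ V, v ∈ Algebra.adjoin ℂ (Set.range fun n => psum (Fin b) ℂ (n + 1)) ∧
      (axisHom i₀ v).natDegree ≤ a * b) :
    (a * b + b).choose b ≤ Module.finrank ℂ V := by
  have hT : ∀ p, dunklHom (oneColor (Fin b)) (-a : ℂ) (signedHom b ℂ p) (bottomSlice a b) ∈ V := by
    intro p
    obtain ⟨L, h1, h2⟩ := exists_isSlice_cauchyKernel (ι := Fin b) (k := ℂ) a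
    obtain ⟨L', h3, h4⟩ := h1.exists_dunklHom ha (signedHom_mem_adjoin_psum p)
    rw [h2] at h4
    rw [bottomSlice, h4]
    exact hL _ h3
  choose G hG using fun i : ℕ =>
    exists_genericGseq_eq_mul (a := a) (b := b) (n := a * b + 1 + i) (by omega)
  obtain ⟨N, hN⟩ := exists_X_pow_mem (G := G) (a := a) (b := b) fun i _ => hG i
  set f : Fin b → MvPolynomial (Fin b) ℂ := fun i =>
    map (Polynomial.evalRingHom (-a : ℂ)) (G i) with hf
  have hdeg : ∑ i : Fin b, (a * b + 1 + (i : ℕ)) = a * b * b + ∑ i : Fin b, ((i : ℕ) + 1) := by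
    simp only [Finset.sum_add_distrib, Finset.sum_const, Finset.card_univ, Fintype.card_fin,
      smul_eq_mul]
    ring
  obtain ⟨h1, h2, h3⟩ := dualizing_of_completeIntersection (ℓ := bottomFunctional a b)
    (w := fun i : Fin b => (i : ℕ) + 1) (d := fun i : Fin b => a * b + 1 + (i : ℕ)) (f := f)
    (by simp) (by simp) hdeg
    (fun i => isWeightedHomogeneous_map_of_mul (hG i)) hN
    (fun p hp => by
      obtain ⟨c, rfl⟩ := Ideal.mem_span_range_iff_exists_fun.1 hp
      rw [map_sum]
      refine Finset.sum_eq_zero fun i _ => ?_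
      rw [mul_comm, bottomFunctional_mul]
      obtain ⟨h4, h5⟩ := hV _ (hT (c i))
      exact dunklPairing_signedHom_eq_zero (hG i) i₀ h4 (by omega))
    (fun s hs => bottomFunctional_monomial hs) (bottomFunctional_ne_zero i₀)
  have hfin : Module.finrank ℂ (MvPolynomial (Fin b) ℂ ⧸ Ideal.span (Set.range f)) =
      (a * b + b).choose b := by
    have h4 : ∏ i : Fin b, (((i : ℕ) + 1 : ℕ) : ℂ) = (b.factorial : ℂ) := by
      rw [← Nat.cast_prod, Fin.prod_univ_eq_prod_range (fun i => i + 1),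
        Finset.prod_range_add_one_eq_factorial]
    have h5 : ∏ i : Fin b, ((a * b + 1 + (i : ℕ) : ℕ) : ℂ) =
        ((b.factorial * (a * b + b).choose b : ℕ) : ℂ) := by
      rw [← Nat.cast_prod, Fin.prod_univ_eq_prod_range (fun i => a * b + 1 + i),
        ← Nat.ascFactorial_eq_prod_range, Nat.ascFactorial_eq_factorial_mul_choose]
    rw [h4, h5] at h3
    have h6 := Nat.cast_injective (R := ℂ) ((Nat.cast_mul _ _).trans h3)
    exact Nat.eq_of_mul_eq_mul_right b.factorial_pos (h6.trans (mul_comm _ _))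
  rw [← hfin]
  obtain ⟨s, hs⟩ := LinearMap.exists_rightInverse_of_surjective
    (Ideal.Quotient.mkₐ ℂ (Ideal.span (Set.range f))).toLinearMap
    (LinearMap.range_eq_top.2 (Ideal.Quotient.mkₐ_surjective ℂ _))
  let T : MvPolynomial (Fin b) ℂ →ₗ[ℂ] V :=
    { toFun := fun p => ⟨_, hT p⟩
      map_add' := fun p q => Subtype.ext (by simp)
      map_smul' := fun c p => Subtype.ext (by simp) }
  refine LinearMap.finrank_le_finrank_of_injective (f := T.comp s) ?_
  rw [← LinearMap.ker_eq_bot, LinearMap.ker_eq_bot']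
  intro x hx
  have h4 : s x ∈ Ideal.span (Set.range f) := h1 _ fun q => by
    rw [bottomFunctional_mul]
    have h5 : dunklHom (oneColor (Fin b)) (-a : ℂ) (signedHom b ℂ (s x)) (bottomSlice a b) = 0 :=
      congrArg Subtype.val hx
    rw [h5, dunklPairing_zero_right]
  have h6 := LinearMap.congr_fun hs x
  exact h6.symm.trans (Ideal.Quotient.eq_zero_iff_mem.2 h4)

end LowerBound

section Coefficients

/-- The generic polynomial `∑ u_i t^i` of degree `b`. -/
noncomputable def genPoly (b : ℕ) : Polynomial (MvPolynomial (Fin (b + 1)) ℂ) :=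
  ∑ i : Fin (b + 1), Polynomial.C (X i) * Polynomial.X ^ (i : ℕ)

lemma coeff_aeval_X_one {A : Type*} [CommRing A] {F : MvPolynomial (Fin 2) A} {n j : ℕ}
    (hF : F.IsHomogeneous n) :
    (aeval ![(Polynomial.X : Polynomial A), 1] F).coeff j =
      coeff (Finsupp.single 0 j + Finsupp.single 1 (n - j)) F := by
  have h : ∀ s : Fin 2 →₀ ℕ, s.degree = n → ∀ c : A,
      (aeval ![(Polynomial.X : Polynomial A), 1] (monomial s c)).coeff j =
      coeff (Finsupp.single 0 j + Finsupp.single 1 (n - j)) (monomial s c) := by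
    intro s hs c
    have hs' : s 0 + s 1 = n := by
      rw [← hs, Finsupp.degree_eq_sum, Fin.sum_univ_two]
    have he : s = Finsupp.single 0 j + Finsupp.single 1 (n - j) ↔ j = s 0 := by
      refine ⟨fun e => by rw [e]; simp, fun e => Finsupp.ext fun x => ?_⟩
      fin_cases x <;> simp [e]
      omega
    rw [coeff_monomial, aeval_monomial, Finsupp.prod_fintype _ _ (by simp), Fin.prod_univ_two,
      Polynomial.algebraMap_eq]
    simp only [Matrix.cons_val_zero, Matrix.cons_val_one, one_pow, mul_one, he,
      Polynomial.coeff_C_mul_X_pow]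
  conv_lhs => rw [F.as_sum]
  conv_rhs => rw [F.as_sum]
  rw [map_sum, Polynomial.finsetSum_coeff, coeff_sum]
  exact Finset.sum_congr rfl fun s hs => h s (hF.degree_eq_sum_deg_support hs).symm _

lemma isHomogeneous_genForm (b : ℕ) : (genForm b).IsHomogeneous b := by
  refine IsHomogeneous.sum _ _ _ fun i _ => ?_
  have h := ((isHomogeneous_C (Fin 2) (X i : MvPolynomial (Fin (b + 1)) ℂ)).mul
    (isHomogeneous_X_pow 0 (i : ℕ))).mul (isHomogeneous_X_pow 1 (b - i))
  rwa [show 0 + (i : ℕ) + (b - i) = b by omega] at h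

lemma coeffC_eq (a b j : ℕ) : coeffC a b j = (genPoly b ^ a).coeff j := by
  have h := (isHomogeneous_genForm b).pow a
  rw [mul_comm b a] at h
  rw [coeffC, ← coeff_aeval_X_one h, map_pow, genForm, genPoly, map_sum]
  simp [MvPolynomial.algHom_C]

lemma isWeightedHomogeneous_coeff_pow {σ k : Type*} [CommRing k] (w : σ → ℕ) (r s : ℕ)
    {P : Polynomial (MvPolynomial σ k)}
    (h : ∀ i, IsWeightedHomogeneous w (P.coeff i) (r + s * i)) (a i : ℕ) :
    IsWeightedHomogeneous w ((P ^ a).coeff i) (a * r + s * i) := by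
  induction a generalizing i with
  | zero =>
    rw [pow_zero, Polynomial.coeff_one]
    split_ifs with hi
    · subst hi
      simpa using isWeightedHomogeneous_one k w
    · exact isWeightedHomogeneous_zero _ _ _
  | succ a ih =>
    rw [pow_succ, Polynomial.coeff_mul]
    refine IsWeightedHomogeneous.sum _ _ _ fun p hp => ?_
    have h1 := (ih p.1).mul (h p.2)
    rw [Finset.HasAntidiagonal.mem_antidiagonal] at hp
    rwa [show a * r + s * p.1 + (r + s * p.2) = (a + 1) * r + s * i by rw [← hp]; ring] at h1

lemma coeff_genPoly {b : ℕ} (i : Fin (b + 1)) : (genPoly b).coeff i = X i := by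
  simp only [genPoly, Polynomial.finsetSum_coeff, Polynomial.coeff_C_mul_X_pow]
  rw [Finset.sum_eq_single i] <;> simp +contextual [Fin.ext_iff, eq_comm]

lemma coeff_genPoly_of_lt {b i : ℕ} (h : b < i) : (genPoly b).coeff i = 0 := by
  simp only [genPoly, Polynomial.finsetSum_coeff, Polynomial.coeff_C_mul_X_pow]
  exact Finset.sum_eq_zero fun j _ => if_neg (by omega)

lemma isHomogeneous_coeffC (a b j : ℕ) : (coeffC a b j).IsHomogeneous a := by
  have h := isWeightedHomogeneous_coeff_pow (P := genPoly b) 1 1 0 (fun i => ?_) a j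
  · rw [coeffC_eq]
    rw [zero_mul, add_zero, mul_one] at h
    exact h
  rcases lt_or_ge b i with hi | hi
  · rw [coeff_genPoly_of_lt hi]
    exact isWeightedHomogeneous_zero _ _ _
  · rw [coeff_genPoly ⟨i, by omega⟩, zero_mul, add_zero]
    exact isHomogeneous_X _ _

lemma isWeightedHomogeneous_coeffC (a b j : ℕ) :
    IsWeightedHomogeneous (fun i : Fin (b + 1) => (i : ℕ)) (coeffC a b j) j := by
  have h := isWeightedHomogeneous_coeff_pow (P := genPoly b) (fun i : Fin (b + 1) => (i : ℕ)) 0 1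
    (fun i => ?_) a j
  · rw [coeffC_eq]
    simpa using h
  rcases lt_or_ge b i with hi | hi
  · rw [coeff_genPoly_of_lt hi]
    exact isWeightedHomogeneous_zero _ _ _
  · rw [coeff_genPoly ⟨i, by omega⟩]
    simpa using isWeightedHomogeneous_X ℂ (fun i : Fin (b + 1) => (i : ℕ)) _

lemma isHomogeneous_FH {a b n : ℕ} {p : MvPolynomial (Fin (a * b + 1)) ℂ}
    (hp : p.IsHomogeneous n) : (FH a b p).IsHomogeneous (a * n) :=
  hp.aeval _ fun j => isHomogeneous_coeffC a b j

end Coefficients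

section Roots

/-- The monic polynomial with the variables as roots. -/
noncomputable def rootPoly (b : ℕ) : Polynomial (MvPolynomial (Fin b) ℂ) :=
  ∏ j : Fin b, (Polynomial.X - Polynomial.C (X j))

lemma natDegree_rootPoly (b : ℕ) : (rootPoly b).natDegree = b := by
  rw [rootPoly, Polynomial.natDegree_finsetProd_X_sub_C_eq_card, Finset.card_univ,
    Fintype.card_fin]

/-- The specialisation of the generic polynomial to the one with the variables as roots. -/
noncomputable def rootHom (b : ℕ) : MvPolynomial (Fin (b + 1)) ℂ →ₐ[ℂ] MvPolynomial (Fin b) ℂ :=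
  aeval fun i => (rootPoly b).coeff i

lemma map_rootHom_genPoly (b : ℕ) : (genPoly b).map (rootHom b : _ →+* _) = rootPoly b := by
  rw [(rootPoly b).as_sum_range_C_mul_X_pow, natDegree_rootPoly, genPoly, Polynomial.map_sum,
    ← Fin.sum_univ_eq_sum_range (fun i => Polynomial.C ((rootPoly b).coeff i) * Polynomial.X ^ i)]
  simp [rootHom]

lemma rootHom_coeffC (a b j : ℕ) : rootHom b (coeffC a b j) = (rootPoly b ^ a).coeff j := by
  rw [coeffC_eq, ← map_rootHom_genPoly, ← Polynomial.map_pow, Polynomial.coeff_map]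
  rfl

lemma coeff_rootPoly_mem_adjoin_psum (b i : ℕ) : (rootPoly b).coeff i ∈
    Algebra.adjoin ℂ (Set.range fun n => psum (Fin b) ℂ (n + 1)) := by
  rcases le_or_gt i b with h | h
  · have h1 := Multiset.prod_X_sub_C_coeff
      ((Finset.univ : Finset (Fin b)).val.map (X : Fin b → MvPolynomial (Fin b) ℂ)) (k := i)
      (by simpa using h)
    rw [← esymm_eq_multiset_esymm, Multiset.map_map] at h1
    have h2 : rootPoly b = (Multiset.map ((fun t => Polynomial.X - Polynomial.C t) ∘ X)
      (Finset.univ : Finset (Fin b)).val).prod := rfl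
    rw [h2, h1]
    exact mul_mem (pow_mem (neg_mem (one_mem _)) _) (esymm_mem_adjoin_psum _)
  · rw [Polynomial.coeff_eq_zero_of_natDegree_lt (by rwa [natDegree_rootPoly])]
    exact zero_mem _

lemma rootHom_mem_adjoin_psum (b : ℕ) (p : MvPolynomial (Fin (b + 1)) ℂ) : rootHom b p ∈
    Algebra.adjoin ℂ (Set.range fun n => psum (Fin b) ℂ (n + 1)) := by
  induction p using MvPolynomial.induction_on with
  | C c => rw [← algebraMap_eq, AlgHom.commutes]; exact Subalgebra.algebraMap_mem _ _
  | add p q hp hq => rw [map_add]; exact add_mem hp hq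
  | mul_X p j hp =>
    rw [map_mul]
    refine mul_mem hp ?_
    rw [rootHom, aeval_X]
    exact coeff_rootPoly_mem_adjoin_psum _ _

lemma natDegree_axisHom_coeff_rootPoly {b : ℕ} (i₀ : Fin b) (i : ℕ) :
    (axisHom i₀ ((rootPoly b).coeff i)).natDegree ≤ 1 := by
  have h : (rootPoly b).map (axisHom (k := ℂ) i₀).toRingHom =
      (Polynomial.X - Polynomial.C Polynomial.X) * Polynomial.X ^ (b - 1) := by
    rw [rootPoly, Polynomial.map_prod, ← Finset.mul_prod_erase _ _ (Finset.mem_univ i₀)]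
    congr 1
    · simp [axisHom]
    · rw [Finset.prod_congr rfl (g := fun _ => Polynomial.X), Finset.prod_const,
        Finset.card_erase_of_mem (Finset.mem_univ _), Finset.card_univ, Fintype.card_fin]
      intro j hj
      simp [axisHom, Finset.ne_of_mem_erase hj]
  have h1 : axisHom i₀ ((rootPoly b).coeff i) =
      ((rootPoly b).map (axisHom (k := ℂ) i₀).toRingHom).coeff i := by
    rw [Polynomial.coeff_map]; rfl
  rw [h1, h, sub_mul, ← pow_succ', Polynomial.coeff_sub, Polynomial.coeff_C_mul,
    Polynomial.coeff_X_pow, Polynomial.coeff_X_pow]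
  refine (Polynomial.natDegree_sub_le _ _).trans (max_le ?_ ?_)
  · split_ifs <;> simp
  · split_ifs <;> simp

lemma natDegree_axisHom_rootHom {b : ℕ} (i₀ : Fin b) {p : MvPolynomial (Fin (b + 1)) ℂ} {n : ℕ}
    (hp : p.IsHomogeneous n) : (axisHom i₀ (rootHom b p)).natDegree ≤ n := by
  have h : axisHom i₀ (rootHom b p) =
      aeval (fun i : Fin (b + 1) => axisHom i₀ ((rootPoly b).coeff i)) p := by
    rw [rootHom, ← AlgHom.comp_apply, comp_aeval]
  rw [h]
  have h1 := aeval_natDegree_le p hp.totalDegree_le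
    (fun i : Fin (b + 1) => axisHom (k := ℂ) i₀ ((rootPoly b).coeff i))
    fun i => natDegree_axisHom_coeff_rootPoly i₀ i
  rwa [mul_one] at h1

/-- The symmetric polynomials arising from products of `n` coefficients. -/
noncomputable def sliceSpace (a b n : ℕ) : Submodule ℂ (MvPolynomial (Fin b) ℂ) :=
  (homogeneousSubmodule (Fin (a * b + 1)) ℂ n).map ((rootHom b).comp (FH a b)).toLinearMap

lemma cauchyKernel_eq_sum (a b : ℕ) :
    cauchyKernel (Fin b) ℂ a = ∑ m : Fin b → Fin (a * b + 1),
      rename Sum.inr (∏ i, (rootPoly b ^ a).coeff (m i)) *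
        rename Sum.inl (∏ i, X i ^ (m i : ℕ)) := by
  have h : ∀ i : Fin b, ∏ j : Fin b, (X (Sum.inl i) - X (Sum.inr j)) ^ a =
      ∑ m : Fin (a * b + 1), rename Sum.inr ((rootPoly b ^ a).coeff m) *
        (X (Sum.inl i) ^ (m : ℕ) : MvPolynomial (Fin b ⊕ Fin b) ℂ) := by
    intro i
    have hd : (rootPoly b ^ a).natDegree < a * b + 1 :=
      Nat.lt_succ_of_le (Polynomial.natDegree_pow_le.trans (by rw [natDegree_rootPoly]))
    have h1 : Polynomial.eval₂ (rename (R := ℂ) (Sum.inr : Fin b → Fin b ⊕ Fin b)).toRingHom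
        (X (Sum.inl i) : MvPolynomial (Fin b ⊕ Fin b) ℂ) (rootPoly b ^ a) =
        ∏ j : Fin b, (X (Sum.inl i) - X (Sum.inr j)) ^ a := by
      rw [Polynomial.eval₂_pow, rootPoly, Polynomial.eval₂_finsetProd, ← Finset.prod_pow]
      simp
    rw [← h1, Polynomial.eval₂_eq_sum_range' _ hd, ← Fin.sum_univ_eq_sum_range
      (fun m => (rename (R := ℂ) (Sum.inr : Fin b → Fin b ⊕ Fin b)).toRingHom
        ((rootPoly b ^ a).coeff m) *
        (X (Sum.inl i) : MvPolynomial (Fin b ⊕ Fin b) ℂ) ^ m)]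
    rfl
  rw [cauchyKernel, Fintype.prod_prod_type, Finset.prod_congr rfl fun i _ => h i,
    Finset.prod_univ_sum, Fintype.piFinset_univ]
  refine Finset.sum_congr rfl fun m _ => ?_
  rw [Finset.prod_mul_distrib, map_prod, map_prod]
  simp

lemma slice_cauchyKernel_mem {a b : ℕ}
    {L : MvPolynomial (Fin b ⊕ Fin b) ℂ →ₗ[ℂ] MvPolynomial (Fin b) ℂ} (hL : IsSlice L) :
    L (cauchyKernel (Fin b) ℂ a) ∈ sliceSpace a b b := by
  rw [cauchyKernel_eq_sum, map_sum]
  refine Submodule.sum_mem _ fun m _ => ?_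
  obtain ⟨c, hc⟩ := hL.map_inl (∏ i, X i ^ (m i : ℕ))
  rw [hL.map_inr_mul, hc, mul_comm, ← smul_eq_C_mul]
  refine Submodule.smul_mem _ _ ⟨∏ i, X (m i), ?_, ?_⟩
  · have h := IsHomogeneous.prod Finset.univ
      (fun i => (X (m i) : MvPolynomial (Fin (a * b + 1)) ℂ)) (fun _ => 1)
      fun i _ => isHomogeneous_X _ _
    simpa using h
  · rw [AlgHom.toLinearMap_apply, map_prod]
    refine Finset.prod_congr rfl fun i _ => ?_
    simp [FH, rootHom_coeffC]

lemma finrank_homogeneousSubmodule (n d : ℕ) :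
    Module.finrank ℂ (homogeneousSubmodule (Fin n) ℂ d) = (n + d - 1).choose d := by
  have h : {s : Fin n →₀ ℕ | s.degree = d} =
      ((Finset.finsuppAntidiag Finset.univ d : Finset (Fin n →₀ ℕ)) : Set (Fin n →₀ ℕ)) := by
    ext s
    simp [Finset.mem_finsuppAntidiag, Finsupp.degree_eq_sum]
  rw [homogeneousSubmodule_eq_finsupp_supported, h,
    (AddMonoidAlgebra.supportedEquivFinsupp _).finrank_eq, Module.finrank_finsupp_self,
    ← Nat.card_eq_fintype_card, Nat.card_coe_set_eq, Set.ncard_coe_finset,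
    Finset.card_finsuppAntidiag_nat_eq_choose, Finset.card_univ,
    Fintype.card_fin]

instance finite_homogeneousSubmodule (n d : ℕ) :
    Module.Finite ℂ (homogeneousSubmodule (Fin n) ℂ d) :=
  Module.Finite.iff_fg.2 (homogeneousSubmodule_fg _ _ _)

lemma eq_zero_of_FH_eq_zero {a b : ℕ} (ha : a ≠ 0) (hb : b ≠ 0)
    {p : MvPolynomial (Fin (a * b + 1)) ℂ} (hp : p.IsHomogeneous b) (h : FH a b p = 0) :
    p = 0 := by
  have : Module.Finite ℂ (sliceSpace a b b) :=
    inferInstanceAs (Module.Finite ℂ ((homogeneousSubmodule (Fin (a * b + 1)) ℂ b).map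
      ((rootHom b).comp (FH a b)).toLinearMap))
  have i₀ : Fin b := ⟨0, Nat.pos_of_ne_zero hb⟩
  have h1 := choose_le_finrank_of_slices ha i₀ (sliceSpace a b b)
    (fun L hL => slice_cauchyKernel_mem hL) (by
      rintro v ⟨q, hq, rfl⟩
      exact ⟨rootHom_mem_adjoin_psum _ _, natDegree_axisHom_rootHom i₀ (isHomogeneous_FH hq)⟩)
  have h2 : Module.finrank ℂ (homogeneousSubmodule (Fin (a * b + 1)) ℂ b) =
      (a * b + b).choose b := by
    rw [finrank_homogeneousSubmodule, show a * b + 1 + b - 1 = a * b + b by omega]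
  let T := (((rootHom b).comp (FH a b)).toLinearMap).submoduleMap
    (homogeneousSubmodule (Fin (a * b + 1)) ℂ b)
  have hT : Function.Injective T := (LinearMap.injective_iff_surjective_of_finrank_eq_finrank
    (le_antisymm (h2.trans_le h1) (Submodule.finrank_map_le _ _))).2
      (LinearMap.submoduleMap_surjective _ _)
  have h3 : T ⟨p, hp⟩ = 0 := Subtype.ext (by
    change rootHom b (FH a b p) = 0
    rw [h, map_zero])
  exact congrArg Subtype.val (hT (h3.trans (map_zero T).symm))

lemma exists_FH_eq_of_isHomogeneous {a b : ℕ} (ha : a ≠ 0) (hb : b ≠ 0)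
    {q : MvPolynomial (Fin (b + 1)) ℂ} (hq : q.IsHomogeneous (a * b)) :
    ∃ p : MvPolynomial (Fin (a * b + 1)) ℂ, p.IsHomogeneous b ∧ FH a b p = q := by
  let T : homogeneousSubmodule (Fin (a * b + 1)) ℂ b →ₗ[ℂ]
      homogeneousSubmodule (Fin (b + 1)) ℂ (a * b) :=
    (FH a b).toLinearMap.restrict fun p hp => isHomogeneous_FH hp
  have hT : Function.Injective T := by
    rw [← LinearMap.ker_eq_bot, LinearMap.ker_eq_bot']
    intro p hp
    exact Subtype.ext (eq_zero_of_FH_eq_zero ha hb p.2 (congrArg Subtype.val hp))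
  have h : Module.finrank ℂ (homogeneousSubmodule (Fin (a * b + 1)) ℂ b) =
      Module.finrank ℂ (homogeneousSubmodule (Fin (b + 1)) ℂ (a * b)) := by
    rw [finrank_homogeneousSubmodule, finrank_homogeneousSubmodule,
      show a * b + 1 + b - 1 = a * b + b by omega, show b + 1 + a * b - 1 = a * b + b by omega]
    exact Nat.choose_symm_add.symm
  obtain ⟨p, hp⟩ := (LinearMap.injective_iff_surjective_of_finrank_eq_finrank h).1 hT ⟨q, hq⟩
  exact ⟨p, p.2, congrArg Subtype.val hp⟩

end Roots

section Triangular

variable {σ k : Type*} [Field k]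

/-- A linear endomorphism that is unitriangular on monomials with respect to `φ`. -/
def IsUnitriangular (φ : (σ →₀ ℕ) → ℕ) (W : MvPolynomial σ k →ₗ[k] MvPolynomial σ k) : Prop :=
  ∀ s t, coeff t (W (monomial s 1) - monomial s 1) ≠ 0 → φ t < φ s

variable {φ : (σ →₀ ℕ) → ℕ} {W : MvPolynomial σ k →ₗ[k] MvPolynomial σ k}

lemma map_eq_sum_smul_monomial {M : Type*} [AddCommGroup M] [Module k M]
    (W : MvPolynomial σ k →ₗ[k] M) (p : MvPolynomial σ k) :
    W p = ∑ s ∈ p.support, coeff s p • W (monomial s 1) := by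
  conv_lhs => rw [p.as_sum]
  rw [map_sum]
  refine Finset.sum_congr rfl fun s _ => ?_
  rw [← map_smul, smul_monomial, smul_eq_mul, mul_one]

lemma IsUnitriangular.injective (h : IsUnitriangular φ W) : Function.Injective W := by
  classical
  rw [← LinearMap.ker_eq_bot, LinearMap.ker_eq_bot']
  intro p hp
  by_contra hne
  obtain ⟨s, hs, hmax⟩ := p.support.exists_max_image φ (support_nonempty.2 hne)
  have h1 : coeff s (W p) = coeff s p := by
    rw [map_eq_sum_smul_monomial, coeff_sum, Finset.sum_eq_single s]
    · have h2 : coeff s (W (monomial s 1) - monomial s 1) = 0 := by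
        by_contra h3
        exact (h s s h3).false
      rw [coeff_sub, coeff_monomial, if_pos rfl, sub_eq_zero] at h2
      rw [coeff_smul, h2, smul_eq_mul, mul_one]
    · intro u hu hus
      have h2 : coeff s (W (monomial u 1) - monomial u 1) = 0 := by
        by_contra h3
        exact (hmax u hu).not_gt (h u s h3)
      rw [coeff_sub, coeff_monomial, if_neg hus, sub_zero] at h2
      rw [coeff_smul, h2, smul_zero]
    · exact fun h2 => absurd hs h2
  rw [hp, coeff_zero] at h1
  exact mem_support_iff.1 hs h1.symm

lemma IsUnitriangular.exists_eq (h : IsUnitriangular φ W)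
    (hW : ∀ s, (W (monomial s 1)).IsHomogeneous s.degree) {n : ℕ} {p : MvPolynomial σ k}
    (hp : p.IsHomogeneous n) : ∃ q : MvPolynomial σ k, q.IsHomogeneous n ∧ W q = p := by
  suffices hs : ∀ m s, φ s = m → s.degree = n →
      monomial s (1 : k) ∈ (homogeneousSubmodule σ k n).map W by
    have h1 : p ∈ (homogeneousSubmodule σ k n).map W := by
      rw [p.as_sum]
      refine Submodule.sum_mem _ fun s hs' => ?_
      rw [← mul_one (coeff s p), ← smul_eq_mul, ← smul_monomial]
      exact Submodule.smul_mem _ _ (hs _ s rfl (hp.degree_eq_sum_deg_support hs').symm)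
    obtain ⟨q, hq, h2⟩ := h1
    exact ⟨q, hq, h2⟩
  intro m
  induction m using Nat.strong_induction_on with
  | _ m ih =>
    intro s hm hn
    have h1 : (monomial s (1 : k)).IsHomogeneous n := isHomogeneous_monomial _ hn
    have h2 : (W (monomial s 1) - monomial s 1) ∈ (homogeneousSubmodule σ k n).map W := by
      rw [as_sum (W (monomial s (1 : k)) - monomial s 1)]
      refine Submodule.sum_mem _ fun t ht => ?_
      rw [← mul_one (coeff t _), ← smul_eq_mul, ← smul_monomial]
      have h3 : (W (monomial s 1) - monomial s 1).IsHomogeneous n := (hn ▸ hW s).sub h1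
      exact Submodule.smul_mem _ _ (ih _ (hm ▸ h s t (mem_support_iff.1 ht)) t rfl
        (h3.degree_eq_sum_deg_support ht).symm)
    have h3 := Submodule.sub_mem _ (Submodule.mem_map_of_mem (f := W)
      ((mem_homogeneousSubmodule n _).2 h1)) h2
    rwa [sub_sub_cancel] at h3

lemma IsUnitriangular.surjective (h : IsUnitriangular φ W)
    (hW : ∀ s, (W (monomial s 1)).IsHomogeneous s.degree) : Function.Surjective W := by
  intro p
  rw [← sum_homogeneousComponent p]
  choose q _ hq using fun i => h.exists_eq hW (homogeneousComponent_isHomogeneous i p)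
  exact ⟨∑ i ∈ Finset.range (p.totalDegree + 1), q i, by rw [map_sum]; simp only [hq]⟩

end Triangular

section Leading

variable {σ k : Type*} [Field k]

/-- The polynomial `p` has leading monomial `s` with respect to the weight `φ`. -/
def HasLeading (φ : (σ →₀ ℕ) →+ ℕ) (s : σ →₀ ℕ) (p : MvPolynomial σ k) : Prop :=
  ∀ t, coeff t (p - monomial s 1) ≠ 0 → φ t < φ s

variable {φ : (σ →₀ ℕ) →+ ℕ}

lemma HasLeading.monomial (s : σ →₀ ℕ) : HasLeading φ s (monomial s (1 : k)) :=
  fun t ht => absurd (by rw [sub_self, coeff_zero]) ht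

lemma lt_of_coeff_mul_ne_zero {p q : MvPolynomial σ k} {m n : ℕ}
    (hp : ∀ t, coeff t p ≠ 0 → φ t < m) (hq : ∀ t, coeff t q ≠ 0 → φ t ≤ n) {t : σ →₀ ℕ}
    (ht : coeff t (p * q) ≠ 0) : φ t < m + n := by
  classical
  obtain ⟨t1, h1, t2, h2, rfl⟩ := Finset.mem_add.1 (support_mul p q (mem_support_iff.2 ht))
  rw [map_add]
  exact add_lt_add_of_lt_of_le (hp _ (mem_support_iff.1 h1)) (hq _ (mem_support_iff.1 h2))

lemma le_of_coeff_monomial_ne_zero {s t : σ →₀ ℕ}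
    (ht : coeff t (MvPolynomial.monomial s (1 : k)) ≠ 0) : φ t ≤ φ s := by
  classical
  rw [coeff_monomial] at ht
  split_ifs at ht with h
  · rw [h]
  · exact absurd rfl ht

lemma HasLeading.mul {s t : σ →₀ ℕ} {p q : MvPolynomial σ k} (hp : HasLeading φ s p)
    (hq : HasLeading φ t q) : HasLeading φ (s + t) (p * q) := by
  intro u hu
  have h : p * q - MvPolynomial.monomial (s + t) 1 =
      (p - MvPolynomial.monomial s 1) * (q - MvPolynomial.monomial t 1) +
        (p - MvPolynomial.monomial s 1) * MvPolynomial.monomial t 1 +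
        (q - MvPolynomial.monomial t 1) * MvPolynomial.monomial s 1 := by
    have h1 : (MvPolynomial.monomial (s + t) (1 : k)) =
      MvPolynomial.monomial s 1 * MvPolynomial.monomial t 1 := by rw [monomial_mul, one_mul]
    rw [h1]
    ring
  rw [map_add]
  by_contra hlt
  refine hu ?_
  rw [h, coeff_add, coeff_add]
  have h1 : coeff u ((p - MvPolynomial.monomial s 1) * (q - MvPolynomial.monomial t 1)) = 0 := by
    by_contra h2
    exact hlt (lt_of_coeff_mul_ne_zero hp (fun v hv => (hq v hv).le) h2)
  have h2 : coeff u ((p - MvPolynomial.monomial s 1) * MvPolynomial.monomial t 1) = 0 := by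
    by_contra h2
    exact hlt (lt_of_coeff_mul_ne_zero hp (fun v hv => le_of_coeff_monomial_ne_zero hv) h2)
  have h3 : coeff u ((q - MvPolynomial.monomial t 1) * MvPolynomial.monomial s 1) = 0 := by
    by_contra h2
    exact hlt ((lt_of_coeff_mul_ne_zero hq
      (fun v hv => le_of_coeff_monomial_ne_zero hv) h2).trans_eq (add_comm _ _))
  rw [h1, h2, h3, add_zero, add_zero]

lemma HasLeading.pow {s : σ →₀ ℕ} {p : MvPolynomial σ k} (hp : HasLeading φ s p) (n : ℕ) :
    HasLeading φ (n • s) (p ^ n) := by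
  induction n with
  | zero => rw [zero_smul, pow_zero]; exact HasLeading.monomial 0
  | succ n ih => rw [succ_nsmul, pow_succ]; exact ih.mul hp

lemma HasLeading.prod {τ : Type*} (S : Finset τ) {s : τ → σ →₀ ℕ} {p : τ → MvPolynomial σ k}
    (hp : ∀ i ∈ S, HasLeading φ (s i) (p i)) : HasLeading φ (∑ i ∈ S, s i) (∏ i ∈ S, p i) := by
  classical
  induction S using Finset.induction_on with
  | empty => exact HasLeading.monomial 0
  | insert i S hi ih =>
    rw [Finset.sum_insert hi, Finset.prod_insert hi]
    exact (hp i (Finset.mem_insert_self _ _)).mul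
      (ih fun j hj => hp j (Finset.mem_insert_of_mem hj))

end Leading

section LeadingCoefficient

/-- The weight `b ^ 2 - i ^ 2` used to compare monomials. -/
noncomputable def squareWeight (b : ℕ) : (Fin (b + 1) →₀ ℕ) →+ ℕ :=
  Finsupp.weight fun i : Fin (b + 1) => b ^ 2 - (i : ℕ) ^ 2

lemma squareWeight_cast (b : ℕ) (t : Fin (b + 1) →₀ ℕ) :
    (squareWeight b t : ℤ) = ∑ j, (t j : ℤ) * ((b : ℤ) ^ 2 - (j : ℤ) ^ 2) := by
  rw [squareWeight, Finsupp.weight_apply, Finsupp.sum_fintype _ _ (by simp), Nat.cast_sum]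
  refine Finset.sum_congr rfl fun j _ => ?_
  have h : (j : ℕ) ^ 2 ≤ b ^ 2 := Nat.pow_le_pow_left (Nat.lt_succ_iff.1 j.2) 2
  rw [smul_eq_mul, Nat.cast_mul, Nat.cast_sub h]
  push_cast
  rfl

lemma squareWeight_lt {b a : ℕ} {i : Fin (b + 1)} {t : Fin (b + 1) →₀ ℕ}
    (hne : t ≠ Finsupp.single i a) (hd : ∑ j, t j = a) (hw : ∑ j, t j * (j : ℕ) = a * i) :
    squareWeight b t < squareWeight b (Finsupp.single i a) := by
  have h1 : (squareWeight b (Finsupp.single i a) : ℤ) = a * ((b : ℤ) ^ 2 - (i : ℤ) ^ 2) := by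
    rw [squareWeight_cast, Finset.sum_eq_single i (fun j _ hj => by
      rw [Finsupp.single_eq_of_ne hj, Nat.cast_zero, zero_mul])
      (fun h => absurd (Finset.mem_univ i) h), Finsupp.single_eq_same]
  have hd' : ∑ j, (t j : ℤ) = a := by exact_mod_cast hd
  have hw' : ∑ j, (t j : ℤ) * (j : ℤ) = a * i := by exact_mod_cast hw
  have h2 : (squareWeight b (Finsupp.single i a) : ℤ) - squareWeight b t =
      ∑ j, (t j : ℤ) * ((j : ℤ) - i) ^ 2 := by
    have h3 : ∑ j, (t j : ℤ) * ((j : ℤ) - i) ^ 2 =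
        ((b : ℤ) ^ 2 + (i : ℤ) ^ 2) * ∑ j, (t j : ℤ) - 2 * i * ∑ j, (t j : ℤ) * (j : ℤ) -
          ∑ j, (t j : ℤ) * ((b : ℤ) ^ 2 - (j : ℤ) ^ 2) := by
      rw [Finset.mul_sum, Finset.mul_sum, ← Finset.sum_sub_distrib, ← Finset.sum_sub_distrib]
      exact Finset.sum_congr rfl fun j _ => by ring
    rw [h3, h1, squareWeight_cast, hd', hw']
    ring
  have h4 : ∃ j, j ≠ i ∧ t j ≠ 0 := by
    by_contra! h
    refine hne (Finsupp.ext fun j => ?_)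
    by_cases hj : j = i
    · rw [hj, Finsupp.single_eq_same, ← hd, Finset.sum_eq_single i (fun j _ hj => h j hj)
        (fun h => absurd (Finset.mem_univ i) h)]
    · rw [h j hj, Finsupp.single_eq_of_ne hj]
  obtain ⟨j, hj, hj'⟩ := h4
  have h5 : 0 < ∑ j, (t j : ℤ) * ((j : ℤ) - i) ^ 2 := by
    refine Finset.sum_pos' (fun l _ => by positivity) ⟨j, Finset.mem_univ j, ?_⟩
    have h6 : ((j : ℕ) : ℤ) - (i : ℕ) ≠ 0 := by
      rw [sub_ne_zero]
      exact fun e => hj (Fin.ext (by exact_mod_cast e))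
    positivity
  omega

lemma coeff_axisHom {ι k : Type*} [CommRing k] [DecidableEq ι] (i : ι) (m : ℕ)
    (p : MvPolynomial ι k) : (axisHom i p).coeff m = coeff (Finsupp.single i m) p := by
  induction p using MvPolynomial.induction_on generalizing m with
  | C c =>
    simp only [axisHom, aeval_C, Polynomial.algebraMap_eq, Polynomial.coeff_C, coeff_C,
      eq_comm (a := (0 : ι →₀ ℕ)), Finsupp.single_eq_zero]
  | add p q hp hq => rw [map_add, Polynomial.coeff_add, coeff_add, hp, hq]
  | mul_X p j hp =>
    rw [map_mul, coeff_mul_X']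
    by_cases hj : j = i
    · subst hj
      have h : axisHom (k := k) j (X j) = Polynomial.X := by simp [axisHom]
      rw [h]
      cases m with
      | zero => simp
      | succ m =>
        rw [Polynomial.coeff_mul_X, hp, if_pos (by simp), ← Finsupp.single_tsub,
          Nat.add_sub_cancel]
    · have h : axisHom (k := k) i (X j) = 0 := by simp [axisHom, hj]
      rw [h, mul_zero, Polynomial.coeff_zero, if_neg]
      rw [Finsupp.mem_support_iff, not_not, Finsupp.single_eq_of_ne hj]

lemma map_axisHom_genPoly (b : ℕ) (i : Fin (b + 1)) :
    (genPoly b).map (axisHom (k := ℂ) i).toRingHom =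
      Polynomial.C (Polynomial.X : Polynomial ℂ) * Polynomial.X ^ (i : ℕ) := by
  rw [genPoly, Polynomial.map_sum, Finset.sum_eq_single i]
  · simp [axisHom]
  · intro j _ hj
    simp [axisHom, hj]
  · exact fun h => absurd (Finset.mem_univ i) h

lemma coeff_single_coeffC (a b : ℕ) (i : Fin (b + 1)) :
    coeff (Finsupp.single i a) (coeffC a b (a * i)) = 1 := by
  have h : axisHom (k := ℂ) i (coeffC a b (a * i)) = Polynomial.X ^ a := by
    have h1 : axisHom (k := ℂ) i (coeffC a b (a * i)) =
        ((genPoly b ^ a).map (axisHom (k := ℂ) i).toRingHom).coeff (a * i) := by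
      rw [Polynomial.coeff_map, coeffC_eq]
      rfl
    rw [h1, Polynomial.map_pow, map_axisHom_genPoly, mul_pow, ← Polynomial.C_pow, ← pow_mul,
      mul_comm (i : ℕ) a, Polynomial.coeff_C_mul_X_pow, if_pos rfl]
  rw [← coeff_axisHom, h, Polynomial.coeff_X_pow_self]

lemma hasLeading_coeffC (a b : ℕ) (i : Fin (b + 1)) :
    HasLeading (squareWeight b) (Finsupp.single i a) (coeffC a b (a * i)) := by
  intro t ht
  have hne : t ≠ Finsupp.single i a := by
    rintro rfl
    rw [coeff_sub, coeff_single_coeffC, coeff_monomial, if_pos rfl, sub_self] at ht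
    exact ht rfl
  rw [coeff_sub, coeff_monomial, if_neg (Ne.symm hne), sub_zero] at ht
  refine squareWeight_lt hne ?_ ?_
  · rw [← Finsupp.degree_eq_sum]
    exact ((isHomogeneous_coeffC a b (a * i)).degree_eq_sum_deg_support
      (mem_support_iff.2 ht)).symm
  · have h := isWeightedHomogeneous_coeffC a b (a * i) ht
    rwa [Finsupp.weight_apply, Finsupp.sum_fintype _ _ (by simp)] at h

end LeadingCoefficient

section PowerSubstitution

variable {ι k : Type*} [Fintype ι] [DecidableEq ι] [Field k]

/-- The linear map replacing every `a`-th power `X i ^ a` in a monomial by `c i`. -/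
noncomputable def powSubst (a : ℕ) (c : ι → MvPolynomial ι k) :
    MvPolynomial ι k →ₗ[k] MvPolynomial ι k :=
  (basisMonomials ι k).constr k fun s => ∏ i, (c i ^ (s i / a) * X i ^ (s i % a))

variable {a : ℕ} {c : ι → MvPolynomial ι k}

lemma powSubst_monomial (s : ι →₀ ℕ) :
    powSubst a c (monomial s 1) = ∏ i, (c i ^ (s i / a) * X i ^ (s i % a)) := by
  have h := (basisMonomials ι k).constr_basis k
    (fun s : ι →₀ ℕ => ∏ i, (c i ^ (s i / a) * X i ^ (s i % a))) s
  rwa [coe_basisMonomials] at h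

lemma powSubst_X_pow_mul (ha : a ≠ 0) (i : ι) (x : MvPolynomial ι k) :
    powSubst a c (X i ^ a * x) = c i * powSubst a c x := by
  suffices h : powSubst a c ∘ₗ LinearMap.mulLeft k (X i ^ a) =
      LinearMap.mulLeft k (c i) ∘ₗ powSubst a c from LinearMap.congr_fun h x
  refine linearMap_ext_monomial fun s => ?_
  rw [LinearMap.comp_apply, LinearMap.comp_apply, LinearMap.mulLeft_apply,
    LinearMap.mulLeft_apply, X_pow_eq_monomial, monomial_mul, one_mul, powSubst_monomial,
    powSubst_monomial, ← Finset.mul_prod_erase _ _ (Finset.mem_univ i),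
    ← Finset.mul_prod_erase Finset.univ (fun j => c j ^ (s j / a) * X j ^ (s j % a))
      (Finset.mem_univ i), ← mul_assoc, ← mul_assoc, ← pow_succ']
  congr 1
  · rw [Finsupp.add_apply, Finsupp.single_eq_same, Nat.add_mod_left,
      Nat.add_div_left _ (Nat.pos_of_ne_zero ha)]
  · refine Finset.prod_congr rfl fun j hj => ?_
    rw [Finsupp.add_apply, Finsupp.single_eq_of_ne (Finset.ne_of_mem_erase hj), zero_add]

lemma powSubst_isHomogeneous (hc : ∀ i, (c i).IsHomogeneous a) (s : ι →₀ ℕ) :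
    (powSubst a c (monomial s 1)).IsHomogeneous s.degree := by
  rw [powSubst_monomial, Finsupp.degree_eq_sum]
  refine IsHomogeneous.prod _ _ _ fun i _ => ?_
  have h := ((hc i).pow (s i / a)).mul (isHomogeneous_X_pow (R := k) i (s i % a))
  rwa [Nat.div_add_mod] at h

lemma powSubst_isUnitriangular {φ : (ι →₀ ℕ) →+ ℕ}
    (hc : ∀ i, HasLeading φ (Finsupp.single i a) (c i)) :
    IsUnitriangular φ (powSubst a c) := by
  intro s
  have h : HasLeading φ (∑ i, ((s i / a) • Finsupp.single i a + Finsupp.single i (s i % a)))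
      (∏ i, (c i ^ (s i / a) * X i ^ (s i % a))) := by
    refine HasLeading.prod _ fun i _ => ((hc i).pow _).mul ?_
    rw [X_pow_eq_monomial]
    exact HasLeading.monomial _
  have hs : ∑ i, ((s i / a) • Finsupp.single i a + Finsupp.single i (s i % a)) = s := by
    have h1 : ∀ i, (s i / a) • Finsupp.single i a + Finsupp.single i (s i % a) =
        Finsupp.single i (s i) := by
      intro i
      rw [Finsupp.smul_single, ← Finsupp.single_add, smul_eq_mul, Nat.div_add_mod']
    rw [Finset.sum_congr rfl fun i _ => h1 i, Finsupp.univ_sum_single]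
  rw [hs] at h
  rw [powSubst_monomial]
  exact h

variable {φ : (ι →₀ ℕ) →+ ℕ}

lemma powSubst_mem_span_iff (ha : a ≠ 0)
    (hl : ∀ i, HasLeading φ (Finsupp.single i a) (c i)) (hc : ∀ i, (c i).IsHomogeneous a)
    (S : Set ι) (x : MvPolynomial ι k) :
    powSubst a c x ∈ Ideal.span (c '' S) ↔ x ∈ Ideal.span ((fun i => X i ^ a) '' S) := by
  have hinj := (powSubst_isUnitriangular hl).injective
  have hsurj := (powSubst_isUnitriangular hl).surjective (powSubst_isHomogeneous hc)
  constructor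
  · intro h
    have key : ∀ p ∈ Ideal.span (c '' S), ∀ r, ∃ y ∈ Ideal.span ((fun i => X i ^ a) '' S),
        powSubst a c y = r * p := by
      intro p hp
      induction hp using Submodule.span_induction with
      | mem p hp =>
        obtain ⟨i, hi, rfl⟩ := hp
        intro r
        obtain ⟨y, rfl⟩ := hsurj r
        exact ⟨X i ^ a * y, Ideal.mul_mem_right _ _ (Ideal.subset_span ⟨i, hi, rfl⟩),
          by rw [powSubst_X_pow_mul ha, mul_comm]⟩
      | zero => exact fun r => ⟨0, zero_mem _, by rw [map_zero, mul_zero]⟩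
      | add p q _ _ hp hq =>
        intro r
        obtain ⟨y, hy, h1⟩ := hp r
        obtain ⟨z, hz, h2⟩ := hq r
        exact ⟨y + z, add_mem hy hz, by rw [map_add, h1, h2, mul_add]⟩
      | smul t p _ hp =>
        intro r
        obtain ⟨y, hy, h1⟩ := hp (r * t)
        exact ⟨y, hy, by rw [h1, smul_eq_mul, mul_assoc]⟩
    obtain ⟨y, hy, h1⟩ := key _ h 1
    rw [one_mul] at h1
    rwa [← hinj h1]
  · intro h
    have key : ∀ p ∈ Ideal.span ((fun i => (X i : MvPolynomial ι k) ^ a) '' S), ∀ r,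
        powSubst a c (r * p) ∈ Ideal.span (c '' S) := by
      intro p hp
      induction hp using Submodule.span_induction with
      | mem p hp =>
        obtain ⟨i, hi, rfl⟩ := hp
        intro r
        rw [mul_comm, powSubst_X_pow_mul ha]
        exact Ideal.mul_mem_right _ _ (Ideal.subset_span ⟨i, hi, rfl⟩)
      | zero => exact fun r => by rw [mul_zero, map_zero]; exact zero_mem _
      | add p q _ _ hp hq => exact fun r => by rw [mul_add, map_add]; exact add_mem (hp r) (hq r)
      | smul t p _ hp => exact fun r => by rw [smul_eq_mul, ← mul_assoc]; exact hp _
    have h1 := key _ h 1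
    rwa [one_mul] at h1

lemma mem_span_of_mul_mem_of_hasLeading (ha : a ≠ 0)
    (hl : ∀ i, HasLeading φ (Finsupp.single i a) (c i)) (hc : ∀ i, (c i).IsHomogeneous a)
    {S : Set ι} {i : ι} (hi : i ∉ S) {x : MvPolynomial ι k}
    (hx : c i * x ∈ Ideal.span (c '' S)) : x ∈ Ideal.span (c '' S) := by
  obtain ⟨y, rfl⟩ := (powSubst_isUnitriangular hl).surjective (powSubst_isHomogeneous hc) x
  rw [← powSubst_X_pow_mul ha, powSubst_mem_span_iff ha hl hc] at hx
  rw [powSubst_mem_span_iff ha hl hc]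
  have he : (fun i => (X i : MvPolynomial ι k) ^ a) '' S =
      (fun s => monomial s (1 : k)) '' ((fun i => Finsupp.single i a) '' S) := by
    rw [Set.image_image]
    exact Set.image_congr fun i _ => X_pow_eq_monomial
  rw [he, mem_ideal_span_monomial_image] at hx ⊢
  intro s hs
  obtain ⟨_, ⟨j, hj, rfl⟩, hle⟩ := hx (Finsupp.single i a + s) (by
    rw [mem_support_iff, X_pow_eq_monomial, coeff_monomial_mul, one_mul]
    exact mem_support_iff.1 hs)
  refine ⟨_, ⟨j, hj, rfl⟩, ?_⟩
  have hij : j ≠ i := fun e => hi (e ▸ hj)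
  rw [Finsupp.single_le_iff, Finsupp.add_apply, Finsupp.single_eq_of_ne hij, zero_add] at hle
  rwa [Finsupp.single_le_iff]

lemma exists_sum_mul_of_hasLeading [Nonempty ι] (ha : a ≠ 0)
    (hl : ∀ i, HasLeading φ (Finsupp.single i a) (c i)) (hc : ∀ i, (c i).IsHomogeneous a)
    {m : ℕ} (hm : (a - 1) * Fintype.card ι < m)
    {p : MvPolynomial ι k} (hp : p.IsHomogeneous m) :
    ∃ y : ι → MvPolynomial ι k, (∀ i, (y i).IsHomogeneous (m - a)) ∧ p = ∑ i, c i * y i := by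
  obtain ⟨q, hq, rfl⟩ := (powSubst_isUnitriangular hl).exists_eq (powSubst_isHomogeneous hc) hp
  have h : ∀ s ∈ q.support, ∃ i, a ≤ s i := by
    intro s hs
    by_contra! h
    have h1 : ∑ i, s i ≤ ∑ _i : ι, (a - 1) :=
      Finset.sum_le_sum fun i _ => Nat.le_sub_one_of_lt (h i)
    have h2 : m = s.degree := hq.degree_eq_sum_deg_support hs
    rw [← Finsupp.degree_eq_sum, ← h2, Finset.sum_const,
      Finset.card_univ, smul_eq_mul, mul_comm] at h1
    exact h1.not_gt hm
  choose! f hf using h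
  refine ⟨fun i => ∑ s ∈ q.support, if f s = i then
    coeff s q • powSubst a c (monomial (s - Finsupp.single i a) 1) else 0, fun i => ?_, ?_⟩
  · refine IsHomogeneous.sum _ _ _ fun s hs => ?_
    split_ifs with hi
    · subst hi
      have h1 : (s - Finsupp.single (f s) a).degree = m - a := by
        have h2 : s - Finsupp.single (f s) a + Finsupp.single (f s) a = s :=
          tsub_add_cancel_of_le (Finsupp.single_le_iff.2 (hf s hs))
        have h3 := congrArg Finsupp.degree h2
        have h4 : m = s.degree := hq.degree_eq_sum_deg_support hs
        rw [map_add, Finsupp.degree_single, ← h4] at h3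
        omega
      exact Submodule.smul_mem (homogeneousSubmodule ι k (m - a)) _
        (h1 ▸ powSubst_isHomogeneous hc (s - Finsupp.single (f s) a))
    · exact isHomogeneous_zero _ _ _
  · simp only [Finset.mul_sum]
    rw [Finset.sum_comm, map_eq_sum_smul_monomial]
    refine Finset.sum_congr rfl fun s hs => ?_
    rw [Finset.sum_eq_single (f s)]
    · have h2 : Finsupp.single (f s) a + (s - Finsupp.single (f s) a) = s :=
        add_tsub_cancel_of_le (Finsupp.single_le_iff.2 (hf s hs))
      rw [if_pos rfl, mul_smul_comm, ← powSubst_X_pow_mul ha, X_pow_eq_monomial, monomial_mul,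
        one_mul, h2]
    · exact fun i _ hi => by rw [if_neg hi.symm, mul_zero]
    · exact fun h => absurd (Finset.mem_univ _) h

end PowerSubstitution

section KernelGeneration

lemma exists_koszul_fin {A : Type*} [CommRing A] {n : ℕ} (f : Fin n → A)
    (hf : ∀ k x, f k * x ∈ Ideal.span (f '' Set.Iio k) → x ∈ Ideal.span (f '' Set.Iio k))
    (p : Fin n → A) (hp : ∑ i, f i * p i = 0) :
    ∃ T : Fin n → Fin n → A, ∀ i, p i = ∑ j, f j * (T i j - T j i) := by
  let g : ℕ → A := fun i => if h : i < n then f ⟨i, h⟩ else 0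
  let q : ℕ → A := fun i => if h : i < n then p ⟨i, h⟩ else 0
  have hg : ∀ i : Fin n, g i = f i := fun i => dif_pos i.2
  have hq : ∀ i : Fin n, q i = p i := fun i => dif_pos i.2
  have himg : ∀ k : Fin n, g '' Set.Iio (k : ℕ) = f '' Set.Iio k := by
    intro k
    ext y
    constructor
    · rintro ⟨i, hi, rfl⟩
      exact ⟨⟨i, lt_trans hi k.2⟩, hi, (hg ⟨i, lt_trans hi k.2⟩).symm⟩
    · rintro ⟨i, hi, rfl⟩
      exact ⟨i, hi, hg i⟩
  obtain ⟨T, hT⟩ := exists_koszul_of_sum_eq_zero g n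
    (fun k hk x => by
      have h := hf ⟨k, hk⟩ x
      rwa [← himg, ← hg] at h) q
    (by
      rw [Finset.sum_range, ← hp]
      exact Finset.sum_congr rfl fun i _ => by rw [hg, hq])
  refine ⟨fun i j => T i j, fun i => ?_⟩
  rw [← hq, hT i i.2, Finset.sum_range]
  exact Finset.sum_congr rfl fun j _ => by rw [hg]

lemma homogeneousComponent_add_mul {σ k : Type*} [CommRing k] {m n : ℕ} {f : MvPolynomial σ k}
    (hf : f.IsHomogeneous m) (p : MvPolynomial σ k) :
    homogeneousComponent (m + n) (f * p) = f * homogeneousComponent n p := by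
  have h : ∀ l, homogeneousComponent (m + n) (f * homogeneousComponent l p) =
      if n = l then f * homogeneousComponent l p else 0 := by
    intro l
    rw [homogeneousComponent_of_mem (hf.mul (homogeneousComponent_isHomogeneous l p))]
    simp only [add_right_inj]
  conv_lhs => rw [← sum_homogeneousComponent p, Finset.mul_sum, map_sum]
  rw [Finset.sum_congr rfl fun l _ => h l, Finset.sum_ite_eq]
  split_ifs with hn
  · rfl
  · rw [homogeneousComponent_eq_zero _ _ (by
      rw [Finset.mem_range] at hn
      omega), mul_zero]

lemma sum_mul_sum_mul_sub {A ι : Type*} [CommRing A] [Fintype ι] (z : ι → A) (t : ι → ι → A) :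
    ∑ i, z i * ∑ j, z j * (t i j - t j i) = 0 := by
  simp only [mul_sub, Finset.sum_sub_distrib, Finset.mul_sum]
  rw [sub_eq_zero, Finset.sum_comm]
  exact Finset.sum_congr rfl fun i _ => Finset.sum_congr rfl fun j _ => by ring

variable {σ τ k : Type*} [Field k] {n a d : ℕ} {F : MvPolynomial σ k →ₐ[k] MvPolynomial τ k}
  {z : Fin n → MvPolynomial σ k}

lemma exists_sub_sum_mem {J : Ideal (MvPolynomial σ k)}
    (h0 : ∀ P : MvPolynomial σ k, P.IsHomogeneous (d + 1) →
      ∃ Q : Fin n → MvPolynomial σ k, (∀ i, (Q i).IsHomogeneous d) ∧ P - ∑ i, z i * Q i ∈ J)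
    (r : ℕ) (hr : d ≤ r) : ∀ P : MvPolynomial σ k, P.IsHomogeneous (r + 1) →
      ∃ Q : Fin n → MvPolynomial σ k, (∀ i, (Q i).IsHomogeneous r) ∧ P - ∑ i, z i * Q i ∈ J := by
  induction r, hr using Nat.le_induction with
  | base => exact h0
  | succ r hr ih =>
    intro P hP
    rw [P.as_sum]
    refine Finset.sum_induction _ (fun P => ∃ Q : Fin n → MvPolynomial σ k,
      (∀ i, (Q i).IsHomogeneous (r + 1)) ∧ P - ∑ i, z i * Q i ∈ J) ?_ ?_ ?_
    · rintro P P' ⟨Q, hQ, h1⟩ ⟨Q', hQ', h2⟩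
      refine ⟨Q + Q', fun i => (hQ i).add (hQ' i), ?_⟩
      have h3 : P + P' - ∑ i, z i * (Q + Q') i =
          (P - ∑ i, z i * Q i) + (P' - ∑ i, z i * Q' i) := by
        simp only [Pi.add_apply, mul_add, Finset.sum_add_distrib]
        ring
      rw [h3]
      exact add_mem h1 h2
    · exact ⟨0, fun i => isHomogeneous_zero _ _ _, by simp⟩
    · intro s hs
      have hs' : r + 1 + 1 = s.degree := hP.degree_eq_sum_deg_support hs
      obtain ⟨j, hj⟩ : ∃ j, s j ≠ 0 := by
        by_contra! h
        have h1 : s = 0 := Finsupp.ext h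
        rw [h1, map_zero] at hs'
        omega
      have h2 : s - Finsupp.single j 1 + Finsupp.single j 1 = s :=
        tsub_add_cancel_of_le (Finsupp.single_le_iff.2 (Nat.one_le_iff_ne_zero.2 hj))
      have h3 := congrArg Finsupp.degree h2
      rw [map_add, Finsupp.degree_single, ← hs'] at h3
      obtain ⟨Q, hQ, h4⟩ := ih (monomial (s - Finsupp.single j 1) (coeff s P))
        (isHomogeneous_monomial _ (by omega))
      refine ⟨fun i => Q i * X j, fun i => (hQ i).mul (isHomogeneous_X _ _), ?_⟩
      have h5 : monomial s (coeff s P) - ∑ i, z i * (Q i * X j) =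
          X j * (monomial (s - Finsupp.single j 1) (coeff s P) - ∑ i, z i * Q i) := by
        rw [mul_sub, mul_comm (X j) (monomial _ _), X, monomial_mul, mul_one, h2, Finset.mul_sum]
        congr 1
        exact Finset.sum_congr rfl fun i _ => by ring
      rw [h5]
      exact Ideal.mul_mem_left _ _ h4

theorem ker_eq_span_of_koszul (ha : a ≠ 0)
    (hF : ∀ n p, p.IsHomogeneous n → (F p).IsHomogeneous (a * n))
    (hz : ∀ i, (z i).IsHomogeneous 1)
    (hinj : ∀ r ≤ d, ∀ p, p.IsHomogeneous r → F p = 0 → p = 0)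
    (hsurj : ∀ r, d ≤ r → ∀ q, q.IsHomogeneous (a * r) → ∃ p, p.IsHomogeneous r ∧ F p = q)
    (hkos : ∀ p : Fin n → MvPolynomial τ k, ∑ i, F (z i) * p i = 0 →
      ∃ T : Fin n → Fin n → MvPolynomial τ k,
        ∀ i, p i = ∑ j, F (z j) * (T i j - T j i))
    (hgen : ∀ q, q.IsHomogeneous (a * (d + 1)) → ∃ y : Fin n → MvPolynomial τ k,
      (∀ i, (y i).IsHomogeneous (a * d)) ∧ q = ∑ i, F (z i) * y i) :
    RingHom.ker F.toRingHom = Ideal.span {P | P.IsHomogeneous (d + 1) ∧ F P = 0} := by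
  set J : Ideal (MvPolynomial σ k) := Ideal.span {P | P.IsHomogeneous (d + 1) ∧ F P = 0} with hJ
  have hJker : ∀ P ∈ J, F P = 0 := by
    have h : J ≤ RingHom.ker F.toRingHom := Ideal.span_le.2 fun P hP => hP.2
    exact fun P hP => h hP
  have h0 : ∀ P : MvPolynomial σ k, P.IsHomogeneous (d + 1) →
      ∃ Q : Fin n → MvPolynomial σ k, (∀ i, (Q i).IsHomogeneous d) ∧
        P - ∑ i, z i * Q i ∈ J := by
    intro P hP
    obtain ⟨y, hy, hPy⟩ := hgen _ (hF _ P hP)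
    choose Q hQ hQy using fun i => hsurj d le_rfl (y i) (hy i)
    refine ⟨Q, hQ, Ideal.subset_span ⟨hP.sub (IsHomogeneous.sum _ _ _ fun i _ => ?_), ?_⟩⟩
    · have h1 := (hz i).mul (hQ i)
      rwa [add_comm] at h1
    · rw [map_sub, map_sum, hPy, sub_eq_zero]
      exact Finset.sum_congr rfl fun i _ => by rw [map_mul, hQy]
  have hstep := exists_sub_sum_mem h0
  have hker : ∀ r P, P.IsHomogeneous r → F P = 0 → P ∈ J := by
    intro r
    induction r with
    | zero =>
      intro P hP h
      rw [hinj 0 (Nat.zero_le _) P hP h]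
      exact zero_mem _
    | succ r ih =>
      intro P hP h
      rcases lt_trichotomy r d with hr | rfl | hr
      · rw [hinj (r + 1) hr P hP h]
        exact zero_mem _
      · exact Ideal.subset_span ⟨hP, h⟩
      · obtain ⟨Q, hQ, hPQ⟩ := hstep r hr.le P hP
        obtain ⟨r, rfl⟩ : ∃ r', r = r' + 1 := ⟨r - 1, by omega⟩
        have h1 : ∑ i, F (z i) * F (Q i) = 0 := by
          have h2 := hJker _ hPQ
          rw [map_sub, h, zero_sub, neg_eq_zero, map_sum] at h2
          rw [← h2]
          exact Finset.sum_congr rfl fun i _ => (map_mul F _ _).symm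
        obtain ⟨T, hT⟩ := hkos _ h1
        choose t ht htT using fun i j => hsurj r (by omega) _
          (homogeneousComponent_isHomogeneous (a * r) (T i j))
        have h2 : ∀ i, Q i - ∑ j, z j * (t i j - t j i) ∈ J := by
          intro i
          refine ih _ ((hQ i).sub (IsHomogeneous.sum _ _ _ fun j _ => ?_)) ?_
          · have h3 := (hz j).mul ((ht i j).sub (ht j i))
            rwa [add_comm] at h3
          · have h3 : F (Q i) = homogeneousComponent (a + a * r) (F (Q i)) := by
              have h4 := hF _ _ (hQ i)
              rw [mul_add, mul_one, add_comm] at h4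
              rw [homogeneousComponent_eq_self h4]
            rw [map_sub, h3, hT, map_sum, map_sum, sub_eq_zero]
            refine Finset.sum_congr rfl fun j _ => ?_
            have h4 := hF _ _ (hz j)
            rw [mul_one] at h4
            rw [homogeneousComponent_add_mul h4, map_mul, map_sub, map_sub, htT, htT]
        have h3 : P = (P - ∑ i, z i * Q i) +
            ∑ i, z i * (Q i - ∑ j, z j * (t i j - t j i)) := by
          have h4 : ∑ i, z i * (Q i - ∑ j, z j * (t i j - t j i)) =
              ∑ i, z i * Q i - ∑ i, z i * ∑ j, z j * (t i j - t j i) := by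
            rw [← Finset.sum_sub_distrib]
            exact Finset.sum_congr rfl fun i _ => mul_sub _ _ _
          rw [h4, sum_mul_sum_mul_sub, sub_zero, sub_add_cancel]
        rw [h3]
        exact add_mem hPQ (sum_mem fun i _ => Ideal.mul_mem_left _ _ (h2 i))
  refine le_antisymm (fun P hP => ?_) fun P hP => hJker P hP
  have hP' : F P = 0 := hP
  rw [← sum_homogeneousComponent P]
  refine sum_mem fun m hm => hker m _ (homogeneousComponent_isHomogeneous m P) ?_
  have h1 : F (homogeneousComponent m P) = homogeneousComponent (a * m) (F P) := by
    conv_rhs => rw [← sum_homogeneousComponent P, map_sum, map_sum]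
    have h2 : ∀ l, homogeneousComponent (a * m) (F (homogeneousComponent l P)) =
        if m = l then F (homogeneousComponent l P) else 0 := by
      intro l
      rw [homogeneousComponent_of_mem (hF l _ (homogeneousComponent_isHomogeneous l P))]
      simp only [mul_right_inj' ha]
    rw [Finset.sum_congr rfl fun l _ => h2 l, Finset.sum_ite_eq]
    rw [if_pos hm]
  rw [h1, hP', map_zero]

end KernelGeneration

section FoulkesHowe

variable {a b : ℕ}

/-- The variable `z_{ai}`, which maps to a form with leading monomial `u_i ^ a`. -/
noncomputable def stepVar (a b : ℕ) (i : Fin (b + 1)) : MvPolynomial (Fin (a * b + 1)) ℂ :=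
  X ⟨a * i, Nat.lt_succ_of_le (Nat.mul_le_mul_left a (Nat.lt_succ_iff.1 i.2))⟩

lemma isHomogeneous_stepVar (i : Fin (b + 1)) : (stepVar a b i).IsHomogeneous 1 :=
  isHomogeneous_X ℂ _

lemma FH_stepVar (i : Fin (b + 1)) : FH a b (stepVar a b i) = coeffC a b (a * i) := by
  rw [stepVar, FH, aeval_X]

lemma FH_stepVar_ne_zero (i : Fin (b + 1)) : FH a b (stepVar a b i) ≠ 0 := by
  intro h
  have h1 := coeff_single_coeffC a b i
  rw [← FH_stepVar, h, coeff_zero] at h1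
  exact zero_ne_one h1

lemma eq_zero_of_FH_eq_zero_of_le (ha : a ≠ 0) (hb : b ≠ 0) {r : ℕ} (hr : r ≤ b)
    {p : MvPolynomial (Fin (a * b + 1)) ℂ} (hp : p.IsHomogeneous r) (h : FH a b p = 0) :
    p = 0 := by
  have h1 : stepVar a b 0 ^ (b - r) * p = 0 := by
    refine eq_zero_of_FH_eq_zero ha hb ?_ (by rw [map_mul, h, mul_zero])
    have h2 := ((isHomogeneous_stepVar 0).pow (b - r)).mul hp
    rwa [one_mul, Nat.sub_add_cancel hr] at h2
  refine (mul_eq_zero.1 h1).resolve_left (pow_ne_zero _ fun h2 => ?_)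
  exact FH_stepVar_ne_zero (a := a) (b := b) 0 (by rw [h2, map_zero])

lemma exists_sum_FH_stepVar_mul (ha : a ≠ 0) {r : ℕ} (hr : b ≤ r)
    {q : MvPolynomial (Fin (b + 1)) ℂ} (hq : q.IsHomogeneous (a * (r + 1))) :
    ∃ y : Fin (b + 1) → MvPolynomial (Fin (b + 1)) ℂ,
      (∀ i, (y i).IsHomogeneous (a * r)) ∧ q = ∑ i, FH a b (stepVar a b i) * y i := by
  have hm : (a - 1) * Fintype.card (Fin (b + 1)) < a * (r + 1) := by
    rw [Fintype.card_fin]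
    exact Nat.mul_lt_mul_of_lt_of_le (Nat.sub_one_lt ha) (Nat.succ_le_succ hr) (Nat.succ_pos r)
  obtain ⟨y, hy, h⟩ := exists_sum_mul_of_hasLeading ha (hasLeading_coeffC a b)
    (fun i => isHomogeneous_coeffC a b (a * i)) hm hq
  refine ⟨y, fun i => ?_, ?_⟩
  · have h1 := hy i
    rwa [mul_add, mul_one, Nat.add_sub_cancel] at h1
  · simp only [FH_stepVar]
    exact h

lemma exists_FH_eq_of_le (ha : a ≠ 0) (hb : b ≠ 0) (r : ℕ) (hr : b ≤ r) :
    ∀ q : MvPolynomial (Fin (b + 1)) ℂ, q.IsHomogeneous (a * r) →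
      ∃ p, p.IsHomogeneous r ∧ FH a b p = q := by
  induction r, hr using Nat.le_induction with
  | base => exact fun q hq => exists_FH_eq_of_isHomogeneous ha hb hq
  | succ r hr ih =>
    intro q hq
    obtain ⟨y, hy, h⟩ := exists_sum_FH_stepVar_mul ha hr hq
    choose p hp hpy using fun i => ih (y i) (hy i)
    refine ⟨∑ i, stepVar a b i * p i, IsHomogeneous.sum _ _ _ fun i _ => ?_, ?_⟩
    · have h1 := (isHomogeneous_stepVar i).mul (hp i)
      rwa [add_comm 1 r] at h1
    · rw [map_sum, h]
      exact Finset.sum_congr rfl fun i _ => by rw [map_mul, hpy]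

lemma exists_koszul_FH_stepVar (ha : a ≠ 0) (p : Fin (b + 1) → MvPolynomial (Fin (b + 1)) ℂ)
    (hp : ∑ i, FH a b (stepVar a b i) * p i = 0) :
    ∃ T : Fin (b + 1) → Fin (b + 1) → MvPolynomial (Fin (b + 1)) ℂ,
      ∀ i, p i = ∑ j, FH a b (stepVar a b j) * (T i j - T j i) := by
  simp only [FH_stepVar] at hp ⊢
  exact exists_koszul_fin (fun i : Fin (b + 1) => coeffC a b (a * i))
    (fun i x hx => mem_span_of_mul_mem_of_hasLeading ha (hasLeading_coeffC a b)
      (fun i => isHomogeneous_coeffC a b (a * i)) (fun h => lt_irrefl i h) hx) p hp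

end FoulkesHowe

/-- For `a, b ≥ 2`, the ideal `I(X) = ker α` is generated by its degree-`(b+1)`
homogeneous component. -/
theorem kernel_FH_generated_in_degree_b_add_one (a b : ℕ) (ha : 2 ≤ a) (hb : 2 ≤ b) :
    RingHom.ker (FH a b).toRingHom =
      Ideal.span {P : MvPolynomial (Fin (a * b + 1)) ℂ |
        P.IsHomogeneous (b + 1) ∧ FH a b P = 0} := by
  have ha' : a ≠ 0 := by omega
  have hb' : b ≠ 0 := by omega
  exact ker_eq_span_of_koszul ha' (fun n p hp => isHomogeneous_FH hp)
    isHomogeneous_stepVar (fun r hr p hp h => eq_zero_of_FH_eq_zero_of_le ha' hb' hr hp h)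
    (exists_FH_eq_of_le ha' hb') (exists_koszul_FH_stepVar ha')
    (fun q hq => exists_sum_FH_stepVar_mul ha' le_rfl hq)
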